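/- Limit of the mutual information: For every λ > 0, (1/n)·I((U,V); Y) converges as n → ∞ to (λ/2)·E[U²]·E[V²] − sup_{(q₁,q₂) ∈ Γ(λ)} 𝓕(λ,q₁,q₂), where U ∼ P_U and V ∼ P_V. -/

import Mathlib

open MeasureTheory ProbabilityTheory Filter Real
open scoped Topology

noncomputable section

/-- Standard Gaussian measure on `ℝ`. -/
def stdG : Measure ℝ := gaussianReal 0 1

/-- The weight `exp(√γ·x·z + γ·x·x₀ − γ·x²/2)` appearing in the scalar Gaussian channel. -/
def scalarWeight (γ x₀ z x : ℝ) : ℝ :=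
  Real.exp (Real.sqrt γ * x * z + γ * x * x₀ - γ * x ^ 2 / 2)

/-- Free energy `ψ_P(γ)` of the scalar Gaussian channel with prior `P`. -/
def psiF (P : Measure ℝ) [IsProbabilityMeasure P] (γ : ℝ) : ℝ :=
  ∫ p : ℝ × ℝ, Real.log (∫ x, scalarWeight γ p.1 p.2 x ∂P) ∂(P.prod stdG)

/-- Posterior mean `⟨x⟩_γ` in the scalar Gaussian channel (`x₀` is the signal, `z` the noise). -/
def postMean (P : Measure ℝ) (γ x₀ z : ℝ) : ℝ :=
  (∫ x, x * scalarWeight γ x₀ z x ∂P) / (∫ x, scalarWeight γ x₀ z x ∂P)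

/-- Overlap `F_P(γ) = E[X₀·⟨x⟩_γ]` of the scalar Gaussian channel. -/
def Fov (P : Measure ℝ) [IsProbabilityMeasure P] (γ : ℝ) : ℝ :=
  ∫ p : ℝ × ℝ, p.1 * postMean P γ p.1 p.2 ∂(P.prod stdG)

/-- The set `Γ(λ)` of fixed points of the state evolution equations. -/
def Gam (PU PV : Measure ℝ) [IsProbabilityMeasure PU] [IsProbabilityMeasure PV]
    (lam : ℝ) : Set (ℝ × ℝ) :=
  {q | 0 ≤ q.1 ∧ 0 ≤ q.2 ∧ q.2 = Fov PU (lam * q.1) ∧ q.1 = Fov PV (lam * q.2)}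

/-- The replica-symmetric potential `𝓕(λ,q₁,q₂)`. -/
def rsF (PU PV : Measure ℝ) [IsProbabilityMeasure PU] [IsProbabilityMeasure PV]
    (lam q₁ q₂ : ℝ) : ℝ :=
  psiF PU (lam * q₁) + psiF PV (lam * q₂) - lam / 2 * q₁ * q₂

/-- Prior distribution of the pair of vectors `(u,v)`. -/
def prior (PU PV : Measure ℝ) [IsProbabilityMeasure PU] [IsProbabilityMeasure PV]
    (n : ℕ) : Measure ((Fin n → ℝ) × (Fin n → ℝ)) :=
  (Measure.pi fun _ => PU).prod (Measure.pi fun _ => PV)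

/-- Law of the Gaussian noise matrix `Z`. -/
def noiseM (n : ℕ) : Measure (Fin n → Fin n → ℝ) :=
  Measure.pi fun _ => Measure.pi fun _ => stdG

/-- Joint law of `((U,V),Z)`. -/
def sampleM (PU PV : Measure ℝ) [IsProbabilityMeasure PU] [IsProbabilityMeasure PV]
    (n : ℕ) : Measure (((Fin n → ℝ) × (Fin n → ℝ)) × (Fin n → Fin n → ℝ)) :=
  (prior PU PV n).prod (noiseM n)

/-- Hamiltonian `H_n(u,v)` of the planted bipartite model. -/
def Ham (lam : ℝ) (n : ℕ) (U V : Fin n → ℝ) (Z : Fin n → Fin n → ℝ)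
    (u v : Fin n → ℝ) : ℝ :=
  ∑ i : Fin n, ∑ j : Fin n,
    (Real.sqrt (lam / n) * u i * v j * Z i j
      + lam / n * (u i * U i * v j * V j)
      - lam / (2 * n) * (u i ^ 2 * v j ^ 2))

/-- Partition function `Z_n = ∫ e^{H_n(u,v)} dP₀ⁿ(u,v)`. -/
def partFun (PU PV : Measure ℝ) [IsProbabilityMeasure PU] [IsProbabilityMeasure PV]
    (lam : ℝ) (n : ℕ)
    (ω : ((Fin n → ℝ) × (Fin n → ℝ)) × (Fin n → Fin n → ℝ)) : ℝ :=
  ∫ uv, Real.exp (Ham lam n ω.1.1 ω.1.2 ω.2 uv.1 uv.2) ∂(prior PU PV n)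

/-- Free energy `F_n(λ) = (1/n)·E[log Z_n]`. -/
def freeEnergy (PU PV : Measure ℝ) [IsProbabilityMeasure PU] [IsProbabilityMeasure PV]
    (n : ℕ) (lam : ℝ) : ℝ :=
  (1 / (n : ℝ)) * ∫ ω, Real.log (partFun PU PV lam n ω) ∂(sampleM PU PV n)

/-- Gibbs (posterior) expectation `⟨f(u,v)⟩` given the realization `ω = ((U,V),Z)`. -/
def gibbs (PU PV : Measure ℝ) [IsProbabilityMeasure PU] [IsProbabilityMeasure PV]
    (lam : ℝ) (n : ℕ)
    (ω : ((Fin n → ℝ) × (Fin n → ℝ)) × (Fin n → Fin n → ℝ))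
    (f : (Fin n → ℝ) × (Fin n → ℝ) → ℝ) : ℝ :=
  (∫ uv, f uv * Real.exp (Ham lam n ω.1.1 ω.1.2 ω.2 uv.1 uv.2) ∂(prior PU PV n))
    / partFun PU PV lam n ω

/-- Rescaled scalar product `x·y = (1/n)·Σᵢ xᵢyᵢ`. -/
def ovDot (n : ℕ) (x y : Fin n → ℝ) : ℝ := (1 / (n : ℝ)) * ∑ i, x i * y i

/-- Observation matrix `Y_{ij} = √(λ/n)·U_i·V_j + Z_{ij}`. -/
def Ymat (lam : ℝ) (n : ℕ)
    (ω : ((Fin n → ℝ) × (Fin n → ℝ)) × (Fin n → Fin n → ℝ)) : Fin n → Fin n → ℝ :=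
  fun i j => Real.sqrt (lam / n) * ω.1.1 i * ω.1.2 j + ω.2 i j

/-- Density of `Y` given `(u,v)` (product of Gaussian densities). -/
def condDens (lam : ℝ) (n : ℕ) (u v : Fin n → ℝ) (y : Fin n → Fin n → ℝ) : ℝ :=
  ∏ i : Fin n, ∏ j : Fin n,
    Real.exp (-(y i j - Real.sqrt (lam / n) * u i * v j) ^ 2 / 2) / Real.sqrt (2 * Real.pi)

/-- Mutual information `I((U,V);Y) = E[log (p(Y|U,V) / p(Y))]`. -/
def mutInfo (PU PV : Measure ℝ) [IsProbabilityMeasure PU] [IsProbabilityMeasure PV]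
    (lam : ℝ) (n : ℕ) : ℝ :=
  ∫ ω, Real.log (condDens lam n ω.1.1 ω.1.2 (Ymat lam n ω)
      / ∫ uv, condDens lam n uv.1 uv.2 (Ymat lam n ω) ∂(prior PU PV n))
    ∂(sampleM PU PV n)


set_option linter.all false


set_option linter.unusedSectionVars false

namespace MI

instance instProbStdG : IsProbabilityMeasure stdG := by unfold stdG; infer_instance

/-- Standard Gaussian measure on `ι → ℝ`. -/
def gM (ι : Type) [Fintype ι] : Measure (ι → ℝ) := Measure.pi fun _ => stdG

instance instProbGM (ι : Type) [Fintype ι] : IsProbabilityMeasure (gM ι) := by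
  unfold gM; infer_instance

lemma integrable_exp_abs (C : ℝ) : Integrable (fun x : ℝ => Real.exp (C * |x|)) stdG := by
  have h1 : Integrable (fun x : ℝ => Real.exp (C * x)) stdG := integrable_exp_mul_gaussianReal C
  have h2 : Integrable (fun x : ℝ => Real.exp (-C * x)) stdG :=
    integrable_exp_mul_gaussianReal (-C)
  refine (h1.add h2).mono' (by fun_prop) (Eventually.of_forall fun x => ?_)
  rw [Real.norm_eq_abs, abs_of_pos (Real.exp_pos _)]
  simp only [Pi.add_apply]
  rcases abs_cases x with ⟨h, _⟩ | ⟨h, _⟩ <;> rw [h]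
  · linarith [Real.exp_pos (-C * x)]
  · have : C * -x = -C * x := by ring
    rw [this]; linarith [Real.exp_pos (C * x)]

lemma integrable_exp_sum {ι : Type} [Fintype ι] (C : ℝ) :
    Integrable (fun y : ι → ℝ => Real.exp (C * ∑ k, |y k|)) (gM ι) := by
  have : (fun y : ι → ℝ => Real.exp (C * ∑ k, |y k|)) = fun y => ∏ k, Real.exp (C * |y k|) := by
    ext y; rw [Finset.mul_sum, Real.exp_sum]
  rw [this]
  exact Integrable.fintype_prod (fun _ => integrable_exp_abs C)

/-- One-dimensional change of density. -/
lemma integral_gaussianReal_shift (c : ℝ) (g : ℝ → ℝ) :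
    ∫ x, g x ∂(gaussianReal c 1) = ∫ x, Real.exp (c * x - c ^ 2 / 2) * g x ∂stdG := by
  unfold stdG
  rw [integral_gaussianReal_eq_integral_smul (by norm_num),
    integral_gaussianReal_eq_integral_smul (by norm_num)]
  congr 1; ext x
  simp only [gaussianPDFReal, smul_eq_mul, NNReal.coe_one]
  have : Real.exp (-(x - c) ^ 2 / (2 * 1))
      = Real.exp (-(x - 0) ^ 2 / (2 * 1)) * Real.exp (c * x - c ^ 2 / 2) := by
    rw [← Real.exp_add]; congr 1; ring
  rw [this]; ring

lemma stdG_map_add (c : ℝ) : stdG.map (fun x => x + c) = gaussianReal c 1 := by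
  unfold stdG; rw [gaussianReal_map_add_const]; simp

lemma gM_map_add {ι : Type} [Fintype ι] (c : ι → ℝ) :
    (gM ι).map (fun y => y + c) =
      (gM ι).withDensity
        (fun y => ENNReal.ofReal (Real.exp (∑ k, (c k * y k - c k ^ 2 / 2)))) := by
  have h1 : (gM ι).map (fun y => y + c) = Measure.pi fun k => gaussianReal (c k) 1 := by
    have := Measure.pi_map_pi (μ := fun _ : ι => stdG) (f := fun k x => x + c k)
      (fun i => by fun_prop)
    simp only [stdG_map_add] at this
    rw [← this]; rfl
  rw [h1]
  refine Measure.pi_eq (fun s hs => ?_)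
  rw [withDensity_apply _ (MeasurableSet.univ_pi hs)]
  have h_integ : Integrable (fun y : ι → ℝ => Real.exp (∑ k, (c k * y k - c k ^ 2 / 2))) (gM ι) := by
    simp_rw [Real.exp_sum]
    refine Integrable.fintype_prod (f := fun k x => Real.exp (c k * x - c k ^ 2 / 2))
      (fun k => ?_)
    simp_rw [Real.exp_sub]
    exact (integrable_exp_mul_gaussianReal (c k)).div_const _
  rw [← ofReal_integral_eq_lintegral_ofReal h_integ.integrableOn
    (Eventually.of_forall fun y => (Real.exp_pos _).le),
    ← integral_indicator (MeasurableSet.univ_pi hs)]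
  have h2 : ∀ y : ι → ℝ, (Set.univ.pi s).indicator
      (fun y : ι → ℝ => Real.exp (∑ k, (c k * y k - c k ^ 2 / 2))) y
      = ∏ k, (s k).indicator (fun x => Real.exp (c k * x - c k ^ 2 / 2)) (y k) := by
    intro y
    by_cases hy : y ∈ Set.univ.pi s
    · rw [Set.indicator_of_mem hy, Real.exp_sum]
      refine Finset.prod_congr rfl fun k _ => ?_
      rw [Set.indicator_of_mem (hy k (Set.mem_univ k))]
    · rw [Set.indicator_of_notMem hy]
      simp only [Set.mem_pi, Set.mem_univ, true_implies, not_forall] at hy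
      obtain ⟨k, hk⟩ := hy
      rw [Finset.prod_eq_zero (Finset.mem_univ k)]
      rw [Set.indicator_of_notMem hk]
  simp_rw [h2]
  unfold gM
  rw [integral_fintype_prod_eq_prod
    (fun k x => (s k).indicator (fun x => Real.exp (c k * x - c k ^ 2 / 2)) x),
    ENNReal.ofReal_prod_of_nonneg]
  · refine Finset.prod_congr rfl fun k _ => ?_
    have h3 := integral_gaussianReal_shift (c k) ((s k).indicator 1)
    rw [integral_indicator_one (hs k)] at h3
    have h4 : ∫ x, (s k).indicator (fun x => Real.exp (c k * x - c k ^ 2 / 2)) x ∂stdG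
        = (gaussianReal (c k) 1).real (s k) := by
      rw [h3]; congr 1; ext x
      by_cases hx : x ∈ s k <;> simp [hx]
    rw [h4, measureReal_def, ENNReal.ofReal_toReal (measure_ne_top _ _)]
  · intro k _
    refine integral_nonneg fun x => ?_
    exact Set.indicator_nonneg (fun _ _ => (Real.exp_pos _).le) _

/-- Cameron–Martin. -/
lemma gM_shift {ι : Type} [Fintype ι] (c : ι → ℝ) (g : (ι → ℝ) → ℝ) (hg : Measurable g) :
    ∫ z, g (z + c) ∂(gM ι) = ∫ y, Real.exp (∑ k, (c k * y k - c k ^ 2 / 2)) * g y ∂(gM ι) := by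
  have h1 : ∫ z, g (z + c) ∂(gM ι) = ∫ y, g y ∂((gM ι).map (fun y => y + c)) := by
    rw [integral_map (by fun_prop) hg.aestronglyMeasurable]
  rw [h1, gM_map_add, integral_withDensity_eq_integral_toReal_smul (by fun_prop)
    (Eventually.of_forall fun y => ENNReal.ofReal_lt_top)]
  congr 1; ext y
  rw [ENNReal.toReal_ofReal (Real.exp_pos _).le, smul_eq_mul]

/-- Resampling one coordinate preserves the Gaussian measure. -/
lemma gM_resample {ι : Type} [Fintype ι] [DecidableEq ι] (k : ι) :
    MeasurePreserving (fun p : (ι → ℝ) × ℝ => Function.update p.1 k p.2)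
      ((gM ι).prod stdG) (gM ι) := by
  have hm : Measurable (fun p : (ι → ℝ) × ℝ => Function.update p.1 k p.2) := by
    rw [measurable_pi_iff]
    intro j
    by_cases h : j = k
    · subst h; simpa using measurable_snd
    · simp only [Function.update_of_ne h]; fun_prop
  refine ⟨hm, ?_⟩
  refine (Measure.pi_eq (fun s hs => ?_)).symm
  rw [Measure.map_apply hm (MeasurableSet.univ_pi hs)]
  have : (fun p : (ι → ℝ) × ℝ => Function.update p.1 k p.2) ⁻¹' (Set.univ.pi s)
      = (Set.univ.pi (Function.update s k Set.univ)) ×ˢ (s k) := by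
    ext p
    simp only [Set.mem_preimage, Set.mem_pi, Set.mem_univ, true_implies, Set.mem_prod]
    constructor
    · intro h
      refine ⟨fun j => ?_, by simpa using h k⟩
      by_cases hj : j = k
      · subst hj; simp
      · simpa [Function.update_of_ne hj] using h j
    · rintro ⟨h1, h2⟩ j
      by_cases hj : j = k
      · subst hj; simpa using h2
      · simpa [Function.update_of_ne hj] using h1 j
  rw [this, Measure.prod_prod]
  unfold gM
  rw [Measure.pi_pi, ← Finset.mul_prod_erase _ _ (Finset.mem_univ k),
    ← Finset.mul_prod_erase _ (fun i => stdG (s i)) (Finset.mem_univ k)]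
  simp only [Function.update_self, measure_univ, one_mul]
  rw [mul_comm]
  congr 1
  refine Finset.prod_congr rfl fun j hj => ?_
  rw [Function.update_of_ne (Finset.ne_of_mem_erase hj)]

/-- One-dimensional Gaussian integration by parts. -/
lemma stein_one (g g' : ℝ → ℝ) (hg : ∀ x, HasDerivAt g (g' x) x) (hg'c : Continuous g')
    (C : ℝ) (h1 : ∀ x, |g x| ≤ C * Real.exp (C * |x|))
    (h2 : ∀ x, |g' x| ≤ C * Real.exp (C * |x|)) :
    ∫ x, x * g x ∂stdG = ∫ x, g' x ∂stdG := by
  have hgc : Continuous g := continuous_iff_continuousAt.2 fun x => (hg x).continuousAt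
  have hC0 : 0 ≤ C := by
    have := (abs_nonneg _).trans (h1 0)
    simpa using this
  have i1 : Integrable g stdG := ((integrable_exp_abs C).const_mul C).mono'
    hgc.aestronglyMeasurable (Eventually.of_forall fun x => by simpa using h1 x)
  have i2 : Integrable g' stdG := ((integrable_exp_abs C).const_mul C).mono'
    hg'c.aestronglyMeasurable (Eventually.of_forall fun x => by simpa using h2 x)
  have i3 : Integrable (fun x => x * g x) stdG := by
    refine ((integrable_exp_abs (C + 1)).const_mul C).mono'
      (by fun_prop) (Eventually.of_forall fun x => ?_)
    rw [Real.norm_eq_abs, abs_mul]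
    have e1 : |x| ≤ Real.exp |x| := by linarith [Real.add_one_le_exp |x|]
    calc |x| * |g x| ≤ Real.exp |x| * (C * Real.exp (C * |x|)) := by
          gcongr
          exact h1 x
      _ = C * Real.exp ((C + 1) * |x|) := by
          rw [add_mul, Real.exp_add, one_mul]; ring
  have conv : ∀ f : ℝ → ℝ, Integrable f stdG → Integrable (fun x => gaussianPDFReal 0 1 x * f x) := by
    intro f hf
    unfold stdG at hf
    rw [gaussianReal_of_var_ne_zero _ (by norm_num),
      integrable_withDensity_iff_integrable_smul' (by fun_prop)
      (Eventually.of_forall fun x => gaussianPDF_lt_top)] at hf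
    simpa [toReal_gaussianPDF] using hf
  have conv2 : ∀ f : ℝ → ℝ, ∫ x, f x ∂stdG = ∫ x, gaussianPDFReal 0 1 x * f x := by
    intro f; unfold stdG
    rw [integral_gaussianReal_eq_integral_smul (by norm_num)]; rfl
  have hp : ∀ x, HasDerivAt (gaussianPDFReal 0 1) (-(x * gaussianPDFReal 0 1 x)) x := by
    intro x
    have e1 : HasDerivAt (fun x : ℝ => -(x - 0) ^ 2 / (2 * ((1 : NNReal) : ℝ))) (-x) x := by
      have := (((hasDerivAt_id x).sub_const 0).pow 2).neg.div_const (2 * ((1 : NNReal) : ℝ))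
      refine this.congr_deriv ?_
      simp only [NNReal.coe_one, id]; ring
    have := (e1.exp).const_mul ((√(2 * Real.pi * ((1 : NNReal) : ℝ)))⁻¹)
    have h0 : gaussianPDFReal 0 1 = fun x => (√(2 * Real.pi * ((1 : NNReal) : ℝ)))⁻¹ *
        Real.exp (-(x - 0) ^ 2 / (2 * ((1 : NNReal) : ℝ))) := rfl
    rw [h0]
    refine this.congr_deriv ?_
    ring
  rw [conv2, conv2]
  have := integral_mul_deriv_eq_deriv_mul_of_integrable (u := g) (u' := g')
    (v := gaussianPDFReal 0 1) (v' := fun x => -(x * gaussianPDFReal 0 1 x))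
    (fun x _ => hg x) (fun x _ => hp x) ?_ ?_ ?_
  · have e1 : ∫ x, gaussianPDFReal 0 1 x * (x * g x)
      = - ∫ x, g x * -(x * gaussianPDFReal 0 1 x) := by
      rw [← integral_neg]; congr 1; ext x; ring
    rw [e1, this, neg_neg]; congr 1; ext x; ring
  · refine (conv _ i3).neg.congr (Eventually.of_forall fun x => ?_)
    simp only [Pi.mul_apply, Pi.neg_apply]; ring
  · refine (conv _ i2).congr (Eventually.of_forall fun x => ?_)
    simp only [Pi.mul_apply]; ring
  · refine (conv _ i1).congr (Eventually.of_forall fun x => ?_)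
    simp only [Pi.mul_apply]; ring

/-- exponential growth -/
def EG {ι : Type} [Fintype ι] (f : (ι → ℝ) → ℝ) : Prop :=
  ∃ C : ℝ, 0 ≤ C ∧ ∀ y, |f y| ≤ C * Real.exp (C * ∑ k, |y k|)

lemma EG.integrable {ι : Type} [Fintype ι] {f : (ι → ℝ) → ℝ} (h : EG f) (hf : Measurable f) :
    Integrable f (gM ι) := by
  obtain ⟨C, _, hC⟩ := h
  exact ((integrable_exp_sum C).const_mul C).mono' hf.aestronglyMeasurable
    (Eventually.of_forall fun x => by simpa using hC x)

/-- Gaussian integration by parts in several variables. -/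
lemma stein {ι : Type} [Fintype ι] [DecidableEq ι] (k : ι) (g g' : (ι → ℝ) → ℝ)
    (hg : ∀ y, HasDerivAt (fun t => g (Function.update y k t)) (g' y) (y k))
    (hgc : Continuous g) (hg'c : Continuous g') (h1 : EG g) (h2 : EG g') :
    ∫ y, y k * g y ∂(gM ι) = ∫ y, g' y ∂(gM ι) := by
  obtain ⟨C1, hC1, h1'⟩ := h1
  obtain ⟨C2, hC2, h2'⟩ := h2
  have upc : ∀ y : ι → ℝ, Continuous fun t : ℝ => Function.update y k t := by
    intro y; exact continuous_const.update k continuous_id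
  have i1 : Integrable (fun y => y k * g y) (gM ι) := by
    refine EG.integrable ⟨C1 + 1, by linarith, fun y => ?_⟩ (by fun_prop)
    have e1 : |y k| ≤ Real.exp (∑ k, |y k|) := by
      have : |y k| ≤ ∑ k, |y k| :=
        Finset.single_le_sum (f := fun k => |y k|) (fun _ _ => abs_nonneg _) (Finset.mem_univ k)
      linarith [Real.add_one_le_exp (∑ k, |y k|)]
    rw [abs_mul]
    calc |y k| * |g y| ≤ Real.exp (∑ k, |y k|) * (C1 * Real.exp (C1 * ∑ k, |y k|)) := by
          gcongr
          exact h1' y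
      _ = C1 * Real.exp ((C1 + 1) * ∑ k, |y k|) := by
          rw [add_mul, Real.exp_add, one_mul]; ring
      _ ≤ (C1 + 1) * Real.exp ((C1 + 1) * ∑ k, |y k|) := by gcongr; linarith
  have i2 : Integrable g' (gM ι) := EG.integrable ⟨C2, hC2, h2'⟩ hg'c.measurable
  have mp := gM_resample k
  rw [← mp.map_eq, integral_map mp.measurable.aemeasurable (by rw [mp.map_eq]; exact i1.1),
    integral_map mp.measurable.aemeasurable (by rw [mp.map_eq]; exact i2.1)]
  have j1 : Integrable (fun x : (ι → ℝ) × ℝ =>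
      Function.update x.1 k x.2 k * g (Function.update x.1 k x.2)) ((gM ι).prod stdG) :=
    mp.integrable_comp_of_integrable i1
  have j2 : Integrable (fun x : (ι → ℝ) × ℝ => g' (Function.update x.1 k x.2))
      ((gM ι).prod stdG) := mp.integrable_comp_of_integrable i2
  rw [integral_prod _ j1, integral_prod _ j2]
  congr 1; ext y
  simp only [Function.update_self]
  have hsum : ∀ t : ℝ, ∑ j, |Function.update y k t j| ≤ |t| + ∑ j, |y j| := by
    intro t
    rw [← Finset.add_sum_erase _ _ (Finset.mem_univ k),
      ← Finset.add_sum_erase _ (fun j => |y j|) (Finset.mem_univ k)]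
    have : ∑ x ∈ Finset.univ.erase k, |Function.update y k t x|
        = ∑ x ∈ Finset.univ.erase k, |y x| :=
      Finset.sum_congr rfl fun j hj => by
        rw [Function.update_of_ne (Finset.ne_of_mem_erase hj)]
    rw [this, Function.update_self]
    linarith [abs_nonneg (y k)]
  set T := ∑ j, |y j|
  have hT : 0 ≤ T := Finset.sum_nonneg fun _ _ => abs_nonneg _
  set C := (C1 + C2) * Real.exp ((C1 + C2) * T) with hCdef
  have hbig : ∀ D, 0 ≤ D → D ≤ C1 + C2 → ∀ t : ℝ, D * Real.exp (D * ∑ j, |Function.update y k t j|)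
      ≤ C * Real.exp (C * |t|) := by
    intro D hD hD2 t
    have hs := hsum t
    have hle : C1 + C2 ≤ C := by
      rw [hCdef]
      have : 1 ≤ Real.exp ((C1 + C2) * T) := Real.one_le_exp (by positivity)
      nlinarith
    calc D * Real.exp (D * ∑ j, |Function.update y k t j|)
        ≤ (C1 + C2) * Real.exp ((C1 + C2) * (|t| + T)) := by gcongr
      _ = C * Real.exp ((C1 + C2) * |t|) := by
          rw [hCdef, mul_add, Real.exp_add]; ring
      _ ≤ C * Real.exp (C * |t|) := by gcongr
  refine stein_one (fun t => g (Function.update y k t)) (fun t => g' (Function.update y k t))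
    (fun t => ?_) (hg'c.comp (upc y)) C (fun t => ?_) (fun t => ?_)
  · have := hg (Function.update y k t)
    simpa using this
  · exact (h1' _).trans (hbig C1 hC1 (by linarith) t)
  · exact (h2' _).trans (hbig C2 hC2 (by linarith) t)

end MI


namespace MI

/-- Abstract finite model: prior weights `w` and features `φ`. -/
structure Mdl (X ι : Type) [Fintype X] where
  w : X → ℝ
  w0 : ∀ x, 0 ≤ w x
  w1 : ∑ x, w x = 1
  φ : ι → X → ℝ

variable {X ι : Type} [Fintype X] [Fintype ι]

/-- Functions of (amplitude, observation) that are continuous with locally uniform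
exponential growth. -/
def Nice (G : (ι → ℝ) → (ι → ℝ) → ℝ) : Prop :=
  Continuous (fun p : (ι → ℝ) × (ι → ℝ) => G p.1 p.2) ∧
    ∀ R : ℝ, 0 ≤ R → ∃ C : ℝ, 0 ≤ C ∧ ∀ r : ι → ℝ, (∀ k, |r k| ≤ R) →
      ∀ y, |G r y| ≤ C * Real.exp (C * ∑ k, |y k|)

lemma sum_abs_nonneg' (y : ι → ℝ) : 0 ≤ ∑ k, |y k| := Finset.sum_nonneg fun _ _ => abs_nonneg _

lemma Nice.cont {G : (ι → ℝ) → (ι → ℝ) → ℝ} (h : Nice G) (r : ι → ℝ) : Continuous (G r) :=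
  h.1.comp (Continuous.prodMk_right r)

lemma exists_bd (r : ι → ℝ) : ∃ R : ℝ, 0 ≤ R ∧ ∀ k, |r k| ≤ R :=
  ⟨∑ k, |r k|, sum_abs_nonneg' r, fun k =>
    Finset.single_le_sum (f := fun k => |r k|) (fun _ _ => abs_nonneg _) (Finset.mem_univ k)⟩

lemma Nice.eg {G : (ι → ℝ) → (ι → ℝ) → ℝ} (h : Nice G) (r : ι → ℝ) : EG (G r) := by
  obtain ⟨R, hR, hr⟩ := exists_bd r
  obtain ⟨C, hC, h2⟩ := h.2 R hR
  exact ⟨C, hC, h2 r hr⟩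

lemma Nice.integrable {G : (ι → ℝ) → (ι → ℝ) → ℝ} (h : Nice G) (r : ι → ℝ) :
    Integrable (G r) (gM ι) := (h.eg r).integrable (h.cont r).measurable

lemma Nice.const (c : ℝ) : Nice (fun _ _ : ι → ℝ => c) := by
  refine ⟨continuous_const, fun R _ => ⟨|c|, abs_nonneg _, fun r _ y => ?_⟩⟩
  have : 1 ≤ Real.exp (|c| * ∑ k, |y k|) :=
    Real.one_le_exp (mul_nonneg (abs_nonneg _) (sum_abs_nonneg' y))
  nlinarith [abs_nonneg c]

lemma Nice.add {G H : (ι → ℝ) → (ι → ℝ) → ℝ} (hG : Nice G) (hH : Nice H) :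
    Nice (fun r y => G r y + H r y) := by
  refine ⟨hG.1.add hH.1, fun R hR => ?_⟩
  obtain ⟨C, hC, h1⟩ := hG.2 R hR
  obtain ⟨D, hD, h2⟩ := hH.2 R hR
  refine ⟨C + D, by positivity, fun r hr y => ?_⟩
  have hy := sum_abs_nonneg' y
  calc |G r y + H r y| ≤ |G r y| + |H r y| := abs_add_le _ _
    _ ≤ C * Real.exp (C * ∑ k, |y k|) + D * Real.exp (D * ∑ k, |y k|) :=
        add_le_add (h1 r hr y) (h2 r hr y)
    _ ≤ C * Real.exp ((C + D) * ∑ k, |y k|) + D * Real.exp ((C + D) * ∑ k, |y k|) := by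
        gcongr <;> linarith
    _ = _ := by ring

lemma Nice.mul {G H : (ι → ℝ) → (ι → ℝ) → ℝ} (hG : Nice G) (hH : Nice H) :
    Nice (fun r y => G r y * H r y) := by
  refine ⟨hG.1.mul hH.1, fun R hR => ?_⟩
  obtain ⟨C, hC, h1⟩ := hG.2 R hR
  obtain ⟨D, hD, h2⟩ := hH.2 R hR
  refine ⟨C * D + C + D, by positivity, fun r hr y => ?_⟩
  have hy := sum_abs_nonneg' y
  rw [abs_mul]
  calc |G r y| * |H r y|
      ≤ (C * Real.exp (C * ∑ k, |y k|)) * (D * Real.exp (D * ∑ k, |y k|)) := by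
        gcongr
        · exact h1 r hr y
        · exact h2 r hr y
    _ = (C * D) * Real.exp ((C + D) * ∑ k, |y k|) := by rw [add_mul, Real.exp_add]; ring
    _ ≤ (C * D + C + D) * Real.exp ((C * D + C + D) * ∑ k, |y k|) := by
        have : 0 ≤ C * D := by positivity
        gcongr <;> linarith

lemma Nice.sum {α : Type} (s : Finset α) {G : α → (ι → ℝ) → (ι → ℝ) → ℝ}
    (h : ∀ a ∈ s, Nice (G a)) : Nice (fun r y => ∑ a ∈ s, G a r y) := by
  classical
  induction s using Finset.induction_on with
  | empty => simpa using Nice.const 0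
  | insert a s ha ih =>
    simp only [Finset.sum_insert ha]
    exact (h a (Finset.mem_insert_self a s)).add
      (ih fun b hb => h b (Finset.mem_insert_of_mem hb))

lemma Nice.pow2 {G : (ι → ℝ) → (ι → ℝ) → ℝ} (hG : Nice G) : Nice (fun r y => G r y ^ 2) := by
  simpa only [pow_two] using hG.mul hG

lemma Nice.neg {G : (ι → ℝ) → (ι → ℝ) → ℝ} (hG : Nice G) : Nice (fun r y => - G r y) := by
  simpa using (Nice.const (-1)).mul hG

lemma Nice.sub {G H : (ι → ℝ) → (ι → ℝ) → ℝ} (hG : Nice G) (hH : Nice H) :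
    Nice (fun r y => G r y - H r y) := by
  simpa only [sub_eq_add_neg] using hG.add hH.neg

lemma Nice.coordY (k : ι) : Nice (fun _ y : ι → ℝ => y k) := by
  refine ⟨by fun_prop, fun R hR => ⟨1, zero_le_one, fun r hr y => ?_⟩⟩
  have : |y k| ≤ ∑ k, |y k| :=
    Finset.single_le_sum (f := fun k => |y k|) (fun _ _ => abs_nonneg _) (Finset.mem_univ k)
  rw [one_mul, one_mul]
  linarith [Real.add_one_le_exp (∑ k, |y k|)]

lemma Nice.coordR (k : ι) : Nice (fun r _ : ι → ℝ => r k) := by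
  refine ⟨by fun_prop, fun R hR => ⟨R, hR, fun r hr y => ?_⟩⟩
  have : 1 ≤ Real.exp (R * ∑ k, |y k|) :=
    Real.one_le_exp (mul_nonneg hR (sum_abs_nonneg' y))
  nlinarith [hr k]

lemma Nice.continuous_integral {G : (ι → ℝ) → (ι → ℝ) → ℝ} (h : Nice G) :
    Continuous (fun r => ∫ y, G r y ∂(gM ι)) := by
  rw [continuous_iff_continuousAt]
  intro r0
  obtain ⟨R, hR, hr⟩ := exists_bd r0
  obtain ⟨C, hC, h2⟩ := h.2 (R + 1) (by linarith)
  refine continuousAt_of_dominated (bound := fun y => C * Real.exp (C * ∑ k, |y k|))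
    (Eventually.of_forall fun r => (h.cont r).aestronglyMeasurable) ?_
    ((integrable_exp_sum C).const_mul C) (Eventually.of_forall fun y => ?_)
  · filter_upwards [Metric.ball_mem_nhds r0 one_pos] with r hr1
    refine Eventually.of_forall fun y => h2 r (fun k => ?_) y
    have h3 : dist (r k) (r0 k) < 1 := lt_of_le_of_lt (dist_le_pi_dist r r0 k) hr1
    rw [Real.dist_eq] at h3
    have := hr k
    have h4 : |r k| ≤ |r k - r0 k| + |r0 k| := by simpa using abs_add_le (r k - r0 k) (r0 k)
    linarith
  · exact (h.1.comp (Continuous.prodMk_left y)).continuousAt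

namespace Mdl
variable (m : Mdl X ι)

/-- exponent -/
def en (r y : ι → ℝ) (x : X) : ℝ := ∑ k, (r k * m.φ k x * y k - (r k * m.φ k x) ^ 2 / 2)

/-- likelihood ratio -/
def ex (r y : ι → ℝ) (x : X) : ℝ := Real.exp (m.en r y x)

/-- unnormalized posterior expectation -/
def S (f : X → ℝ) (r y : ι → ℝ) : ℝ := ∑ x, m.w x * f x * m.ex r y x

/-- partition function -/
def L (r y : ι → ℝ) : ℝ := ∑ x, m.w x * m.ex r y x

lemma S_one (r y : ι → ℝ) : m.S (fun _ => 1) r y = m.L r y := by simp [S, L]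

lemma ex_pos (r y : ι → ℝ) (x : X) : 0 < m.ex r y x := Real.exp_pos _

/-- bound on features -/
def B : ℝ := ∑ k, ∑ x, |m.φ k x|

lemma phi_le (k : ι) (x : X) : |m.φ k x| ≤ m.B := by
  refine (Finset.single_le_sum (f := fun x => |m.φ k x|) (fun _ _ => abs_nonneg _)
    (Finset.mem_univ x)).trans ?_
  exact Finset.single_le_sum (f := fun k => ∑ x, |m.φ k x|)
    (fun _ _ => Finset.sum_nonneg fun _ _ => abs_nonneg _) (Finset.mem_univ k)

lemma B0 : 0 ≤ m.B := Finset.sum_nonneg fun _ _ => Finset.sum_nonneg fun _ _ => abs_nonneg _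

lemma en_bd (R : ℝ) (hR : 0 ≤ R) (r : ι → ℝ) (hr : ∀ k, |r k| ≤ R) (y : ι → ℝ) (x : X) :
    |m.en r y x| ≤ R * m.B * ∑ k, |y k| + Fintype.card ι * (R * m.B) ^ 2 := by
  have hB := m.B0
  calc |m.en r y x| ≤ ∑ k, |r k * m.φ k x * y k - (r k * m.φ k x) ^ 2 / 2| :=
        Finset.abs_sum_le_sum_abs _ _
    _ ≤ ∑ k, (R * m.B * |y k| + (R * m.B) ^ 2) := by
        refine Finset.sum_le_sum fun k _ => ?_
        have h1 : |r k * m.φ k x| ≤ R * m.B := by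
          rw [abs_mul]; gcongr
          · exact hr k
          · exact m.phi_le k x
        have h2 : (r k * m.φ k x) ^ 2 ≤ (R * m.B) ^ 2 := by
          rw [← sq_abs]; gcongr
        calc _ ≤ |r k * m.φ k x * y k| + |(r k * m.φ k x) ^ 2 / 2| := abs_sub _ _
          _ ≤ R * m.B * |y k| + (R * m.B) ^ 2 := by
              rw [abs_mul]
              have h3 : |(r k * m.φ k x) ^ 2 / 2| ≤ (R * m.B) ^ 2 := by
                rw [abs_of_nonneg (by positivity)]; nlinarith [sq_nonneg (R * m.B)]
              gcongr
    _ = _ := by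
        rw [Finset.sum_add_distrib, ← Finset.mul_sum]; simp

lemma L_pos (r y : ι → ℝ) : 0 < m.L r y := by
  have h1 : 0 ≤ m.L r y := Finset.sum_nonneg fun x _ => mul_nonneg (m.w0 x) (m.ex_pos r y x).le
  refine lt_of_le_of_ne h1 fun h => ?_
  have h2 := (Finset.sum_eq_zero_iff_of_nonneg
    (fun x _ => mul_nonneg (m.w0 x) (m.ex_pos r y x).le)).1 h.symm
  have h3 : ∑ x, m.w x = 0 := Finset.sum_eq_zero fun x hx => by
    have := h2 x hx
    rcases mul_eq_zero.1 this with h | h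
    · exact h
    · exact absurd h (m.ex_pos r y x).ne'
  rw [m.w1] at h3; exact one_ne_zero h3

lemma en_cont (x : X) : Continuous (fun p : (ι → ℝ) × (ι → ℝ) => m.en p.1 p.2 x) := by
  unfold en; fun_prop

lemma nice_ex (x : X) : Nice (fun r y => m.ex r y x) := by
  refine ⟨Real.continuous_exp.comp (m.en_cont x), fun R hR => ?_⟩
  have hB := m.B0
  refine ⟨R * m.B + Real.exp (Fintype.card ι * (R * m.B) ^ 2), by positivity, fun r hr y => ?_⟩
  have hy := sum_abs_nonneg' y
  unfold ex
  rw [abs_of_pos (Real.exp_pos _)]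
  calc Real.exp (m.en r y x) ≤ Real.exp (R * m.B * ∑ k, |y k| + Fintype.card ι * (R * m.B) ^ 2) :=
        Real.exp_le_exp.2 ((le_abs_self _).trans (m.en_bd R hR r hr y x))
    _ = Real.exp (Fintype.card ι * (R * m.B) ^ 2) * Real.exp (R * m.B * ∑ k, |y k|) := by
        rw [add_comm, Real.exp_add]
    _ ≤ _ := by
        have := Real.exp_pos (Fintype.card ι * (R * m.B) ^ 2)
        have : 0 ≤ R * m.B := by positivity
        gcongr <;> linarith

lemma nice_S (f : X → ℝ) : Nice (m.S f) := by
  unfold S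
  exact Nice.sum _ fun x _ => (Nice.const _).mul (m.nice_ex x)

lemma nice_L : Nice m.L := by
  have := m.nice_S (fun _ => 1)
  have h : m.S (fun _ => 1) = m.L := by ext r y; exact m.S_one r y
  rwa [h] at this

lemma L_bd (R : ℝ) (hR : 0 ≤ R) (r : ι → ℝ) (hr : ∀ k, |r k| ≤ R) (y : ι → ℝ) :
    Real.exp (-(R * m.B * ∑ k, |y k| + Fintype.card ι * (R * m.B) ^ 2)) ≤ m.L r y ∧
    m.L r y ≤ Real.exp (R * m.B * ∑ k, |y k| + Fintype.card ι * (R * m.B) ^ 2) := by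
  set H := R * m.B * ∑ k, |y k| + Fintype.card ι * (R * m.B) ^ 2
  have h1 : ∀ c : ℝ, c = ∑ x, m.w x * c := fun c => by rw [← Finset.sum_mul, m.w1, one_mul]
  constructor
  · rw [h1 (Real.exp (-H))]
    refine Finset.sum_le_sum fun x _ => mul_le_mul_of_nonneg_left ?_ (m.w0 x)
    exact Real.exp_le_exp.2 (neg_le_of_abs_le (m.en_bd R hR r hr y x))
  · rw [h1 (Real.exp H)]
    refine Finset.sum_le_sum fun x _ => mul_le_mul_of_nonneg_left ?_ (m.w0 x)
    exact Real.exp_le_exp.2 (le_of_abs_le (m.en_bd R hR r hr y x))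

lemma nice_invL : Nice (fun r y => (m.L r y)⁻¹) := by
  refine ⟨m.nice_L.1.inv₀ fun p => (m.L_pos _ _).ne', fun R hR => ?_⟩
  have hB := m.B0
  refine ⟨R * m.B + Real.exp (Fintype.card ι * (R * m.B) ^ 2), by positivity, fun r hr y => ?_⟩
  have hy := sum_abs_nonneg' y
  rw [abs_of_pos (inv_pos.2 (m.L_pos r y))]
  calc (m.L r y)⁻¹
      ≤ (Real.exp (-(R * m.B * ∑ k, |y k| + Fintype.card ι * (R * m.B) ^ 2)))⁻¹ := by
        gcongr
        exact (m.L_bd R hR r hr y).1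
    _ = Real.exp (Fintype.card ι * (R * m.B) ^ 2) * Real.exp (R * m.B * ∑ k, |y k|) := by
        rw [Real.exp_neg, inv_inv, add_comm, Real.exp_add]
    _ ≤ _ := by
        have := Real.exp_pos (Fintype.card ι * (R * m.B) ^ 2)
        have : 0 ≤ R * m.B := by positivity
        gcongr <;> linarith

lemma nice_logL : Nice (fun r y => Real.log (m.L r y)) := by
  refine ⟨m.nice_L.1.log fun p => (m.L_pos _ _).ne', fun R hR => ?_⟩
  have hB := m.B0
  refine ⟨R * m.B + Real.exp (Fintype.card ι * (R * m.B) ^ 2), by positivity, fun r hr y => ?_⟩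
  have hy := sum_abs_nonneg' y
  have hb := m.L_bd R hR r hr y
  have h1 : |Real.log (m.L r y)| ≤ R * m.B * ∑ k, |y k| + Fintype.card ι * (R * m.B) ^ 2 := by
    rw [abs_le]
    constructor
    · exact (Real.le_log_iff_exp_le (m.L_pos r y)).2 hb.1
    · exact (Real.log_le_iff_le_exp (m.L_pos r y)).2 hb.2
  calc |Real.log (m.L r y)| ≤ _ := h1
    _ ≤ Real.exp (R * m.B * ∑ k, |y k| + Fintype.card ι * (R * m.B) ^ 2) := by
        linarith [Real.add_one_le_exp (R * m.B * ∑ k, |y k| + Fintype.card ι * (R * m.B) ^ 2)]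
    _ = Real.exp (Fintype.card ι * (R * m.B) ^ 2) * Real.exp (R * m.B * ∑ k, |y k|) := by
        rw [add_comm, Real.exp_add]
    _ ≤ _ := by
        have := Real.exp_pos (Fintype.card ι * (R * m.B) ^ 2)
        have : 0 ≤ R * m.B := by positivity
        gcongr <;> linarith

/-- derivative of `S` along a curve of amplitudes -/
lemma hasDerivAt_S_r (f : X → ℝ) (r : ℝ → ι → ℝ) (ρ : ι → ℝ) (t : ℝ)
    (hr : ∀ k, HasDerivAt (fun τ => r τ k) (ρ k) t) (y : ι → ℝ) :
    HasDerivAt (fun τ => m.S f (r τ) y)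
      (∑ k, ρ k * (y k * m.S (fun x => f x * m.φ k x) (r t) y
        - r t k * m.S (fun x => f x * m.φ k x ^ 2) (r t) y)) t := by
  have h1 : ∀ x, HasDerivAt (fun τ => m.en (r τ) y x)
      (∑ k, ρ k * (m.φ k x * y k - r t k * m.φ k x ^ 2)) t := by
    intro x
    unfold en
    refine HasDerivAt.fun_sum fun k _ => ?_
    have a1 := ((hr k).mul_const (m.φ k x)).mul_const (y k)
    have a2 := (((hr k).mul_const (m.φ k x)).fun_pow 2).div_const 2
    refine (a1.fun_sub a2).congr_deriv ?_
    simp; ring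
  have h2 : HasDerivAt (fun τ => m.S f (r τ) y)
      (∑ x, m.w x * f x * (m.ex (r t) y x *
        ∑ k, ρ k * (m.φ k x * y k - r t k * m.φ k x ^ 2))) t := by
    unfold S
    exact HasDerivAt.fun_sum fun x _ => (h1 x).exp.const_mul _
  refine h2.congr_deriv ?_
  unfold S
  simp only [Finset.mul_sum, ← Finset.sum_sub_distrib]
  rw [Finset.sum_comm]
  refine Finset.sum_congr rfl fun k _ => Finset.sum_congr rfl fun x _ => ?_
  ring

lemma hasDerivAt_S_y [DecidableEq ι] (f : X → ℝ) (r y : ι → ℝ) (k : ι) :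
    HasDerivAt (fun t => m.S f r (Function.update y k t))
      (r k * m.S (fun x => f x * m.φ k x) r y) (y k) := by
  have h1 : ∀ x, HasDerivAt (fun t => m.en r (Function.update y k t) x) (r k * m.φ k x) (y k) := by
    intro x
    unfold en
    have : ∀ j, HasDerivAt (fun t : ℝ => r j * m.φ j x * Function.update y k t j
        - (r j * m.φ j x) ^ 2 / 2) (if j = k then r k * m.φ k x else 0) (y k) := by
      intro j
      by_cases hj : j = k
      · subst hj
        simp only [Function.update_self, if_true]
        simpa using ((hasDerivAt_id (y j)).const_mul (r j * m.φ j x)).sub_const ((r j * m.φ j x) ^ 2 / 2)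
      · simp only [Function.update_of_ne hj, if_neg hj]
        exact hasDerivAt_const _ _
    refine (HasDerivAt.fun_sum fun j (_ : j ∈ Finset.univ) => this j).congr_deriv ?_
    simp
  have h2 : HasDerivAt (fun t => m.S f r (Function.update y k t))
      (∑ x, m.w x * f x * (m.ex r (Function.update y k (y k)) x * (r k * m.φ k x))) (y k) := by
    unfold S
    exact HasDerivAt.fun_sum fun x _ => (h1 x).exp.const_mul _
  refine h2.congr_deriv ?_
  unfold S
  rw [Function.update_eq_self, Finset.mul_sum]
  refine Finset.sum_congr rfl fun x _ => ?_
  ring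

end Mdl
end MI


namespace MI

/-- derivative data for a function of two variables on `{l > 0}` along curves -/
def D2 (F F1 F2 : ℝ → ℝ → ℝ) : Prop :=
  ∀ (l q : ℝ → ℝ) (l' q' t : ℝ), HasDerivAt l l' t → HasDerivAt q q' t → 0 < l t →
    HasDerivAt (fun s => F (l s) (q s)) (F1 (l t) (q t) * l' + F2 (l t) (q t) * q') t

namespace Mdl
variable {X ι : Type} [Fintype X] [Fintype ι] (m : Mdl X ι)

lemma hasDerivAt_L_r (r : ℝ → ι → ℝ) (ρ : ι → ℝ) (t : ℝ)
    (hr : ∀ k, HasDerivAt (fun τ => r τ k) (ρ k) t) (y : ι → ℝ) :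
    HasDerivAt (fun τ => m.L (r τ) y)
      (∑ k, ρ k * (y k * m.S (m.φ k) (r t) y
        - r t k * m.S (fun x => m.φ k x ^ 2) (r t) y)) t := by
  have := m.hasDerivAt_S_r (fun _ => 1) r ρ t hr y
  simpa only [S_one, one_mul] using this

lemma hasDerivAt_L_y [DecidableEq ι] (r y : ι → ℝ) (k : ι) :
    HasDerivAt (fun t => m.L r (Function.update y k t))
      (r k * m.S (m.φ k) r y) (y k) := by
  have := m.hasDerivAt_S_y (fun _ => 1) r y k
  simpa only [S_one, one_mul] using this

/-- the second order form appearing in the master formula -/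
def Hk (F11 F12 F22 : ℝ → ℝ → ℝ) (f : X → ℝ) (k : ι) (r y : ι → ℝ) : ℝ :=
  F11 (m.L r y) (m.S f r y) * m.S (m.φ k) r y ^ 2
    + 2 * F12 (m.L r y) (m.S f r y) * (m.S (m.φ k) r y * m.S (fun x => f x * m.φ k x) r y)
    + F22 (m.L r y) (m.S f r y) * m.S (fun x => f x * m.φ k x) r y ^ 2

theorem master (F F1 F2 F11 F12 F22 : ℝ → ℝ → ℝ) (f : X → ℝ)
    (hF : D2 F F1 F2) (hF1 : D2 F1 F11 F12) (hF2 : D2 F2 F12 F22)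
    (n0 : Nice fun r y => F (m.L r y) (m.S f r y))
    (n1 : Nice fun r y => F1 (m.L r y) (m.S f r y))
    (n2 : Nice fun r y => F2 (m.L r y) (m.S f r y))
    (n11 : Nice fun r y => F11 (m.L r y) (m.S f r y))
    (n12 : Nice fun r y => F12 (m.L r y) (m.S f r y))
    (n22 : Nice fun r y => F22 (m.L r y) (m.S f r y))
    (r ρ : ℝ → ι → ℝ) (t0 ε R : ℝ) (hε : 0 < ε) (hR : 0 ≤ R)
    (hr : ∀ t ∈ Metric.ball t0 ε, ∀ k, HasDerivAt (fun τ => r τ k) (ρ t k) t)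
    (hrR : ∀ t ∈ Metric.ball t0 ε, ∀ k, |r t k| ≤ R)
    (hρR : ∀ t ∈ Metric.ball t0 ε, ∀ k, |ρ t k| ≤ R) :
    HasDerivAt (fun t => ∫ y, F (m.L (r t) y) (m.S f (r t) y) ∂(gM ι))
      (∑ k, (ρ t0 k * r t0 k) * ∫ y, m.Hk F11 F12 F22 f k (r t0) y ∂(gM ι)) t0 := by
  classical
  -- the pointwise derivative
  let G : ι → (ι → ℝ) → (ι → ℝ) → ℝ := fun k r y =>
    F1 (m.L r y) (m.S f r y) * (y k * m.S (m.φ k) r y - r k * m.S (fun x => m.φ k x ^ 2) r y)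
    + F2 (m.L r y) (m.S f r y) * (y k * m.S (fun x => f x * m.φ k x) r y
        - r k * m.S (fun x => f x * m.φ k x ^ 2) r y)
  have nG : ∀ k, Nice (G k) := fun k =>
    (n1.mul (((Nice.coordY k).mul (m.nice_S _)).sub ((Nice.coordR k).mul (m.nice_S _)))).add
      (n2.mul (((Nice.coordY k).mul (m.nice_S _)).sub ((Nice.coordR k).mul (m.nice_S _))))
  have hder : ∀ t ∈ Metric.ball t0 ε, ∀ y, HasDerivAt
      (fun t => F (m.L (r t) y) (m.S f (r t) y)) (∑ k, ρ t k * G k (r t) y) t := by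
    intro t ht y
    have := hF _ _ _ _ t (m.hasDerivAt_L_r r (ρ t) t (hr t ht) y)
      (m.hasDerivAt_S_r f r (ρ t) t (hr t ht) y) (m.L_pos _ _)
    refine this.congr_deriv ?_
    rw [Finset.mul_sum, Finset.mul_sum, ← Finset.sum_add_distrib]
    refine Finset.sum_congr rfl fun k _ => ?_
    simp only [G]; ring
  -- bounds
  choose C hC0 hC using fun k => (nG k).2 R hR
  have h0 : t0 ∈ Metric.ball t0 ε := Metric.mem_ball_self hε
  have hmain := hasDerivAt_integral_of_dominated_loc_of_deriv_le (μ := gM ι)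
    (F := fun t y => F (m.L (r t) y) (m.S f (r t) y))
    (F' := fun t y => ∑ k, ρ t k * G k (r t) y) (x₀ := t0) (s := Metric.ball t0 ε)
    (bound := fun y => ∑ k, R * (C k * Real.exp (C k * ∑ j, |y j|)))
    (Metric.ball_mem_nhds t0 hε)
    (Eventually.of_forall fun t => (n0.cont (r t)).aestronglyMeasurable)
    (n0.integrable (r t0))
    (Continuous.aestronglyMeasurable (continuous_finsetSum _ fun k _ =>
      continuous_const.mul ((nG k).cont (r t0))))
    (Eventually.of_forall fun y t ht => by
      refine (norm_sum_le _ _).trans (Finset.sum_le_sum fun k _ => ?_)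
      rw [norm_mul, Real.norm_eq_abs, Real.norm_eq_abs]
      exact mul_le_mul (hρR t ht k) (hC k (r t) (hrR t ht) y) (abs_nonneg _) hR)
    (integrable_finsetSum _ fun k _ => ((integrable_exp_sum (C k)).const_mul (C k)).const_mul R)
    (Eventually.of_forall fun y t ht => hder t ht y)
  refine hmain.2.congr_deriv ?_
  rw [integral_finsetSum _ fun k _ => ((nG k).integrable (r t0)).const_mul _]
  refine Finset.sum_congr rfl fun k _ => ?_
  rw [integral_const_mul, mul_assoc]
  congr 1
  -- Stein
  set q := r t0
  have ng : Nice fun r y => F1 (m.L r y) (m.S f r y) * m.S (m.φ k) r y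
      + F2 (m.L r y) (m.S f r y) * m.S (fun x => f x * m.φ k x) r y :=
    (n1.mul (m.nice_S _)).add (n2.mul (m.nice_S _))
  have nH : Nice (m.Hk F11 F12 F22 f k) := by
    unfold Hk
    exact ((n11.mul (m.nice_S _).pow2).add
      (((Nice.const 2).mul n12).mul ((m.nice_S _).mul (m.nice_S _)))).add
      (n22.mul (m.nice_S _).pow2)
  have nE : Nice fun r y => F1 (m.L r y) (m.S f r y) * m.S (fun x => m.φ k x ^ 2) r y
      + F2 (m.L r y) (m.S f r y) * m.S (fun x => f x * m.φ k x ^ 2) r y :=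
    (n1.mul (m.nice_S _)).add (n2.mul (m.nice_S _))
  have hst := stein k (fun y => F1 (m.L q y) (m.S f q y) * m.S (m.φ k) q y
      + F2 (m.L q y) (m.S f q y) * m.S (fun x => f x * m.φ k x) q y)
    (fun y => q k * (m.Hk F11 F12 F22 f k q y +
      (F1 (m.L q y) (m.S f q y) * m.S (fun x => m.φ k x ^ 2) q y
      + F2 (m.L q y) (m.S f q y) * m.S (fun x => f x * m.φ k x ^ 2) q y)))
    (fun y => by
      have a1 := hF1 _ _ _ _ (y k) (m.hasDerivAt_L_y q y k) (m.hasDerivAt_S_y f q y k)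
        (m.L_pos _ _)
      have a2 := hF2 _ _ _ _ (y k) (m.hasDerivAt_L_y q y k) (m.hasDerivAt_S_y f q y k)
        (m.L_pos _ _)
      have b1 := m.hasDerivAt_S_y (m.φ k) q y k
      have b2 := m.hasDerivAt_S_y (fun x => f x * m.φ k x) q y k
      refine ((a1.fun_mul b1).fun_add (a2.fun_mul b2)).congr_deriv ?_
      simp only [Function.update_eq_self, Hk, pow_two, mul_assoc]
      ring)
    (ng.cont q) (continuous_const.mul ((nH.add nE).cont q)) (ng.eg q)
    ((((Nice.coordR k).mul (nH.add nE))).eg q)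
  have e1 : ∫ y, G k q y ∂(gM ι) = (∫ y, y k * (F1 (m.L q y) (m.S f q y) * m.S (m.φ k) q y
      + F2 (m.L q y) (m.S f q y) * m.S (fun x => f x * m.φ k x) q y) ∂(gM ι))
      - ∫ y, q k * (F1 (m.L q y) (m.S f q y) * m.S (fun x => m.φ k x ^ 2) q y
      + F2 (m.L q y) (m.S f q y) * m.S (fun x => f x * m.φ k x ^ 2) q y) ∂(gM ι) := by
    rw [← integral_sub (((Nice.coordY k).mul ng).integrable q)
      ((((Nice.coordR k).mul nE)).integrable q)]
    congr 1; ext y; simp only [G]; ring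
  rw [e1, hst, ← integral_sub ((((Nice.coordR k).mul (nH.add nE))).integrable q)
    ((((Nice.coordR k).mul nE)).integrable q), ← integral_const_mul]
  congr 1; ext y; ring

/-- amplitudes from signal-to-noise ratios -/
def rt (s : ι → ℝ) : ι → ℝ := fun k => √(s k)

lemma rt_cont : Continuous (rt : (ι → ℝ) → ι → ℝ) := by unfold rt; fun_prop

end Mdl
end MI


namespace MI
namespace Mdl
variable {X ι : Type} [Fintype X] [Fintype ι] (m : Mdl X ι)

theorem master_s (F F1 F2 F11 F12 F22 : ℝ → ℝ → ℝ) (f : X → ℝ)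
    (hF : D2 F F1 F2) (hF1 : D2 F1 F11 F12) (hF2 : D2 F2 F12 F22)
    (n0 : Nice fun r y => F (m.L r y) (m.S f r y))
    (n1 : Nice fun r y => F1 (m.L r y) (m.S f r y))
    (n2 : Nice fun r y => F2 (m.L r y) (m.S f r y))
    (n11 : Nice fun r y => F11 (m.L r y) (m.S f r y))
    (n12 : Nice fun r y => F12 (m.L r y) (m.S f r y))
    (n22 : Nice fun r y => F22 (m.L r y) (m.S f r y))
    (s d : ι → ℝ) (t0 : ℝ) (hd : ∀ k, d k = 0 ∨ 0 < s k + t0 * d k) :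
    HasDerivAt (fun t => ∫ y, F (m.L (rt (s + t • d)) y) (m.S f (rt (s + t • d)) y) ∂(gM ι))
      (∑ k, (d k / 2) * ∫ y, m.Hk F11 F12 F22 f k (rt (s + t0 • d)) y ∂(gM ι)) t0 := by
  set r : ℝ → ι → ℝ := fun t => rt (s + t • d) with hr
  have hrk : ∀ t k, r t k = √(s k + t * d k) := fun t k => by simp [hr, rt]
  set ρ : ℝ → ι → ℝ := fun t k => d k / (2 * r t k) with hρ
  have ev1 : ∀ᶠ t in 𝓝 t0, ∀ k, d k = 0 ∨ 0 < s k + t * d k := by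
    rw [eventually_all]
    intro k
    rcases hd k with h | h
    · exact Eventually.of_forall fun t => Or.inl h
    · have : ContinuousAt (fun t => s k + t * d k) t0 := by fun_prop
      exact (this.eventually (lt_mem_nhds h)).mono fun t ht => Or.inr ht
  obtain ⟨R1, hR1, hb1⟩ := exists_bd (r t0)
  obtain ⟨R2, hR2, hb2⟩ := exists_bd (ρ t0)
  have rc : ∀ k, ContinuousAt (fun t => r t k) t0 := fun k => by
    simp only [hrk]; fun_prop
  have ev2 : ∀ᶠ t in 𝓝 t0, ∀ k, |r t k| ≤ R1 + R2 + 1 := by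
    rw [eventually_all]
    intro k
    have h1 : |r t0 k| < R1 + R2 + 1 := by linarith [hb1 k]
    exact ((rc k).abs.eventually (gt_mem_nhds h1)).mono fun t ht => ht.le
  have ev3 : ∀ᶠ t in 𝓝 t0, ∀ k, |ρ t k| ≤ R1 + R2 + 1 := by
    rw [eventually_all]
    intro k
    rcases hd k with h | h
    · refine Eventually.of_forall fun t => ?_
      simp only [hρ, h, zero_div, abs_zero]; linarith
    · have h1 : |ρ t0 k| < R1 + R2 + 1 := by linarith [hb2 k]
      have hc : ContinuousAt (fun t => ρ t k) t0 := by
        simp only [hρ]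
        refine continuousAt_const.div (continuousAt_const.mul (rc k)) ?_
        rw [hrk]
        have := Real.sqrt_pos.2 h
        positivity
      exact (hc.abs.eventually (gt_mem_nhds h1)).mono fun t ht => ht.le
  obtain ⟨ε, hε, hball⟩ := Metric.eventually_nhds_iff_ball.1 (ev1.and (ev2.and ev3))
  have := m.master F F1 F2 F11 F12 F22 f hF hF1 hF2 n0 n1 n2 n11 n12 n22 r ρ t0 ε (R1 + R2 + 1)
    hε (by linarith) (fun t ht k => ?_) (fun t ht => (hball t ht).2.1)
    (fun t ht => (hball t ht).2.2)
  · refine this.congr_deriv (Finset.sum_congr rfl fun k _ => ?_)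
    congr 1
    rcases hd k with h | h
    · simp [hρ, h]
    · have := Real.sqrt_pos.2 h
      simp only [hρ, hrk]
      generalize √(s k + t0 * d k) = z at this
      field_simp
  · rcases (hball t ht).1 k with h | h
    · simp only [hrk, hρ, h, mul_zero, zero_div]; exact hasDerivAt_const _ _
    · have h1 : HasDerivAt (fun t => s k + t * d k) (d k) t := by
        simpa using ((hasDerivAt_id t).mul_const (d k)).const_add (s k)
      have := h1.sqrt h.ne'
      simp only [hrk, hρ]
      exact this

/-- Free energy -/
def Psi (s : ι → ℝ) : ℝ := ∫ y, m.L (rt s) y * Real.log (m.L (rt s) y) ∂(gM ι)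

/-- overlap of a feature/function -/
def Q (f : X → ℝ) (s : ι → ℝ) : ℝ := ∫ y, m.S f (rt s) y ^ 2 * (m.L (rt s) y)⁻¹ ∂(gM ι)

/-- covariance squared -/
def Cv (f g : X → ℝ) (s : ι → ℝ) : ℝ :=
  ∫ y, (m.S (fun x => f x * g x) (rt s) y - m.S f (rt s) y * m.S g (rt s) y * (m.L (rt s) y)⁻¹) ^ 2
    * (m.L (rt s) y)⁻¹ ∂(gM ι)

lemma nice_LlogL : Nice fun r y => m.L r y * Real.log (m.L r y) := m.nice_L.mul m.nice_logL
lemma nice_Q (f : X → ℝ) : Nice fun r y => m.S f r y ^ 2 * (m.L r y)⁻¹ :=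
  (m.nice_S f).pow2.mul m.nice_invL
lemma nice_Cv (f g : X → ℝ) : Nice fun r y =>
    (m.S (fun x => f x * g x) r y - m.S f r y * m.S g r y * (m.L r y)⁻¹) ^ 2 * (m.L r y)⁻¹ :=
  ((m.nice_S _).sub (((m.nice_S _).mul (m.nice_S _)).mul m.nice_invL)).pow2.mul m.nice_invL

lemma Psi_cont : Continuous m.Psi := m.nice_LlogL.continuous_integral.comp rt_cont
lemma Q_cont (f : X → ℝ) : Continuous (m.Q f) := (m.nice_Q f).continuous_integral.comp rt_cont
lemma Cv_cont (f g : X → ℝ) : Continuous (m.Cv f g) :=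
  (m.nice_Cv f g).continuous_integral.comp rt_cont

lemma Q_nonneg (f : X → ℝ) (s : ι → ℝ) : 0 ≤ m.Q f s :=
  integral_nonneg fun _ => mul_nonneg (sq_nonneg _) (inv_nonneg.2 (m.L_pos _ _).le)

lemma Cv_nonneg (f g : X → ℝ) (s : ι → ℝ) : 0 ≤ m.Cv f g s :=
  integral_nonneg fun _ => mul_nonneg (sq_nonneg _) (inv_nonneg.2 (m.L_pos _ _).le)

lemma hasDerivAt_Psi (s d : ι → ℝ) (t0 : ℝ) (hd : ∀ k, d k = 0 ∨ 0 < s k + t0 * d k) :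
    HasDerivAt (fun t => m.Psi (s + t • d)) (∑ k, d k / 2 * m.Q (m.φ k) (s + t0 • d)) t0 := by
  have nz : Nice (fun _ _ : ι → ℝ => (0:ℝ)) := Nice.const 0
  have := m.master_s (fun l _ => l * Real.log l) (fun l _ => Real.log l + 1) (fun _ _ => 0)
    (fun l _ => l⁻¹) (fun _ _ => 0) (fun _ _ => 0) (fun _ => 1)
    (fun l q l' q' t hl hq h0 => by
      refine (hl.fun_mul (hl.log h0.ne')).congr_deriv ?_
      field_simp; ring)
    (fun l q l' q' t hl hq h0 => by
      refine ((hl.log h0.ne').add_const 1).congr_deriv ?_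
      field_simp; ring)
    (fun l q l' q' t hl hq h0 => by simpa using hasDerivAt_const t (0:ℝ))
    m.nice_LlogL (m.nice_logL.add (Nice.const 1)) nz m.nice_invL nz nz s d t0 hd
  refine this.congr_deriv (Finset.sum_congr rfl fun k _ => ?_)
  unfold Q Hk
  congr 1
  congr 1; ext y; ring

lemma hasDerivAt_Q (f : X → ℝ) (s d : ι → ℝ) (t0 : ℝ) (hd : ∀ k, d k = 0 ∨ 0 < s k + t0 * d k) :
    HasDerivAt (fun t => m.Q f (s + t • d)) (∑ k, d k * m.Cv f (m.φ k) (s + t0 • d)) t0 := by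
  have := m.master_s (fun l q => q ^ 2 * l⁻¹) (fun l q => - (q ^ 2 * (l⁻¹) ^ 2))
    (fun l q => 2 * q * l⁻¹)
    (fun l q => 2 * q ^ 2 * (l⁻¹ * l⁻¹ ^ 2)) (fun l q => - (2 * q * (l⁻¹) ^ 2))
    (fun l q => 2 * l⁻¹) f
    (fun l q l' q' t hl hq h0 => by
      refine ((hq.fun_pow 2).fun_mul (hl.fun_inv h0.ne')).congr_deriv ?_
      simp; field_simp; try ring)
    (fun l q l' q' t hl hq h0 => by
      refine ((hq.fun_pow 2).fun_mul ((hl.fun_inv h0.ne').fun_pow 2)).fun_neg.congr_deriv ?_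
      simp; field_simp; try ring)
    (fun l q l' q' t hl hq h0 => by
      refine ((hq.const_mul 2).fun_mul (hl.fun_inv h0.ne')).congr_deriv ?_
      have := h0.ne'
      field_simp
      try ring)
    (m.nice_Q f) ((m.nice_S f).pow2.mul m.nice_invL.pow2).neg
    (((Nice.const 2).mul (m.nice_S f)).mul m.nice_invL)
    (((Nice.const 2).mul (m.nice_S f).pow2).mul (m.nice_invL.mul m.nice_invL.pow2))
    (((Nice.const 2).mul (m.nice_S f)).mul m.nice_invL.pow2).neg
    ((Nice.const 2).mul m.nice_invL) s d t0 hd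
  refine this.congr_deriv (Finset.sum_congr rfl fun k _ => ?_)
  unfold Cv Hk
  rw [div_mul_eq_mul_div, mul_div_assoc, ← integral_div]
  congr 1
  congr 1; ext y
  have := m.L_pos (rt (s + t0 • d)) y
  field_simp; ring

lemma sum4 {A B : Type} [Fintype A] [Fintype B] (K : A → A → B → B → ℝ) :
    ∑ k, ∑ l, ∑ x, ∑ x', K k l x x' = ∑ x, ∑ x', ∑ k, ∑ l, K k l x x' := by
  have h1 : ∀ k, ∑ l, ∑ x, ∑ x', K k l x x' = ∑ x, ∑ x', ∑ l, K k l x x' := fun k => by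
    rw [Finset.sum_comm]
    exact Finset.sum_congr rfl fun x _ => Finset.sum_comm
  simp_rw [h1]
  rw [Finset.sum_comm]
  exact Finset.sum_congr rfl fun x _ => Finset.sum_comm

/-- Positivity of the Hessian. -/
lemma hess_nonneg (s d : ι → ℝ) :
    0 ≤ ∑ k, ∑ l, d k * d l * m.Cv (m.φ k) (m.φ l) s := by
  have h1 : ∑ k, ∑ l, d k * d l * m.Cv (m.φ k) (m.φ l) s
      = ∫ y, ∑ k, ∑ l, d k * d l * ((m.S (fun x => m.φ k x * m.φ l x) (rt s) y
        - m.S (m.φ k) (rt s) y * m.S (m.φ l) (rt s) y * (m.L (rt s) y)⁻¹) ^ 2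
        * (m.L (rt s) y)⁻¹) ∂(gM ι) := by
    rw [integral_finsetSum _ fun k _ => integrable_finsetSum _ fun l _ =>
      ((m.nice_Cv _ _).integrable _).const_mul _]
    refine Finset.sum_congr rfl fun k _ => ?_
    rw [integral_finsetSum _ fun l _ => ((m.nice_Cv _ _).integrable _).const_mul _]
    refine Finset.sum_congr rfl fun l _ => ?_
    rw [integral_const_mul]; rfl
  rw [h1]
  refine integral_nonneg fun y => ?_
  simp only [Pi.zero_apply]
  set r := rt s
  have hL := m.L_pos r y
  -- centered features
  set c : ι → X → ℝ := fun k x => m.φ k x - m.S (m.φ k) r y * (m.L r y)⁻¹ with hc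
  set ν : X → ℝ := fun x => m.w x * m.ex r y x with hν
  have hν0 : ∀ x, 0 ≤ ν x := fun x => mul_nonneg (m.w0 x) (m.ex_pos r y x).le
  have hcov : ∀ k l, m.S (fun x => m.φ k x * m.φ l x) r y
      - m.S (m.φ k) r y * m.S (m.φ l) r y * (m.L r y)⁻¹ = ∑ x, ν x * (c k x * c l x) := by
    intro k l
    have e1 : ∑ x, ν x * (c k x * c l x) = m.S (fun x => m.φ k x * m.φ l x) r y
        - (m.S (m.φ k) r y * (m.L r y)⁻¹) * m.S (m.φ l) r y
        - (m.S (m.φ l) r y * (m.L r y)⁻¹) * m.S (m.φ k) r y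
        + (m.S (m.φ k) r y * (m.L r y)⁻¹) * (m.S (m.φ l) r y * (m.L r y)⁻¹) * m.L r y := by
      have gen : ∀ a b : ℝ, ∑ x, ν x * ((m.φ k x - a) * (m.φ l x - b))
          = m.S (fun x => m.φ k x * m.φ l x) r y - a * m.S (m.φ l) r y - b * m.S (m.φ k) r y
            + a * b * m.L r y := by
        intro a b
        simp only [S, L, Finset.mul_sum, ← Finset.sum_sub_distrib, ← Finset.sum_add_distrib]
        refine Finset.sum_congr rfl fun x _ => ?_
        simp only [hν]; ring
      exact gen _ _
    rw [e1]; field_simp; ring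
  simp_rw [hcov]
  have h2 : ∑ k, ∑ l, d k * d l * ((∑ x, ν x * (c k x * c l x)) ^ 2 * (m.L r y)⁻¹)
      = (∑ x, ∑ x', ν x * ν x' * (∑ k, d k * (c k x * c k x')) ^ 2) * (m.L r y)⁻¹ := by
    simp only [pow_two, Finset.mul_sum, Finset.sum_mul]
    rw [sum4]
    refine Finset.sum_congr rfl fun x _ => Finset.sum_congr rfl fun x' _ =>
      Finset.sum_congr rfl fun k _ => Finset.sum_congr rfl fun l _ => ?_
    ring
  rw [h2]
  refine mul_nonneg (Finset.sum_nonneg fun x _ => Finset.sum_nonneg fun x' _ => ?_)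
    (inv_nonneg.2 hL.le)
  exact mul_nonneg (mul_nonneg (hν0 x) (hν0 x')) (sq_nonneg _)

lemma Psi_tangent_pos (s s' : ι → ℝ) (hs : ∀ k, 0 < s k) (hs' : ∀ k, 0 ≤ s' k) :
    m.Psi s + ∑ k, (s' k - s k) / 2 * m.Q (m.φ k) s ≤ m.Psi s' := by
  set d := s' - s with hd
  have hpos : ∀ t : ℝ, 0 ≤ t → t < 1 → ∀ k, 0 < s k + t * d k := by
    intro t h0 h1 k
    have : s k + t * d k = (1 - t) * s k + t * s' k := by simp [hd]; ring
    rw [this]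
    have := mul_pos (sub_pos.2 h1) (hs k)
    have := mul_nonneg h0 (hs' k)
    linarith
  set g : ℝ → ℝ := fun t => ∑ k, d k / 2 * m.Q (m.φ k) (s + t • d) with hg
  have hline : Continuous fun t : ℝ => s + t • d := by fun_prop
  have hgd : ∀ t, 0 ≤ t → t < 1 →
      HasDerivAt g (∑ k, d k / 2 * ∑ l, d l * m.Cv (m.φ k) (m.φ l) (s + t • d)) t := by
    intro t h0 h1
    exact HasDerivAt.fun_sum fun k _ => (m.hasDerivAt_Q (m.φ k) s d t
      (fun k => Or.inr (hpos t h0 h1 k))).const_mul _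
  have hgc : Continuous g := continuous_finsetSum _ fun k _ =>
    continuous_const.mul ((m.Q_cont _).comp hline)
  obtain ⟨ξ, hξ, h1⟩ := exists_hasDerivAt_eq_slope (fun t => m.Psi (s + t • d)) g one_pos
    (m.Psi_cont.comp hline).continuousOn
    (fun t ht => m.hasDerivAt_Psi s d t fun k => Or.inr (hpos t ht.1.le ht.2 k))
  obtain ⟨η, hη, h2⟩ := exists_hasDerivAt_eq_slope g _ hξ.1 hgc.continuousOn
    (fun t ht => hgd t ht.1.le (ht.2.trans hξ.2))
  have h3 : 0 ≤ ∑ k, d k / 2 * ∑ l, d l * m.Cv (m.φ k) (m.φ l) (s + η • d) := by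
    have := m.hess_nonneg (s + η • d) d
    have e : ∑ k, d k / 2 * ∑ l, d l * m.Cv (m.φ k) (m.φ l) (s + η • d)
        = (∑ k, ∑ l, d k * d l * m.Cv (m.φ k) (m.φ l) (s + η • d)) / 2 := by
      simp only [Finset.mul_sum, Finset.sum_div]
      refine Finset.sum_congr rfl fun x _ => Finset.sum_congr rfl fun x' _ => ?_
      ring
    rw [e]; linarith
  rw [h2] at h3
  have h4 : g 0 ≤ g ξ := by
    have := hξ.1
    rw [sub_zero] at h3
    have := (div_nonneg_iff.1 h3)
    rcases this with ⟨a, _⟩ | ⟨_, b⟩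
    · linarith
    · linarith
  have e1 : s + (1:ℝ) • d = s' := by rw [one_smul, hd]; abel
  have e0 : s + (0:ℝ) • d = s := by rw [zero_smul, add_zero]
  rw [e1, e0] at h1
  simp only [sub_zero, div_one] at h1
  have e2 : g 0 = ∑ k, (s' k - s k) / 2 * m.Q (m.φ k) s := by
    simp only [hg, e0]; rfl
  linarith

lemma Psi_tangent (s s' : ι → ℝ) (hs : ∀ k, 0 ≤ s k) (hs' : ∀ k, 0 ≤ s' k) :
    m.Psi s + ∑ k, (s' k - s k) / 2 * m.Q (m.φ k) s ≤ m.Psi s' := by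
  have hl : Continuous fun ε : ℝ => (fun k => s k + ε : ι → ℝ) := by fun_prop
  have hc : Continuous fun ε : ℝ => m.Psi (fun k => s k + ε)
      + ∑ k, (s' k - (s k + ε)) / 2 * m.Q (m.φ k) (fun k => s k + ε) :=
    (m.Psi_cont.comp hl).add (continuous_finsetSum _ fun k _ =>
      (by fun_prop : Continuous fun ε : ℝ => (s' k - (s k + ε)) / 2).mul ((m.Q_cont _).comp hl))
  have ht : Tendsto (fun ε : ℝ => m.Psi (fun k => s k + ε)
      + ∑ k, (s' k - (s k + ε)) / 2 * m.Q (m.φ k) (fun k => s k + ε)) (𝓝[>] 0)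
      (𝓝 (m.Psi s + ∑ k, (s' k - s k) / 2 * m.Q (m.φ k) s)) := by
    have := (hc.tendsto 0).mono_left (nhdsWithin_le_nhds (s := Set.Ioi 0))
    simpa using this
  refine le_of_tendsto ht ?_
  filter_upwards [self_mem_nhdsWithin] with ε hε
  exact m.Psi_tangent_pos _ s' (fun k => add_pos_of_nonneg_of_pos (hs k) hε) hs'

end Mdl
end MI


namespace MI

lemma EG.mul {ι : Type} [Fintype ι] {f g : (ι → ℝ) → ℝ} (hf : EG f) (hg : EG g) :
    EG (fun y => f y * g y) := by
  obtain ⟨C, hC, h1⟩ := hf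
  obtain ⟨D, hD, h2⟩ := hg
  refine ⟨C * D + C + D, by positivity, fun y => ?_⟩
  have hy := sum_abs_nonneg' y
  rw [abs_mul]
  calc |f y| * |g y|
      ≤ (C * Real.exp (C * ∑ k, |y k|)) * (D * Real.exp (D * ∑ k, |y k|)) := by
        gcongr
        · exact h1 y
        · exact h2 y
    _ = (C * D) * Real.exp ((C + D) * ∑ k, |y k|) := by rw [add_mul, Real.exp_add]; ring
    _ ≤ (C * D + C + D) * Real.exp ((C * D + C + D) * ∑ k, |y k|) := by
        have : 0 ≤ C * D := by positivity
        gcongr <;> linarith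

lemma EG.abs {ι : Type} [Fintype ι] {f : (ι → ℝ) → ℝ} (hf : EG f) : EG (fun y => |f y|) := by
  obtain ⟨C, hC, h1⟩ := hf
  exact ⟨C, hC, fun y => by rw [abs_abs]; exact h1 y⟩

namespace Mdl
variable {X ι κ : Type} [Fintype X] [Fintype ι] [Fintype κ] (m : Mdl X ι)

/-- Nishimori identity. -/
lemma nishimori (r : ι → ℝ) (g : (ι → ℝ) → ℝ) (hg : EG g) (hgm : Measurable g) :
    ∫ y, m.L r y * g y ∂(gM ι) = ∑ x, m.w x * ∫ z, g (z + fun k => r k * m.φ k x) ∂(gM ι) := by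
  have h1 : ∀ x, ∫ z, g (z + fun k => r k * m.φ k x) ∂(gM ι) = ∫ y, m.ex r y x * g y ∂(gM ι) := by
    intro x; exact gM_shift _ g hgm
  simp_rw [h1]
  simp only [← integral_const_mul]
  rw [← integral_finsetSum]
  · congr 1; ext y; rw [L, Finset.sum_mul]
    exact Finset.sum_congr rfl fun x _ => by ring
  · intro x _
    exact ((((m.nice_ex x).eg r).mul hg).integrable
      (((m.nice_ex x).cont r).measurable.mul hgm)).const_mul _

lemma int_L (r : ι → ℝ) : ∫ y, m.L r y ∂(gM ι) = 1 := by
  have := m.nishimori r (fun _ => 1) ((Nice.const 1).eg r) measurable_const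
  simpa [m.w1] using this

lemma S_abs_le (f : X → ℝ) (K : ℝ) (hf : ∀ x, |f x| ≤ K) (r y : ι → ℝ) :
    |m.S f r y| ≤ K * m.L r y := by
  unfold S L
  rw [Finset.mul_sum]
  refine (Finset.abs_sum_le_sum_abs _ _).trans (Finset.sum_le_sum fun x _ => ?_)
  rw [abs_mul, abs_mul, abs_of_nonneg (m.w0 x), abs_of_pos (m.ex_pos r y x)]
  have := mul_nonneg (m.w0 x) (m.ex_pos r y x).le
  nlinarith [hf x]

/-- posterior mean -/
def mn (f : X → ℝ) (r y : ι → ℝ) : ℝ := m.S f r y * (m.L r y)⁻¹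

lemma nice_mn (f : X → ℝ) : Nice (m.mn f) := (m.nice_S f).mul m.nice_invL

lemma mn_abs_le (f : X → ℝ) (K : ℝ) (hf : ∀ x, |f x| ≤ K) (r y : ι → ℝ) :
    |m.mn f r y| ≤ K := by
  have hL := m.L_pos r y
  unfold mn
  rw [abs_mul, abs_inv, abs_of_pos hL, ← div_eq_mul_inv, div_le_iff₀ hL]
  exact m.S_abs_le f K hf r y

lemma Q_eq (f : X → ℝ) (s : ι → ℝ) :
    m.Q f s = ∫ y, m.L (rt s) y * m.mn f (rt s) y ^ 2 ∂(gM ι) := by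
  unfold Q mn
  congr 1; ext y
  have := m.L_pos (rt s) y
  field_simp

lemma Cv_eq (f g : X → ℝ) (s : ι → ℝ) :
    m.Cv f g s = ∫ y, m.L (rt s) y * (m.mn (fun x => f x * g x) (rt s) y
      - m.mn f (rt s) y * m.mn g (rt s) y) ^ 2 ∂(gM ι) := by
  unfold Cv mn
  congr 1; ext y
  have := m.L_pos (rt s) y
  field_simp

lemma Q_le (f : X → ℝ) (K : ℝ) (hf : ∀ x, |f x| ≤ K) (s : ι → ℝ) : m.Q f s ≤ K ^ 2 := by
  rw [Q_eq]
  have : ∫ y, m.L (rt s) y * K ^ 2 ∂(gM ι) = K ^ 2 := by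
    rw [integral_mul_const, int_L, one_mul]
  rw [← this]
  refine integral_mono ((m.nice_L.mul (m.nice_mn f).pow2).integrable _)
    ((m.nice_L.integrable _).mul_const _) fun y => ?_
  refine mul_le_mul_of_nonneg_left ?_ (m.L_pos _ y).le
  rw [← sq_abs]
  have := m.mn_abs_le f K hf (rt s) y
  gcongr

/-- model with all amplitudes zero -/
lemma en_zero (y : ι → ℝ) (x : X) : m.en 0 y x = 0 := by simp [en]

lemma rt_zero : rt (0 : ι → ℝ) = 0 := by ext k; simp [rt]

lemma L_zero (y : ι → ℝ) : m.L 0 y = 1 := by simp [L, ex, en_zero, m.w1]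

lemma Psi_zero : m.Psi 0 = 0 := by simp [Psi, rt_zero, L_zero]

lemma Q_zero (f : X → ℝ) : m.Q f 0 = (∑ x, m.w x * f x) ^ 2 := by
  simp [Q, rt_zero, L_zero, S, ex, en_zero]

/-- extension of a model by extra features -/
def ext (φ' : κ → X → ℝ) : Mdl X (ι ⊕ κ) := ⟨m.w, m.w0, m.w1, Sum.elim m.φ φ'⟩

/-- posterior model with new features -/
def cond (φ' : κ → X → ℝ) (r y : ι → ℝ) : Mdl X κ where
  w x := m.w x * m.ex r y x * (m.L r y)⁻¹
  w0 x := mul_nonneg (mul_nonneg (m.w0 x) (m.ex_pos r y x).le) (inv_nonneg.2 (m.L_pos r y).le)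
  w1 := by
    rw [← Finset.sum_mul]
    exact mul_inv_cancel₀ (m.L_pos r y).ne'
  φ := φ'

variable (φ' : κ → X → ℝ)

lemma ext_L (r y : ι → ℝ) (r' y' : κ → ℝ) :
    (m.ext φ').L (Sum.elim r r') (Sum.elim y y') = m.L r y * (m.cond φ' r y).L r' y' := by
  have h1 : ∀ x, (m.ext φ').ex (Sum.elim r r') (Sum.elim y y') x
      = m.ex r y x * (m.cond φ' r y).ex r' y' x := by
    intro x
    simp only [ex, ← Real.exp_add, en, Fintype.sum_sum_type]
    rfl
  unfold L
  rw [Finset.mul_sum]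
  refine Finset.sum_congr rfl fun x _ => ?_
  rw [h1]
  simp only [ext, cond]
  have := (m.L_pos r y).ne'
  unfold L at this ⊢
  field_simp

lemma rt_elim (s : ι → ℝ) (s' : κ → ℝ) : rt (Sum.elim s s') = Sum.elim (rt s) (rt s') := by
  ext k; cases k <;> rfl

end Mdl

lemma gM_sum {ι κ : Type} [Fintype ι] [Fintype κ] :
    MeasurePreserving (fun p : (ι → ℝ) × (κ → ℝ) => (Sum.elim p.1 p.2 : ι ⊕ κ → ℝ))
      ((gM ι).prod (gM κ)) (gM (ι ⊕ κ)) := by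
  have := measurePreserving_sumPiEquivProdPi_symm (fun _ : ι ⊕ κ => stdG)
  have h : (fun p : (ι → ℝ) × (κ → ℝ) => (Sum.elim p.1 p.2 : ι ⊕ κ → ℝ))
    = (MeasurableEquiv.sumPiEquivProdPi (fun _ : ι ⊕ κ => ℝ)).symm := by
    ext p k; cases k <;> rfl
  rw [h]; exact this

lemma gM_sum_integrable {ι κ : Type} [Fintype ι] [Fintype κ] (G : (ι ⊕ κ → ℝ) → ℝ)
    (hG : Integrable G (gM (ι ⊕ κ))) :
    Integrable (fun p : (ι → ℝ) × (κ → ℝ) => G (Sum.elim p.1 p.2)) ((gM ι).prod (gM κ)) :=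
  gM_sum.integrable_comp_of_integrable hG

lemma gM_sum_integral {ι κ : Type} [Fintype ι] [Fintype κ] (G : (ι ⊕ κ → ℝ) → ℝ)
    (hG : Integrable G (gM (ι ⊕ κ))) :
    ∫ y, G y ∂(gM (ι ⊕ κ)) = ∫ y, ∫ y', G (Sum.elim y y') ∂(gM κ) ∂(gM ι) := by
  rw [← integral_prod (fun p : (ι → ℝ) × (κ → ℝ) => G (Sum.elim p.1 p.2))
    (gM_sum_integrable G hG)]
  have mp := gM_sum (ι := ι) (κ := κ)
  conv_lhs => rw [← mp.map_eq]
  rw [integral_map mp.measurable.aemeasurable (by rw [mp.map_eq]; exact hG.1)]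

end MI


namespace MI

lemma integrable_chi {Ω : Type} [MeasurableSpace Ω] {μ : Measure Ω} {χ G : Ω → ℝ}
    (hG : Integrable G μ) (hχ : Measurable χ) (h0 : ∀ y, 0 ≤ χ y) (h1 : ∀ y, χ y ≤ 1) :
    Integrable (fun y => χ y * G y) μ := by
  refine hG.mono (hχ.aestronglyMeasurable.mul hG.1) (Eventually.of_forall fun y => ?_)
  rw [norm_mul, Real.norm_eq_abs, abs_of_nonneg (h0 y)]
  nlinarith [norm_nonneg (G y), h1 y]

namespace Mdl
variable {X ι κ : Type} [Fintype X] [Fintype ι] [Fintype κ] (m : Mdl X ι)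
variable (φ' : κ → X → ℝ)

/-- L1 fluctuation of the log-partition function -/
def Dv (s : ι → ℝ) : ℝ := ∫ y, m.L (rt s) y * |Real.log (m.L (rt s) y) - m.Psi s| ∂(gM ι)

lemma cond_Psi_ge (r y : ι → ℝ) (δ : ℝ) (hδ : 0 ≤ δ) :
    δ / 2 * ∑ k, m.mn (φ' k) r y ^ 2 ≤ (m.cond φ' r y).Psi (fun _ => δ) := by
  have := (m.cond φ' r y).Psi_tangent 0 (fun _ => δ) (fun _ => le_rfl) (fun _ => hδ)
  rw [Psi_zero, zero_add] at this
  refine le_trans (le_of_eq ?_) this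
  rw [Finset.mul_sum]
  refine Finset.sum_congr rfl fun k _ => ?_
  rw [Q_zero]
  simp only [Pi.zero_apply, sub_zero]
  congr 2
  simp only [mn, S, cond, Finset.sum_mul]
  exact Finset.sum_congr rfl fun x _ => by ring

lemma ext_inner (s : ι → ℝ) (s' : κ → ℝ) (y : ι → ℝ) :
    ∫ y', (m.ext φ').L (rt (Sum.elim s s')) (Sum.elim y y')
        * Real.log ((m.ext φ').L (rt (Sum.elim s s')) (Sum.elim y y')) ∂(gM κ)
      = m.L (rt s) y * Real.log (m.L (rt s) y)
        + m.L (rt s) y * (m.cond φ' (rt s) y).Psi s' := by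
  simp only [rt_elim, ext_L]
  set c := m.cond φ' (rt s) y
  have h1 : ∀ y', m.L (rt s) y * c.L (rt s') y' * Real.log (m.L (rt s) y * c.L (rt s') y')
      = (m.L (rt s) y * Real.log (m.L (rt s) y)) * c.L (rt s') y'
        + m.L (rt s) y * (c.L (rt s') y' * Real.log (c.L (rt s') y')) := by
    intro y'
    rw [Real.log_mul (m.L_pos _ _).ne' (c.L_pos _ _).ne']; ring
  simp_rw [h1]
  rw [integral_add ((c.nice_L.integrable _).const_mul _)
    ((c.nice_LlogL.integrable _).const_mul _), integral_const_mul, integral_const_mul, int_L,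
    mul_one]
  rfl

/-- restriction to the left block -/
def lft (y : ι ⊕ κ → ℝ) : ι → ℝ := fun i => y (Sum.inl i)

lemma lft_meas : Measurable (lft : (ι ⊕ κ → ℝ) → ι → ℝ) := by unfold lft; fun_prop

lemma lft_elim (y : ι → ℝ) (y' : κ → ℝ) : lft (Sum.elim y y') = y := rfl

lemma ext_chi_ge (s : ι → ℝ) (δ : ℝ) (hδ : 0 ≤ δ) (χ : (ι → ℝ) → ℝ) (hχ : Measurable χ)
    (h0 : ∀ y, 0 ≤ χ y) (h1 : ∀ y, χ y ≤ 1) :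
    ∫ y, χ y * (m.L (rt s) y * Real.log (m.L (rt s) y)) ∂(gM ι)
      + δ / 2 * ∫ y, χ y * (m.L (rt s) y * ∑ k, m.mn (φ' k) (rt s) y ^ 2) ∂(gM ι)
      ≤ ∫ y, χ (lft y) * ((m.ext φ').L (rt (Sum.elim s (fun _ => δ))) y
          * Real.log ((m.ext φ').L (rt (Sum.elim s (fun _ => δ))) y)) ∂(gM (ι ⊕ κ)) := by
  have hi : Integrable (fun y => χ (lft y) * ((m.ext φ').L (rt (Sum.elim s (fun _ => δ))) y
          * Real.log ((m.ext φ').L (rt (Sum.elim s (fun _ => δ))) y))) (gM (ι ⊕ κ)) :=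
    integrable_chi ((m.ext φ').nice_LlogL.integrable _) (hχ.comp lft_meas) (fun _ => h0 _)
      (fun _ => h1 _)
  have hi2 := (gM_sum_integrable _ hi).integral_prod_left
  rw [gM_sum_integral _ hi]
  simp only [lft_elim, integral_const_mul, ext_inner] at hi2 ⊢
  have i1 := integrable_chi (m.nice_LlogL.integrable (rt s)) hχ h0 h1
  have n2 : Nice fun r y => m.L r y * ∑ k, m.mn (φ' k) r y ^ 2 :=
    m.nice_L.mul (Nice.sum _ fun k _ => (m.nice_mn _).pow2)
  have i2 := integrable_chi (n2.integrable (rt s)) hχ h0 h1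
  rw [← integral_const_mul, ← integral_add i1 (i2.const_mul _)]
  refine integral_mono (i1.add (i2.const_mul _)) hi2 fun y => ?_
  have h3 := m.cond_Psi_ge φ' (rt s) y δ hδ
  have h4 := mul_nonneg (h0 y) (m.L_pos (rt s) y).le
  have h5 := mul_le_mul_of_nonneg_left h3 h4
  simp only
  linarith

lemma ext_chi_L (s : ι → ℝ) (s' : κ → ℝ) (χ : (ι → ℝ) → ℝ) (hχ : Measurable χ)
    (h0 : ∀ y, 0 ≤ χ y) (h1 : ∀ y, χ y ≤ 1) :
    ∫ y, χ (lft y) * (m.ext φ').L (rt (Sum.elim s s')) y ∂(gM (ι ⊕ κ))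
      = ∫ y, χ y * m.L (rt s) y ∂(gM ι) := by
  have hi : Integrable (fun y => χ (lft y) * (m.ext φ').L (rt (Sum.elim s s')) y)
      (gM (ι ⊕ κ)) :=
    integrable_chi ((m.ext φ').nice_L.integrable _) (hχ.comp lft_meas)
      (fun _ => h0 _) (fun _ => h1 _)
  rw [gM_sum_integral _ hi]
  simp only [lft_elim, rt_elim, ext_L, integral_const_mul, int_L, mul_one]

lemma ext_Psi_zero (s : ι → ℝ) : (m.ext φ').Psi (Sum.elim s 0) = m.Psi s := by
  rw [Psi, gM_sum_integral _ ((m.ext φ').nice_LlogL.integrable _)]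
  simp only [ext_inner, Psi_zero, mul_zero, add_zero]
  rfl

theorem conc (s : ι → ℝ) (δ : ℝ) (hδ : 0 < δ) :
    ∫ y, m.L (rt s) y * |∑ k, m.mn (φ' k) (rt s) y ^ 2 - ∑ k, m.Q (φ' k) s| ∂(gM ι)
      ≤ 4 / δ * ((m.ext φ').Dv (Sum.elim s (fun _ => δ)) + m.Dv s)
        + 2 * (2 / δ * ((m.ext φ').Psi (Sum.elim s (fun _ => δ)) - m.Psi s)
          - ∑ k, m.Q (φ' k) s) := by
  classical
  set r := rt s with hr
  set e := m.ext φ' with he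
  set re := rt (Sum.elim s (fun _ : κ => δ)) with hre
  set A : (ι → ℝ) → ℝ := fun y => ∑ k, m.mn (φ' k) r y ^ 2 with hA
  set a := ∑ k, m.Q (φ' k) s with ha
  have nA : Nice fun r y => ∑ k, m.mn (φ' k) r y ^ 2 := Nice.sum _ fun k _ => (m.nice_mn _).pow2
  have Am : Measurable A := (nA.cont r).measurable
  have hLA : ∫ y, m.L r y * A y ∂(gM ι) = a := by
    simp only [hA, Finset.mul_sum]
    rw [integral_finsetSum _ fun k _ => (m.nice_L.mul (m.nice_mn (φ' k)).pow2).integrable r]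
    exact Finset.sum_congr rfl fun k _ => (m.Q_eq _ _).symm
  have iLA : Integrable (fun y => m.L r y * A y) (gM ι) := (m.nice_L.mul nA).integrable r
  have iL := m.nice_L.integrable r
  set χ : (ι → ℝ) → ℝ := fun y => if a < A y then 1 else 0 with hχd
  have hχ : Measurable χ := Measurable.ite (measurableSet_lt measurable_const Am)
    measurable_const measurable_const
  have h0 : ∀ y, 0 ≤ χ y := fun y => by simp only [hχd]; split_ifs <;> norm_num
  have h1 : ∀ y, χ y ≤ 1 := fun y => by simp only [hχd]; split_ifs <;> norm_num
  set p := ∫ y, χ y * m.L r y ∂(gM ι) with hp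
  have hp1 : p ≤ 1 := by
    rw [← m.int_L r]
    refine integral_mono (integrable_chi iL hχ h0 h1) iL fun y => ?_
    have := m.L_pos r y
    simp only
    nlinarith [h1 y]
  have hp0 : 0 ≤ p := integral_nonneg fun y => mul_nonneg (h0 y) (m.L_pos r y).le
  -- main inequality
  have key := m.ext_chi_ge φ' s δ hδ.le χ hχ h0 h1
  have key1 := m.ext_chi_ge φ' s δ hδ.le (fun _ => 1) measurable_const (fun _ => zero_le_one)
    (fun _ => le_rfl)
  simp only [one_mul] at key1
  rw [← hr, ← hre] at key key1
  have hPsi : δ / 2 * a ≤ e.Psi (Sum.elim s (fun _ => δ)) - m.Psi s := by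
    have : m.Psi s + δ / 2 * a ≤ e.Psi (Sum.elim s (fun _ => δ)) := by
      rw [← hLA]; exact key1
    linarith
  have hext : ∫ y, χ (lft y) * (e.L re y * Real.log (e.L re y)) ∂(gM (ι ⊕ κ))
      ≤ e.Dv (Sum.elim s (fun _ => δ)) + e.Psi (Sum.elim s (fun _ => δ)) * p := by
    rw [hp, ← m.ext_chi_L φ' s (fun _ => δ) χ hχ h0 h1, ← integral_const_mul, Dv, ← integral_add]
    · refine integral_mono ?_ ?_ fun y => ?_
      · exact integrable_chi (e.nice_LlogL.integrable _) (hχ.comp lft_meas) (fun _ => h0 _)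
          (fun _ => h1 _)
      · refine Integrable.add ?_ ((integrable_chi (e.nice_L.integrable _) (hχ.comp lft_meas)
          (fun _ => h0 _) (fun _ => h1 _)).const_mul _)
        exact (((e.nice_L.eg _).mul ((e.nice_logL.sub (Nice.const _)).eg _).abs)).integrable
          (((e.nice_L.cont _).mul ((e.nice_logL.sub (Nice.const _)).cont _).abs).measurable)
      · simp only [← hre]
        have hL := e.L_pos re y
        have := h0 (lft y)
        have := h1 (lft y)
        have hab := le_abs_self (Real.log (e.L re y) - e.Psi (Sum.elim s (fun _ => δ)))
        have hab0 := abs_nonneg (Real.log (e.L re y) - e.Psi (Sum.elim s (fun _ => δ)))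
        have h3 : χ (lft y) * (e.L re y * (Real.log (e.L re y) - e.Psi (Sum.elim s (fun _ => δ))))
          ≤ e.L re y * |Real.log (e.L re y) - e.Psi (Sum.elim s (fun _ => δ))| := by
          calc _ ≤ χ (lft y) * (e.L re y
                * |Real.log (e.L re y) - e.Psi (Sum.elim s (fun _ => δ))|) := by gcongr
            _ ≤ 1 * (e.L re y * |Real.log (e.L re y) - e.Psi (Sum.elim s (fun _ => δ))|) := by
                gcongr
            _ = _ := one_mul _
        have h4 : e = m.ext φ' := he
        simp only [← h4]
        linarith
    · exact (((e.nice_L.eg _).mul ((e.nice_logL.sub (Nice.const _)).eg _).abs)).integrable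
          (((e.nice_L.cont _).mul ((e.nice_logL.sub (Nice.const _)).cont _).abs).measurable)
    · exact ((integrable_chi (e.nice_L.integrable _) (hχ.comp lft_meas)
          (fun _ => h0 _) (fun _ => h1 _)).const_mul _)
  have iD : Integrable (fun y => m.L r y * |Real.log (m.L r y) - m.Psi s|) (gM ι) :=
    (((m.nice_L.eg _).mul ((m.nice_logL.sub (Nice.const _)).eg _).abs)).integrable
          (((m.nice_L.cont _).mul ((m.nice_logL.sub (Nice.const _)).cont _).abs).measurable)
  have hbase : m.Psi s * p - m.Dv s ≤ ∫ y, χ y * (m.L r y * Real.log (m.L r y)) ∂(gM ι) := by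
    rw [hp, ← integral_const_mul, Dv, ← hr, ← integral_sub _ iD]
    · refine integral_mono ?_ ?_ fun y => ?_
      · exact ((integrable_chi iL hχ h0 h1).const_mul _).sub iD
      · exact integrable_chi (m.nice_LlogL.integrable _) hχ h0 h1
      · have hL := m.L_pos r y
        have := h0 y
        have := h1 y
        have hab := neg_abs_le (Real.log (m.L r y) - m.Psi s)
        have hab0 := abs_nonneg (Real.log (m.L r y) - m.Psi s)
        have h3 : χ y * (m.L r y * (-(Real.log (m.L r y) - m.Psi s)))
          ≤ m.L r y * |Real.log (m.L r y) - m.Psi s| := by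
          calc _ ≤ χ y * (m.L r y * |Real.log (m.L r y) - m.Psi s|) := by
                gcongr; linarith
            _ ≤ 1 * (m.L r y * |Real.log (m.L r y) - m.Psi s|) := by gcongr
            _ = _ := one_mul _
        simp only
        linarith
    · exact (integrable_chi iL hχ h0 h1).const_mul _
  -- final
  have iχLA := integrable_chi iLA hχ h0 h1
  have habs : ∫ y, m.L r y * |A y - a| ∂(gM ι)
      = 2 * (∫ y, χ y * (m.L r y * A y) ∂(gM ι) - a * p) := by
    have e1 : ∀ y, m.L r y * |A y - a| = 2 * (χ y * (m.L r y * A y) - a * (χ y * m.L r y))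
        - (m.L r y * A y - a * m.L r y) := by
      intro y
      simp only [hχd]
      split_ifs with h
      · rw [abs_of_pos (by linarith)]; ring
      · rw [abs_of_nonpos (by linarith)]; ring
    simp_rw [e1]
    rw [integral_sub, integral_const_mul, integral_sub, integral_sub, integral_const_mul,
      integral_const_mul, hLA, m.int_L]
    · ring
    · exact iLA
    · exact iL.const_mul _
    · exact iχLA
    · exact (integrable_chi iL hχ h0 h1).const_mul _
    · exact (iχLA.sub ((integrable_chi iL hχ h0 h1).const_mul _)).const_mul _
    · exact iLA.sub (iL.const_mul _)
  rw [habs]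
  set I := ∫ y, χ y * (m.L r y * A y) ∂(gM ι)
  set De := e.Dv (Sum.elim s (fun _ => δ))
  set Db := m.Dv s
  set Pe := e.Psi (Sum.elim s (fun _ => δ))
  set Pb := m.Psi s
  have f1 : δ / 2 * I ≤ De + Db + (Pe - Pb) * p := by
    have : δ / 2 * I = δ / 2 * ∫ y, χ y * (m.L r y * ∑ k, m.mn (φ' k) r y ^ 2) ∂(gM ι) := rfl
    linarith
  have f2 : I ≤ 2 / δ * (De + Db) + 2 / δ * ((Pe - Pb) * p) := by
    have : I = 2 / δ * (δ / 2 * I) := by field_simp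
    rw [this, ← mul_add]; gcongr
  have f3 : 0 ≤ 2 / δ * (Pe - Pb) - a := by
    have : a = 2 / δ * (δ / 2 * a) := by field_simp
    have h5 : 2 / δ * (δ / 2 * a) ≤ 2 / δ * (Pe - Pb) := by gcongr
    linarith
  have f4 : (2 / δ * (Pe - Pb) - a) * p ≤ (2 / δ * (Pe - Pb) - a) * 1 := by gcongr
  have f5 : 4 / δ * (De + Db) = 2 * (2 / δ * (De + Db)) := by ring
  rw [f5]
  nlinarith

/-- duplicating features amounts to adding the signal-to-noise ratios -/
lemma ext_Psi_shift [DecidableEq ι] (j : κ → ι) (s : ι → ℝ) (hs : ∀ i, 0 ≤ s i) (δ : ℝ)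
    (hδ : 0 < δ) :
    (m.ext (fun k => m.φ (j k))).Psi (Sum.elim s (fun _ => δ))
      = m.Psi (fun i => s i + δ * ∑ k, if j k = i then 1 else 0) := by
  set e := m.ext (fun k => m.φ (j k)) with he
  set c : ι → ℝ := fun i => ∑ k, if j k = i then (1:ℝ) else 0 with hc
  have hc0 : ∀ i, 0 ≤ c i := fun i => Finset.sum_nonneg fun k _ => by split_ifs <;> norm_num
  set d : ι ⊕ κ → ℝ := Sum.elim c (fun _ => -1) with hd
  set s0 : ι ⊕ κ → ℝ := Sum.elim s (fun _ => δ) with hs0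
  have hline : Continuous fun t : ℝ => s0 + t • d := by fun_prop
  obtain ⟨ξ, hξ, h1⟩ := exists_hasDerivAt_eq_slope (fun t => e.Psi (s0 + t • d)) _ hδ
    (e.Psi_cont.comp hline).continuousOn
    (fun t ht => e.hasDerivAt_Psi s0 d t fun k => by
      rcases k with i | k
      · rcases (hc0 i).eq_or_lt with h | h
        · left; simp [hd, ← h]
        · right
          simp only [hs0, hd, Sum.elim_inl]
          have := mul_pos ht.1 h
          linarith [hs i]
      · right
        simp only [hs0, hd, Sum.elim_inr]; linarith [ht.2])
  have h2 : ∑ k, d k / 2 * e.Q (e.φ k) (s0 + ξ • d) = 0 := by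
    rw [Fintype.sum_sum_type]
    simp only [hd, Sum.elim_inl, Sum.elim_inr]
    have e1 : ∀ i, e.φ (Sum.inl i) = m.φ i := fun i => rfl
    have e2 : ∀ k, e.φ (Sum.inr k) = m.φ (j k) := fun k => rfl
    simp only [e1, e2, hc, Finset.sum_div, Finset.sum_mul]
    rw [Finset.sum_comm, ← Finset.sum_add_distrib]
    refine Finset.sum_eq_zero fun k _ => ?_
    simp only [ite_div, ite_mul, zero_div, zero_mul, Finset.sum_ite_eq, Finset.mem_univ, if_true]
    ring
  rw [h2] at h1
  have h3 : e.Psi (s0 + δ • d) = e.Psi s0 := by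
    have := h1.symm
    rw [div_eq_zero_iff] at this
    rcases this with h | h
    · simp only [zero_smul, add_zero] at h; linarith
    · linarith
  rw [← h3]
  have h4 : s0 + δ • d = Sum.elim (fun i => s i + δ * c i) 0 := by
    ext k; rcases k with i | k <;> simp [hs0, hd]
  rw [h4, he, ext_Psi_zero]

end Mdl
end MI


namespace MI

section EfronStein
variable {α : Type} [MeasurableSpace α]

/-- Coordinatewise Lipschitz condition relative to `g`. -/
def Lip {ι : Type} [Fintype ι] (g : α → ℝ) (c : ι → ℝ) (f : (ι → α) → ℝ) : Prop :=
  ∀ y y', |f y - f y'| ≤ ∑ k, c k * |g (y k) - g (y' k)|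

lemma memLp_subc {Ω : Type} [MeasurableSpace Ω] {μ : Measure Ω} [IsProbabilityMeasure μ]
    {h : Ω → ℝ} (hh : MemLp h 2 μ) (t : ℝ) : MemLp (fun a => h a - t) 2 μ := by
  have h5 : MemLp (fun _ : Ω => t) 2 μ := memLp_const _
  exact hh.sub h5

lemma memLp_lip {Ω : Type} [MeasurableSpace Ω] {μ : Measure Ω} [IsProbabilityMeasure μ]
    {h : Ω → ℝ} (hh : MemLp h 2 μ) (t c : ℝ) : MemLp (fun a => c * |h a - t|) 2 μ :=
  ((memLp_subc hh t).norm).const_mul c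

lemma Lip.memLp {ι : Type} [Fintype ι] {g : α → ℝ} {c : ι → ℝ} {f : (ι → α) → ℝ}
    (hl : Lip g c f) (hf : Measurable f) (μ : ι → Measure α) [∀ k, IsProbabilityMeasure (μ k)]
    (hg : ∀ k, MemLp g 2 (μ k)) : MemLp f 2 (Measure.pi μ) := by
  have hne : Nonempty (ι → α) := nonempty_of_isProbabilityMeasure (Measure.pi μ)
  obtain ⟨y0⟩ := hne
  have h1 : MemLp (fun y : ι → α => |f y0| + ∑ k, c k * |g (y k) - g (y0 k)|) 2
      (Measure.pi μ) := by
    have h2 : ∀ k, MemLp (fun y : ι → α => c k * |g (y k) - g (y0 k)|) 2 (Measure.pi μ) := by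
      intro k
      have h3 : MemLp (fun y : ι → α => g (y k)) 2 (Measure.pi μ) :=
        (hg k).comp_measurePreserving (measurePreserving_eval μ k)
      exact memLp_lip h3 _ _
    have h4 : MemLp (fun y : ι → α => ∑ k, c k * |g (y k) - g (y0 k)|) 2 (Measure.pi μ) :=
      memLp_finsetSum _ fun k _ => h2 k
    have h5 : MemLp (fun _ : ι → α => |f y0|) 2 (Measure.pi μ) := memLp_const _
    exact h5.add h4
  refine h1.mono hf.aestronglyMeasurable (Eventually.of_forall fun y => ?_)
  rw [Real.norm_eq_abs, Real.norm_eq_abs]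
  refine le_trans ?_ (le_abs_self _)
  have := hl y y0
  have h3 : |f y| ≤ |f y0| + |f y - f y0| := by
    have := abs_add_le (f y0) (f y - f y0)
    simpa using this
  linarith

lemma sq_expand (μ : Measure α) [IsProbabilityMeasure μ] {h : α → ℝ} (hh : MemLp h 2 μ) (u : ℝ) :
    ∫ a, (h a - u) ^ 2 ∂μ = ∫ a, h a ^ 2 ∂μ - 2 * u * ∫ a, h a ∂μ + u ^ 2 := by
  have i1 : Integrable h μ := hh.integrable (by norm_num)
  have i2 : Integrable (fun a => h a ^ 2) μ := hh.integrable_sq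
  have i3 : Integrable (fun a => 2 * u * h a) μ := i1.const_mul _
  have i4 : Integrable (fun a => h a ^ 2 - 2 * u * h a) μ := i2.sub i3
  have : ∀ a, (h a - u) ^ 2 = h a ^ 2 - 2 * u * h a + u ^ 2 := fun a => by ring
  simp_rw [this]
  rw [integral_add i4 (integrable_const _), integral_sub i2 i3, integral_const_mul]
  simp

lemma var_one (μ : Measure α) [IsProbabilityMeasure μ] {h : α → ℝ} (hh : MemLp h 2 μ) (t e : ℝ) :
    ∫ a, (h a - e) ^ 2 ∂μ ≤ ∫ a, (h a - t) ^ 2 ∂μ + ((∫ a, h a ∂μ) - e) ^ 2 := by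
  rw [sq_expand μ hh e, sq_expand μ hh t]
  nlinarith [sq_nonneg ((∫ a, h a ∂μ) - t)]

lemma efron_fin (g : α → ℝ) (V : ℝ) : ∀ (N : ℕ) (μ : Fin N → Measure α)
    [∀ k, IsProbabilityMeasure (μ k)] (_ : ∀ k, MemLp g 2 (μ k))
    (_ : ∀ k, ∃ a0, ∫ a, (g a - g a0) ^ 2 ∂(μ k) ≤ V)
    (c : Fin N → ℝ) (_ : ∀ k, 0 ≤ c k) (f : (Fin N → α) → ℝ) (_ : Measurable f) (_ : Lip g c f),
    ∫ y, (f y - ∫ y', f y' ∂(Measure.pi μ)) ^ 2 ∂(Measure.pi μ) ≤ V * ∑ k, c k ^ 2 := by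
  intro N
  induction N with
  | zero =>
    intro μ _ _ _ c _ f _ hl
    have h0 : ∀ y, f y = f default := fun y => by rw [Subsingleton.elim y default]
    have : ∀ y, f y - ∫ y', f y' ∂(Measure.pi μ) = 0 := by
      intro y
      simp_rw [h0]; simp
    simp_rw [this]
    simp
  | succ N ih =>
    intro μ _ hg hV c hc f hf hl
    have hmp := (measurePreserving_piFinSuccAbove μ 0).symm
    have hI : ∀ F : (Fin (N + 1) → α) → ℝ, ∫ y, F y ∂(Measure.pi μ)
        = ∫ p : α × (Fin N → α), F (Fin.cons p.1 p.2)
          ∂((μ 0).prod (Measure.pi fun j => μ (Fin.succ j))) := by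
      intro F
      rw [← hmp.integral_comp' F]
      simp [Fin.insertNthEquiv]
    have hmeas : Measurable fun p : α × (Fin N → α) => f (Fin.cons p.1 p.2) := by
      have := hf.comp (MeasurableEquiv.piFinSuccAbove (fun _ : Fin (N+1) => α) 0).symm.measurable
      simpa [Function.comp_def, Fin.insertNthEquiv] using this
    have hm2 : MemLp (fun p : α × (Fin N → α) => f (Fin.cons p.1 p.2)) 2
        ((μ 0).prod (Measure.pi fun j => μ (Fin.succ j))) := by
      have := (hl.memLp hf μ hg).comp_measurePreserving hmp
      simpa [Function.comp_def, Fin.insertNthEquiv] using this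
    set ν := Measure.pi fun j => μ (Fin.succ j) with hν
    set m := ∫ y', f y' ∂(Measure.pi μ) with hm
    set h : (Fin N → α) → ℝ := fun b => ∫ a, f (Fin.cons a b) ∂(μ 0) with hh
    have hla : ∀ a a' b b', |f (Fin.cons a b) - f (Fin.cons a' b')|
        ≤ c 0 * |g a - g a'| + ∑ k : Fin N, c k.succ * |g (b k) - g (b' k)| := by
      intro a a' b b'
      have := hl (Fin.cons a b) (Fin.cons a' b')
      simpa [Fin.sum_univ_succ] using this
    have hmb : ∀ b, Measurable fun a => f (Fin.cons a b) := fun b =>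
      hmeas.comp (measurable_id.prodMk measurable_const)
    have hpb : ∀ b, MemLp (fun a => f (Fin.cons a b)) 2 (μ 0) := by
      intro b
      obtain ⟨a0, -⟩ := hV 0
      have h1 : MemLp (fun a => |f (Fin.cons a0 b)| + c 0 * |g a - g a0|) 2 (μ 0) :=
by
        have h5 : MemLp (fun _ : α => |f (Fin.cons a0 b)|) 2 (μ 0) := memLp_const _
        exact h5.add (memLp_lip (hg 0) _ _)
      refine h1.mono (hmb b).aestronglyMeasurable (Eventually.of_forall fun a => ?_)
      rw [Real.norm_eq_abs, Real.norm_eq_abs]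
      refine le_trans ?_ (le_abs_self _)
      have := hla a a0 b b
      simp only [sub_self, abs_zero, mul_zero, Finset.sum_const_zero, add_zero] at this
      have h3 := abs_add_le (f (Fin.cons a0 b)) (f (Fin.cons a b) - f (Fin.cons a0 b))
      rw [add_sub_cancel] at h3
      linarith
    have hib : ∀ b, Integrable (fun a => f (Fin.cons a b)) (μ 0) := fun b =>
      (hpb b).integrable (by norm_num)
    have hmh : Measurable h :=
      (StronglyMeasurable.integral_prod_left' hmeas.stronglyMeasurable).measurable
    have hlh : Lip g (fun k : Fin N => c k.succ) h := by
      intro b b'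
      simp only [hh]
      rw [← integral_sub (hib b) (hib b'), ← Real.norm_eq_abs]
      have := norm_integral_le_of_norm_le_const (μ := μ 0)
        (f := fun a => f (Fin.cons a b) - f (Fin.cons a b'))
        (C := ∑ k : Fin N, c k.succ * |g (b k) - g (b' k)|)
        (Eventually.of_forall fun a => by simpa using hla a a b b')
      simpa using this
    have hEm : m = ∫ b, h b ∂ν := by
      rw [hm, hI, integral_prod_symm _ (hm2.integrable (by norm_num))]
    have hih := ih (fun j => μ (Fin.succ j)) (fun k => hg _) (fun k => hV _)
      (fun k => c k.succ) (fun k => hc _) h hmh hlh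
    rw [← hν, ← hEm] at hih
    have i2 : Integrable (fun p : α × (Fin N → α) => (f (Fin.cons p.1 p.2) - m) ^ 2)
        ((μ 0).prod ν) := (memLp_subc hm2 m).integrable_sq
    rw [hI, integral_prod_symm _ i2]
    have i3 : Integrable (fun b => (h b - m) ^ 2) ν :=
      (memLp_subc (hlh.memLp hmh _ (fun k => hg _)) m).integrable_sq
    calc ∫ b, ∫ a, (f (Fin.cons a b) - m) ^ 2 ∂(μ 0) ∂ν
        ≤ ∫ b, (c 0 ^ 2 * V + (h b - m) ^ 2) ∂ν := by
          refine integral_mono i2.integral_prod_right ((integrable_const _).add i3) fun b => ?_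
          obtain ⟨a0, ha0⟩ := hV 0
          refine (var_one (μ 0) (hpb b) (f (Fin.cons a0 b)) m).trans ?_
          refine add_le_add ?_ le_rfl
          have j1 : Integrable (fun a => c 0 ^ 2 * (g a - g a0) ^ 2) (μ 0) :=
            ((memLp_subc (hg 0) (g a0)).integrable_sq).const_mul _
          calc ∫ a, (f (Fin.cons a b) - f (Fin.cons a0 b)) ^ 2 ∂(μ 0)
              ≤ ∫ a, c 0 ^ 2 * (g a - g a0) ^ 2 ∂(μ 0) := by
                refine integral_mono (memLp_subc (hpb b) _).integrable_sq j1 fun a => ?_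
                have := hla a a0 b b
                simp only [sub_self, abs_zero, mul_zero, Finset.sum_const_zero, add_zero] at this
                simp only
                rw [← sq_abs, ← sq_abs (g a - g a0), ← mul_pow]
                exact pow_le_pow_left₀ (abs_nonneg _) this 2
            _ = c 0 ^ 2 * ∫ a, (g a - g a0) ^ 2 ∂(μ 0) := integral_const_mul _ _
            _ ≤ _ := by gcongr
      _ = c 0 ^ 2 * V + ∫ b, (h b - m) ^ 2 ∂ν := by
          rw [integral_add (integrable_const _) i3]; simp
      _ ≤ c 0 ^ 2 * V + V * ∑ k : Fin N, c k.succ ^ 2 := by gcongr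
      _ = _ := by rw [Fin.sum_univ_succ]; ring

lemma efron {ι : Type} [Fintype ι] (g : α → ℝ) (V : ℝ) (μ : ι → Measure α)
    [∀ k, IsProbabilityMeasure (μ k)] (hg : ∀ k, MemLp g 2 (μ k))
    (hV : ∀ k, ∃ a0, ∫ a, (g a - g a0) ^ 2 ∂(μ k) ≤ V)
    (c : ι → ℝ) (hc : ∀ k, 0 ≤ c k) (f : (ι → α) → ℝ) (hf : Measurable f) (hl : Lip g c f) :
    ∫ y, (f y - ∫ y', f y' ∂(Measure.pi μ)) ^ 2 ∂(Measure.pi μ) ≤ V * ∑ k, c k ^ 2 := by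
  let e := (Fintype.equivFin ι).symm
  have hmp := measurePreserving_piCongrLeft μ e
  have hev : ∀ (y : Fin (Fintype.card ι) → α) k,
      MeasurableEquiv.piCongrLeft (fun _ => α) e y (e k) = y k := fun y k =>
    MeasurableEquiv.piCongrLeft_apply_apply e (β := fun _ => α) y k
  have := efron_fin g V _ (fun k => μ (e k)) (fun k => hg _) (fun k => hV _) (fun k => c (e k))
    (fun k => hc _) (fun y => f (MeasurableEquiv.piCongrLeft (fun _ => α) e y))
    (hf.comp (MeasurableEquiv.measurable _)) ?_
  · rw [hmp.integral_comp' (g := f),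
      hmp.integral_comp' (g := fun y => (f y - ∫ y', f y' ∂(Measure.pi μ)) ^ 2),
      Equiv.sum_comp e (fun k => c k ^ 2)] at this
    exact this
  · intro y y'
    refine (hl _ _).trans (le_of_eq ?_)
    rw [← Equiv.sum_comp e]
    simp_rw [hev]

lemma efron_L1 {ι : Type} [Fintype ι] (g : α → ℝ) (V : ℝ) (μ : ι → Measure α)
    [∀ k, IsProbabilityMeasure (μ k)] (hg : ∀ k, MemLp g 2 (μ k))
    (hV : ∀ k, ∃ a0, ∫ a, (g a - g a0) ^ 2 ∂(μ k) ≤ V)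
    (c : ι → ℝ) (hc : ∀ k, 0 ≤ c k) (f : (ι → α) → ℝ) (hf : Measurable f) (hl : Lip g c f) :
    ∫ y, |f y - ∫ y', f y' ∂(Measure.pi μ)| ∂(Measure.pi μ) ≤ √(V * ∑ k, c k ^ 2) := by
  have h1 := efron g V μ hg hV c hc f hf hl
  have hm := hl.memLp hf μ hg
  set m := ∫ y', f y' ∂(Measure.pi μ)
  have hm' : MemLp (fun y => |f y - m|) 2 (Measure.pi μ) := (memLp_subc hm m).norm
  refine Real.le_sqrt_of_sq_le (le_trans ?_ h1)
  set A := ∫ y', |f y' - m| ∂(Measure.pi μ) with hA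
  have h3 : 0 ≤ ∫ y, (|f y - m| - A) ^ 2 ∂(Measure.pi μ) := integral_nonneg fun _ => sq_nonneg _
  rw [sq_expand _ hm', ← hA] at h3
  simp only [sq_abs] at h3
  linarith

end EfronStein

end MI


namespace MI

lemma memLp_id_stdG : MemLp (fun a : ℝ => a) 2 stdG := by
  unfold stdG
  exact memLp_id_gaussianReal 2

lemma sq_stdG : ∫ a : ℝ, (a - 0) ^ 2 ∂stdG ≤ 1 := by
  have h := variance_fun_id_gaussianReal (μ := 0) (v := 1)
  rw [variance_eq_integral (by fun_prop)] at h
  simp only [integral_id_gaussianReal] at h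
  exact le_of_eq (by simpa [stdG] using h)

namespace Mdl

section LL
variable {X ι : Type} [Fintype X] [Fintype ι] (m : Mdl X ι)

lemma logL_lip (r : ι → ℝ) (hr : ∀ k, 0 ≤ r k) (b : ι → ℝ) (hb : ∀ k x, |m.φ k x| ≤ b k)
    (y y' : ι → ℝ) :
    |Real.log (m.L r y) - Real.log (m.L r y')| ≤ ∑ k, r k * b k * |y k - y' k| := by
  have key : ∀ y y' : ι → ℝ, Real.log (m.L r y)
      ≤ Real.log (m.L r y') + ∑ k, r k * b k * |y k - y' k| := by
    intro y y'
    have h1 : m.L r y ≤ Real.exp (∑ k, r k * b k * |y k - y' k|) * m.L r y' := by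
      simp only [L, Finset.mul_sum]
      refine Finset.sum_le_sum fun x _ => ?_
      rw [mul_left_comm]
      refine mul_le_mul_of_nonneg_left ?_ (m.w0 x)
      rw [ex, ex, ← Real.exp_add]
      refine Real.exp_le_exp.2 ?_
      simp only [en, ← Finset.sum_add_distrib]
      refine Finset.sum_le_sum fun k _ => ?_
      have h2 : r k * m.φ k x * (y k - y' k) ≤ r k * b k * |y k - y' k| := by
        have h3 : m.φ k x * (y k - y' k) ≤ b k * |y k - y' k| := by
          refine (le_abs_self _).trans ?_
          rw [abs_mul]
          exact mul_le_mul_of_nonneg_right (hb k x) (abs_nonneg _)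
        have := mul_le_mul_of_nonneg_left h3 (hr k)
        linarith
      linarith
    have h2 := Real.log_le_log (m.L_pos r y) h1
    rw [Real.log_mul (Real.exp_pos _).ne' (m.L_pos r y').ne', Real.log_exp] at h2
    linarith
  rw [abs_le]
  have h1 := key y y'
  have h2 := key y' y
  simp_rw [abs_sub_comm (y' _)] at h2
  constructor <;> linarith

lemma EG_abs_log (r : ι → ℝ) (c : ℝ) : EG fun y => |Real.log (m.L r y) - c| :=
  ((m.nice_logL.sub (Nice.const c)).eg r).abs

lemma Dv_eq (s : ι → ℝ) : m.Dv s = ∑ x, m.w x *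
    ∫ z, |Real.log (m.L (rt s) (z + fun k => rt s k * m.φ k x)) - m.Psi s| ∂(gM ι) := by
  rw [Dv, m.nishimori (rt s) (fun y => |Real.log (m.L (rt s) y) - m.Psi s|) (m.EG_abs_log _ _)
    (((m.nice_logL.sub (Nice.const _)).cont _).abs.measurable)]

lemma Psi_eq (s : ι → ℝ) : m.Psi s = ∑ x, m.w x *
    ∫ z, Real.log (m.L (rt s) (z + fun k => rt s k * m.φ k x)) ∂(gM ι) := by
  rw [Psi, m.nishimori (rt s) (fun y => Real.log (m.L (rt s) y)) (m.nice_logL.eg _)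
    (m.nice_logL.cont _).measurable]

end LL

variable {J σ ι : Type} [Fintype J] [DecidableEq J] [Fintype σ] [Fintype ι]
  [MeasurableSpace σ] [MeasurableSingletonClass σ] (m : Mdl (J → σ) ι)

theorem Dv_le (μ : J → Measure σ) [∀ j, IsProbabilityMeasure (μ j)]
    (hw : ∀ x, m.w x = (Measure.pi μ).real {x}) (g : σ → ℝ) (K : ℝ) (hg : ∀ a, |g a| ≤ K)
    (b : ι → ℝ) (hb : ∀ k x, |m.φ k x| ≤ b k) (b0 : ∀ k, 0 ≤ b k)
    (ℓ : ι → J → ℝ) (l0 : ∀ k j, 0 ≤ ℓ k j)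
    (hl : ∀ k x x', |m.φ k x - m.φ k x'| ≤ ∑ j, ℓ k j * |g (x j) - g (x' j)|)
    (s : ι → ℝ) (hs : ∀ k, 0 ≤ s k) :
    m.Dv s ≤ √(∑ k, s k * b k ^ 2)
      + √((2 * K) ^ 2 * ∑ j, (∑ k, s k * b k * ℓ k j) ^ 2) := by
  set r := rt s with hr
  have r0 : ∀ k, 0 ≤ r k := fun k => Real.sqrt_nonneg _
  have rr : ∀ k, r k * r k = s k := fun k => Real.mul_self_sqrt (hs k)
  set F : (J → σ) → (ι → ℝ) → ℝ := fun x z => Real.log (m.L r (z + fun k => r k * m.φ k x)) with hF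
  have Fm : ∀ x, Measurable (F x) := fun x =>
    ((m.nice_logL.cont r).comp (by fun_prop)).measurable
  have lz : ∀ x, Lip (fun a : ℝ => a) (fun k => r k * b k) (F x) := by
    intro x z z'
    refine (m.logL_lip r r0 b hb _ _).trans (le_of_eq ?_)
    refine Finset.sum_congr rfl fun k _ => ?_
    simp
  have lx : ∀ x x' z, |F x z - F x' z| ≤ ∑ j, (∑ k, s k * b k * ℓ k j) * |g (x j) - g (x' j)| := by
    intro x x' z
    refine (m.logL_lip r r0 b hb _ _).trans ?_
    simp only [Pi.add_apply, add_sub_add_left_eq_sub, ← mul_sub, abs_mul, abs_of_nonneg (r0 _)]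
    simp_rw [Finset.sum_mul]
    rw [Finset.sum_comm]
    refine Finset.sum_le_sum fun k _ => ?_
    have := mul_le_mul_of_nonneg_left (hl k x x') (mul_nonneg (hs k) (b0 k))
    rw [Finset.mul_sum] at this
    calc r k * b k * (r k * |m.φ k x - m.φ k x'|) = s k * b k * |m.φ k x - m.φ k x'| := by
          rw [← rr]; ring
      _ ≤ _ := this.trans (le_of_eq (Finset.sum_congr rfl fun j _ => by ring))
  have Fp : ∀ x, MemLp (F x) 2 (gM ι) := fun x =>
    (lz x).memLp (Fm x) (fun _ => stdG) (fun _ => memLp_id_stdG)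
  have Fi : ∀ x, Integrable (F x) (gM ι) := fun x => (Fp x).integrable (by norm_num)
  set fb : (J → σ) → ℝ := fun x => ∫ z, F x z ∂(gM ι) with hfb
  have lfb : Lip g (fun j => ∑ k, s k * b k * ℓ k j) fb := by
    intro x x'
    simp only [hfb]
    rw [← integral_sub (Fi x) (Fi x'), ← Real.norm_eq_abs]
    have := norm_integral_le_of_norm_le_const (μ := gM ι)
        (f := fun z => F x z - F x' z)
        (C := ∑ j, (∑ k, s k * b k * ℓ k j) * |g (x j) - g (x' j)|)
        (Eventually.of_forall fun z => lx x x' z)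
    simpa using this
  have hsum : ∀ f : (J → σ) → ℝ, ∫ x, f x ∂(Measure.pi μ) = ∑ x, m.w x * f x := by
    intro f
    rw [integral_fintype (Integrable.of_finite)]
    simp [hw]
  have hPsi : m.Psi s = ∫ x, fb x ∂(Measure.pi μ) := by rw [m.Psi_eq, hsum]
  have e1 : ∀ x, ∫ z, |F x z - fb x| ∂(gM ι) ≤ √(∑ k, s k * b k ^ 2) := by
    intro x
    have := efron_L1 (fun a : ℝ => a) 1 (fun _ : ι => stdG) (fun _ => memLp_id_stdG)
      (fun _ => ⟨0, sq_stdG⟩) (fun k => r k * b k) (fun k => mul_nonneg (r0 k) (b0 k)) (F x) (Fm x)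
      (lz x)
    refine this.trans (le_of_eq ?_)
    rw [one_mul]
    congr 1
    exact Finset.sum_congr rfl fun k _ => by rw [← rr]; ring
  have gp : ∀ j, MemLp g 2 (μ j) := fun j =>
    MemLp.of_bound (Measurable.of_discrete).aestronglyMeasurable K
      (Eventually.of_forall hg)
  have e2 : ∫ x, |fb x - ∫ x', fb x' ∂(Measure.pi μ)| ∂(Measure.pi μ)
      ≤ √((2 * K) ^ 2 * ∑ j, (∑ k, s k * b k * ℓ k j) ^ 2) := by
    refine efron_L1 g _ μ gp ?_ _ ?_ fb Measurable.of_discrete lfb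
    · intro j
      obtain ⟨a0⟩ := nonempty_of_isProbabilityMeasure (μ j)
      refine ⟨a0, ?_⟩
      have := norm_integral_le_of_norm_le_const (μ := μ j) (f := fun a => (g a - g a0) ^ 2)
        (C := (2 * K) ^ 2) (Eventually.of_forall fun a => ?_)
      · refine (le_abs_self _).trans ?_
        simpa using this
      · have h1 := abs_le.1 (hg a)
        have h2 := abs_le.1 (hg a0)
        rw [Real.norm_eq_abs, abs_of_nonneg (sq_nonneg _)]
        exact sq_le_sq' (by linarith) (by linarith)
    · exact fun j => Finset.sum_nonneg fun k _ => mul_nonneg (mul_nonneg (hs k) (b0 k)) (l0 k j)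
  rw [← hPsi, hsum] at e2
  rw [Dv_eq]
  calc ∑ x, m.w x * ∫ z, |F x z - m.Psi s| ∂(gM ι)
      ≤ ∑ x, m.w x * (√(∑ k, s k * b k ^ 2) + |fb x - m.Psi s|) := by
        refine Finset.sum_le_sum fun x _ => mul_le_mul_of_nonneg_left ?_ (m.w0 x)
        have j1 : Integrable (fun z => |F x z - fb x|) (gM ι) := ((Fi x).sub (integrable_const _)).abs
        have j2 : Integrable (fun z => |F x z - m.Psi s|) (gM ι) :=
          ((Fi x).sub (integrable_const _)).abs
        calc ∫ z, |F x z - m.Psi s| ∂(gM ι)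
            ≤ ∫ z, (|F x z - fb x| + |fb x - m.Psi s|) ∂(gM ι) :=
              integral_mono j2 (j1.add (integrable_const _)) fun z => abs_sub_le _ _ _
          _ = ∫ z, |F x z - fb x| ∂(gM ι) + |fb x - m.Psi s| := by
              rw [integral_add j1 (integrable_const _)]; simp
          _ ≤ _ := by gcongr; exact e1 x
    _ = √(∑ k, s k * b k ^ 2) + ∑ x, m.w x * |fb x - m.Psi s| := by
        simp only [mul_add, Finset.sum_add_distrib, ← Finset.sum_mul, m.w1, one_mul]
    _ ≤ _ := by gcongr

end Mdl
end MI


namespace MI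
namespace Bip

variable {σ : Type} [Fintype σ] [MeasurableSpace σ] [MeasurableSingletonClass σ]
  (μU μV : Measure σ) [IsProbabilityMeasure μU] [IsProbabilityMeasure μV] (g : σ → ℝ) (n : ℕ)

/-- prior marginals -/
def mus : Fin n ⊕ Fin n → Measure σ := Sum.elim (fun _ => μU) (fun _ => μV)

instance instMus (j : Fin n ⊕ Fin n) : IsProbabilityMeasure (mus μU μV n j) := by
  cases j <;> simp only [mus, Sum.elim_inl, Sum.elim_inr] <;> infer_instance

/-- `u` coordinates -/
def fu (i : Fin n) (x : Fin n ⊕ Fin n → σ) : ℝ := g (x (Sum.inl i))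
/-- `v` coordinates -/
def fv (j : Fin n) (x : Fin n ⊕ Fin n → σ) : ℝ := g (x (Sum.inr j))

/-- index set of the observations -/
abbrev Ix (n : ℕ) : Type := (Fin n × Fin n) ⊕ (Fin n ⊕ Fin n)

/-- The bipartite model with side channels -/
def bm : Mdl (Fin n ⊕ Fin n → σ) (Ix n) where
  w x := (Measure.pi (mus μU μV n)).real {x}
  w0 x := measureReal_nonneg
  w1 := by
    have := integral_fintype (μ := Measure.pi (mus μU μV n)) (f := fun _ => (1 : ℝ))
      Integrable.of_finite
    simpa using this.symm
  φ := Sum.elim (fun p x => fu g n p.1 x * fv g n p.2 x) (Sum.elim (fu g n) (fv g n))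

/-- vector of SNRs -/
def sv (lam : ℝ) (t h1 h2 : ℝ) : Ix n → ℝ :=
  Sum.elim (fun _ => t * (lam / n)) (Sum.elim (fun _ => h1) (fun _ => h2))

lemma sv_nonneg {lam t h1 h2 : ℝ} (hl : 0 ≤ lam) (ht : 0 ≤ t) (hh1 : 0 ≤ h1) (hh2 : 0 ≤ h2)
    (k : Ix n) : 0 ≤ sv n lam t h1 h2 k := by
  rcases k with k | k | k <;> simp only [sv, Sum.elim_inl, Sum.elim_inr] <;> positivity

lemma sv_cont (lam : ℝ) : Continuous fun p : ℝ × ℝ × ℝ => sv n lam p.1 p.2.1 p.2.2 := by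
  refine continuous_pi fun k => ?_
  rcases k with k | k | k <;> simp only [sv, Sum.elim_inl, Sum.elim_inr] <;> fun_prop

/-- free energy density -/
def Ph (lam t h1 h2 : ℝ) : ℝ := (bm μU μV g n).Psi (sv n lam t h1 h2) / n
/-- overlap of `u` -/
def qa (lam t h1 h2 : ℝ) : ℝ := (∑ i, (bm μU μV g n).Q (fu g n i) (sv n lam t h1 h2)) / n
/-- overlap of `v` -/
def qb (lam t h1 h2 : ℝ) : ℝ := (∑ j, (bm μU μV g n).Q (fv g n j) (sv n lam t h1 h2)) / n
/-- overlap of `uv` -/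
def qc (lam t h1 h2 : ℝ) : ℝ :=
  (∑ p : Fin n × Fin n, (bm μU μV g n).Q (fun x => fu g n p.1 x * fv g n p.2 x)
    (sv n lam t h1 h2)) / n ^ 2
/-- derivative of `qb` in `h1` -/
def db (lam t h1 h2 : ℝ) : ℝ :=
  (∑ j, ∑ i, (bm μU μV g n).Cv (fv g n j) (fu g n i) (sv n lam t h1 h2)) / n
/-- derivative of `qa` in `h2` -/
def da (lam t h1 h2 : ℝ) : ℝ :=
  (∑ i, ∑ j, (bm μU μV g n).Cv (fu g n i) (fv g n j) (sv n lam t h1 h2)) / n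

lemma Ph_cont (lam : ℝ) : Continuous fun p : ℝ × ℝ × ℝ => Ph μU μV g n lam p.1 p.2.1 p.2.2 :=
  ((bm μU μV g n).Psi_cont.comp (sv_cont n lam)).div_const _

lemma qa_cont (lam : ℝ) : Continuous fun p : ℝ × ℝ × ℝ => qa μU μV g n lam p.1 p.2.1 p.2.2 :=
  (continuous_finsetSum _ fun i _ => ((bm μU μV g n).Q_cont _).comp (sv_cont n lam)).div_const _

lemma qb_cont (lam : ℝ) : Continuous fun p : ℝ × ℝ × ℝ => qb μU μV g n lam p.1 p.2.1 p.2.2 :=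
  (continuous_finsetSum _ fun i _ => ((bm μU μV g n).Q_cont _).comp (sv_cont n lam)).div_const _

lemma qc_cont (lam : ℝ) : Continuous fun p : ℝ × ℝ × ℝ => qc μU μV g n lam p.1 p.2.1 p.2.2 :=
  (continuous_finsetSum _ fun i _ => ((bm μU μV g n).Q_cont _).comp (sv_cont n lam)).div_const _

lemma db_cont (lam : ℝ) : Continuous fun p : ℝ × ℝ × ℝ => db μU μV g n lam p.1 p.2.1 p.2.2 :=
  (continuous_finsetSum _ fun i _ => continuous_finsetSum _ fun j _ =>
    ((bm μU μV g n).Cv_cont _ _).comp (sv_cont n lam)).div_const _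

lemma da_cont (lam : ℝ) : Continuous fun p : ℝ × ℝ × ℝ => da μU μV g n lam p.1 p.2.1 p.2.2 :=
  (continuous_finsetSum _ fun i _ => continuous_finsetSum _ fun j _ =>
    ((bm μU μV g n).Cv_cont _ _).comp (sv_cont n lam)).div_const _

lemma qa_nonneg (lam t h1 h2 : ℝ) : 0 ≤ qa μU μV g n lam t h1 h2 :=
  div_nonneg (Finset.sum_nonneg fun _ _ => Mdl.Q_nonneg _ _ _) (Nat.cast_nonneg _)

lemma qb_nonneg (lam t h1 h2 : ℝ) : 0 ≤ qb μU μV g n lam t h1 h2 :=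
  div_nonneg (Finset.sum_nonneg fun _ _ => Mdl.Q_nonneg _ _ _) (Nat.cast_nonneg _)

lemma qc_nonneg (lam t h1 h2 : ℝ) : 0 ≤ qc μU μV g n lam t h1 h2 :=
  div_nonneg (Finset.sum_nonneg fun _ _ => Mdl.Q_nonneg _ _ _) (by positivity)

lemma db_nonneg (lam t h1 h2 : ℝ) : 0 ≤ db μU μV g n lam t h1 h2 :=
  div_nonneg (Finset.sum_nonneg fun _ _ => Finset.sum_nonneg fun _ _ => Mdl.Cv_nonneg _ _ _ _)
    (Nat.cast_nonneg _)

lemma da_nonneg (lam t h1 h2 : ℝ) : 0 ≤ da μU μV g n lam t h1 h2 :=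
  div_nonneg (Finset.sum_nonneg fun _ _ => Finset.sum_nonneg fun _ _ => Mdl.Cv_nonneg _ _ _ _)
    (Nat.cast_nonneg _)

lemma avg_le {n : ℕ} {f : Fin n → ℝ} {c : ℝ} (hc : 0 ≤ c) (hf : ∀ i, f i ≤ c) :
    (∑ i, f i) / n ≤ c := by
  rcases Nat.eq_zero_or_pos n with h | h
  · subst h; simpa using hc
  · have h' : (0 : ℝ) < n := by exact_mod_cast h
    rw [div_le_iff₀ h']
    calc ∑ i, f i ≤ ∑ _i : Fin n, c := Finset.sum_le_sum fun i _ => hf i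
      _ = c * n := by simp [mul_comm]

variable {K : ℝ}

lemma qa_le (hg : ∀ a, |g a| ≤ K) (lam t h1 h2 : ℝ) : qa μU μV g n lam t h1 h2 ≤ K ^ 2 :=
  avg_le (sq_nonneg K) fun i => Mdl.Q_le _ _ K (fun x => hg _) _

lemma qb_le (hg : ∀ a, |g a| ≤ K) (lam t h1 h2 : ℝ) : qb μU μV g n lam t h1 h2 ≤ K ^ 2 :=
  avg_le (sq_nonneg K) fun i => Mdl.Q_le _ _ K (fun x => hg _) _

lemma Ph_tangent (hn : 0 < n) {lam t h1 h2 t' h1' h2' : ℝ} (hl : 0 ≤ lam) (ht : 0 ≤ t)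
    (hh1 : 0 ≤ h1) (hh2 : 0 ≤ h2) (ht' : 0 ≤ t') (hh1' : 0 ≤ h1') (hh2' : 0 ≤ h2') :
    Ph μU μV g n lam t h1 h2 + lam / 2 * (t' - t) * qc μU μV g n lam t h1 h2
      + (h1' - h1) / 2 * qa μU μV g n lam t h1 h2 + (h2' - h2) / 2 * qb μU μV g n lam t h1 h2
      ≤ Ph μU μV g n lam t' h1' h2' := by
  have hn' : (0 : ℝ) < n := by exact_mod_cast hn
  have h := (bm μU μV g n).Psi_tangent (sv n lam t h1 h2) (sv n lam t' h1' h2')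
    (sv_nonneg n hl ht hh1 hh2) (sv_nonneg n hl ht' hh1' hh2')
  rw [Fintype.sum_sum_type, Fintype.sum_sum_type] at h
  have e1 : ∀ p, (bm μU μV g n).φ (Sum.inl p) = fun x => fu g n p.1 x * fv g n p.2 x :=
    fun p => rfl
  have e2 : ∀ i, (bm μU μV g n).φ (Sum.inr (Sum.inl i)) = fu g n i := fun p => rfl
  have e3 : ∀ i, (bm μU μV g n).φ (Sum.inr (Sum.inr i)) = fv g n i := fun p => rfl
  simp only [e1, e2, e3] at h
  simp only [sv, Sum.elim_inl, Sum.elim_inr, ← Finset.mul_sum] at h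
  simp only [Ph, qa, qb, qc, sv]
  rw [le_div_iff₀ hn']
  refine le_trans (le_of_eq ?_) h
  field_simp
  ring

/-- directions -/
def dirT (lam : ℝ) : Ix n → ℝ := Sum.elim (fun _ => lam / n) (fun _ => 0)
def dir1 : Ix n → ℝ := Sum.elim (fun _ => 0) (Sum.elim (fun _ => 1) (fun _ => 0))
def dir2 : Ix n → ℝ := Sum.elim (fun _ => 0) (Sum.elim (fun _ => 0) (fun _ => 1))

lemma sv_T (lam t h1 h2 : ℝ) : sv n lam t h1 h2 = sv n lam 0 h1 h2 + t • dirT n lam := by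
  ext k
  rcases k with k | k | k <;> simp [sv, dirT]

lemma sv_1 (lam t h1 h2 : ℝ) : sv n lam t h1 h2 = sv n lam t 0 h2 + h1 • dir1 n := by
  ext k
  rcases k with k | k | k <;> simp [sv, dir1]

lemma sv_2 (lam t h1 h2 : ℝ) : sv n lam t h1 h2 = sv n lam t h1 0 + h2 • dir2 n := by
  ext k
  rcases k with k | k | k <;> simp [sv, dir2]

lemma dirT_ok (hn : 0 < n) {lam t : ℝ} (hl : 0 < lam) (ht : 0 < t) (h1 h2 : ℝ) (k : Ix n) :
    dirT n lam k = 0 ∨ 0 < sv n lam 0 h1 h2 k + t * dirT n lam k := by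
  have hn' : (0 : ℝ) < n := by exact_mod_cast hn
  rcases k with k | k | k
  · right; simp only [sv, dirT, Sum.elim_inl]; positivity
  · left; rfl
  · left; rfl

lemma dir1_ok {h1 : ℝ} (hh : 0 < h1) (lam t h2 : ℝ) (k : Ix n) :
    dir1 n k = 0 ∨ 0 < sv n lam t 0 h2 k + h1 * dir1 n k := by
  rcases k with k | k | k
  · left; rfl
  · right; simpa [sv, dir1] using hh
  · left; rfl

lemma dir2_ok {h2 : ℝ} (hh : 0 < h2) (lam t h1 : ℝ) (k : Ix n) :
    dir2 n k = 0 ∨ 0 < sv n lam t h1 0 k + h2 * dir2 n k := by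
  rcases k with k | k | k
  · left; rfl
  · left; rfl
  · right; simpa [sv, dir2] using hh

lemma Ph_dT (hn : 0 < n) {lam t : ℝ} (hl : 0 < lam) (ht : 0 < t) (h1 h2 : ℝ) :
    HasDerivAt (fun t => Ph μU μV g n lam t h1 h2) (lam / 2 * qc μU μV g n lam t h1 h2) t := by
  have hn' : (0 : ℝ) < n := by exact_mod_cast hn
  have h := ((bm μU μV g n).hasDerivAt_Psi (sv n lam 0 h1 h2) (dirT n lam) t
    (dirT_ok n hn hl ht h1 h2)).div_const (n : ℝ)
  simp only [← sv_T] at h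
  refine h.congr_deriv ?_
  rw [Fintype.sum_sum_type]
  simp only [dirT, Sum.elim_inl, Sum.elim_inr, zero_div, zero_mul, Finset.sum_const_zero, add_zero,
    ← Finset.mul_sum]
  simp only [qc, bm, Sum.elim_inl]
  field_simp

lemma Ph_d1 {h1 : ℝ} (hh : 0 < h1) (lam t h2 : ℝ) :
    HasDerivAt (fun h => Ph μU μV g n lam t h h2) (qa μU μV g n lam t h1 h2 / 2) h1 := by
  have h := ((bm μU μV g n).hasDerivAt_Psi (sv n lam t 0 h2) (dir1 n) h1
    (dir1_ok n hh lam t h2)).div_const (n : ℝ)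
  simp only [← sv_1] at h
  refine h.congr_deriv ?_
  rw [Fintype.sum_sum_type, Fintype.sum_sum_type]
  simp only [dir1, Sum.elim_inl, Sum.elim_inr, zero_div, zero_mul, Finset.sum_const_zero, add_zero,
    ← Finset.mul_sum, zero_add]
  simp only [qa, bm, Sum.elim_inl, Sum.elim_inr]
  ring

lemma Ph_d2 {h2 : ℝ} (hh : 0 < h2) (lam t h1 : ℝ) :
    HasDerivAt (fun h => Ph μU μV g n lam t h1 h) (qb μU μV g n lam t h1 h2 / 2) h2 := by
  have h := ((bm μU μV g n).hasDerivAt_Psi (sv n lam t h1 0) (dir2 n) h2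
    (dir2_ok n hh lam t h1)).div_const (n : ℝ)
  simp only [← sv_2] at h
  refine h.congr_deriv ?_
  rw [Fintype.sum_sum_type, Fintype.sum_sum_type]
  simp only [dir2, Sum.elim_inl, Sum.elim_inr, zero_div, zero_mul, Finset.sum_const_zero, add_zero,
    ← Finset.mul_sum, zero_add]
  simp only [qb, bm, Sum.elim_inl, Sum.elim_inr]
  ring

lemma qb_d1 {h1 : ℝ} (hh : 0 < h1) (lam t h2 : ℝ) :
    HasDerivAt (fun h => qb μU μV g n lam t h h2) (db μU μV g n lam t h1 h2) h1 := by
  have h := (HasDerivAt.fun_sum (u := Finset.univ) fun j _ =>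
    ((bm μU μV g n).hasDerivAt_Q (fv g n j) (sv n lam t 0 h2) (dir1 n) h1
    (dir1_ok n hh lam t h2))).div_const (n : ℝ)
  simp only [← sv_1] at h
  refine h.congr_deriv ?_
  simp only [Fintype.sum_sum_type]
  simp only [dir1, Sum.elim_inl, Sum.elim_inr, zero_div, zero_mul, Finset.sum_const_zero, add_zero,
    zero_add, one_mul]
  rfl

lemma qa_d2 {h2 : ℝ} (hh : 0 < h2) (lam t h1 : ℝ) :
    HasDerivAt (fun h => qa μU μV g n lam t h1 h) (da μU μV g n lam t h1 h2) h2 := by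
  have h := (HasDerivAt.fun_sum (u := Finset.univ) fun j _ =>
    ((bm μU μV g n).hasDerivAt_Q (fu g n j) (sv n lam t h1 0) (dir2 n) h2
    (dir2_ok n hh lam t h1))).div_const (n : ℝ)
  simp only [← sv_2] at h
  refine h.congr_deriv ?_
  simp only [Fintype.sum_sum_type]
  simp only [dir2, Sum.elim_inl, Sum.elim_inr, zero_div, zero_mul, Finset.sum_const_zero, add_zero,
    zero_add, one_mul]
  rfl

end Bip
end MI


namespace MI
namespace Bip

variable {σ : Type} [Fintype σ] [MeasurableSpace σ] [MeasurableSingletonClass σ]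
  (μU μV : Measure σ) [IsProbabilityMeasure μU] [IsProbabilityMeasure μV] (g : σ → ℝ) (n : ℕ)
  {K : ℝ}

/-- bounds on the features -/
def bb (K : ℝ) : Ix n → ℝ := Sum.elim (fun _ => K ^ 2) (Sum.elim (fun _ => K) (fun _ => K))
/-- Lipschitz constants -/
def ll (K : ℝ) : Ix n → Fin n ⊕ Fin n → ℝ :=
  Sum.elim (fun p j => (if j = Sum.inl p.1 then K else 0) + (if j = Sum.inr p.2 then K else 0))
    (Sum.elim (fun i j => if j = Sum.inl i then 1 else 0) (fun i j => if j = Sum.inr i then 1 else 0))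

lemma bb0 (hK : 0 ≤ K) (k : Ix n) : 0 ≤ bb n K k := by
  rcases k with k | k | k <;> simp only [bb, Sum.elim_inl, Sum.elim_inr] <;> positivity

lemma ll0 (hK : 0 ≤ K) (k : Ix n) (j) : 0 ≤ ll n K k j := by
  rcases k with k | k | k <;> simp only [ll, Sum.elim_inl, Sum.elim_inr] <;> positivity

lemma bb_ok (hg : ∀ a, |g a| ≤ K) (hK : 0 ≤ K) (k : Ix n) (x) :
    |(bm μU μV g n).φ k x| ≤ bb n K k := by
  rcases k with k | k | k <;> simp only [bm, bb, Sum.elim_inl, Sum.elim_inr, fu, fv]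
  · rw [abs_mul, sq]; exact mul_le_mul (hg _) (hg _) (abs_nonneg _) hK
  · exact hg _
  · exact hg _

lemma ll_ok (hg : ∀ a, |g a| ≤ K) (hK : 0 ≤ K) (k : Ix n) (x x') :
    |(bm μU μV g n).φ k x - (bm μU μV g n).φ k x'|
      ≤ ∑ j, ll n K k j * |g (x j) - g (x' j)| := by
  rcases k with k | k | k <;> simp only [bm, ll, Sum.elim_inl, Sum.elim_inr, fu, fv,
    Fintype.sum_sum_type]
  · simp only [Sum.inl.injEq, reduceCtorEq, if_false, add_zero, zero_add, ite_mul, zero_mul,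
      Finset.sum_ite_eq', Finset.mem_univ, if_true, Sum.inr.injEq]
    set u := g (x (Sum.inl k.1))
    set v := g (x (Sum.inr k.2)) with hv
    set u' := g (x' (Sum.inl k.1)) with hu'
    set v' := g (x' (Sum.inr k.2))
    have : u * v - u' * v' = (u - u') * v + u' * (v - v') := by ring
    rw [this]
    refine (abs_add_le _ _).trans ?_
    rw [abs_mul, abs_mul, mul_comm |u - u'|]
    have h1 : |v| ≤ K := hg _
    have h2 : |u'| ≤ K := hg _
    gcongr
  · simp
  · simp

lemma Dv_ext (hg : ∀ a, |g a| ≤ K) (hK : 0 ≤ K) (hn : 0 < n) {lam t h1 h2 δ M : ℝ}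
    (hl : 0 ≤ lam) (ht : 0 ≤ t) (ht1 : t ≤ 1) (hh1 : 0 ≤ h1) (hh2 : 0 ≤ h2) (h1M : h1 ≤ M)
    (h2M : h2 ≤ M) (hδ : 0 ≤ δ) (hδ1 : δ ≤ 1) :
    ((bm μU μV g n).ext (fu g n)).Dv (Sum.elim (sv n lam t h1 h2) fun _ => δ)
      ≤ √n * (√(lam * K ^ 4 + (2 * M + 1) * K ^ 2)
        + √((2 * K) ^ 2 * (2 * (lam * K ^ 3 + (M + 1) * K) ^ 2))) := by
  have hn' : (0 : ℝ) < n := by exact_mod_cast hn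
  have h := ((bm μU μV g n).ext (fu g n)).Dv_le (mus μU μV n) (fun x => rfl) g K hg
    (Sum.elim (bb n K) (fun _ => K)) ?_ ?_
    (Sum.elim (ll n K) (fun i j => if j = Sum.inl i then 1 else 0)) ?_ ?_
    (Sum.elim (sv n lam t h1 h2) fun _ => δ) ?_
  · refine h.trans ?_
    rw [mul_add, ← Real.sqrt_mul hn'.le, ← Real.sqrt_mul hn'.le]
    refine add_le_add (Real.sqrt_le_sqrt ?_) (Real.sqrt_le_sqrt ?_)
    · simp only [Fintype.sum_sum_type, Sum.elim_inl, Sum.elim_inr, sv, bb, Finset.sum_const,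
        Finset.card_univ, Fintype.card_prod, Fintype.card_fin, nsmul_eq_mul]
      push_cast
      have e : (n : ℝ) * n * (t * (lam / n) * (K ^ 2) ^ 2) + (n * (h1 * K ^ 2) + n * (h2 * K ^ 2))
          + n * (δ * K ^ 2) = n * (t * (lam * K ^ 4) + (h1 + h2 + δ) * K ^ 2) := by
        field_simp
        ring
      rw [e]
      have e1 : t * (lam * K ^ 4) ≤ lam * K ^ 4 := mul_le_of_le_one_left (by positivity) ht1
      have e2 : (h1 + h2 + δ) * K ^ 2 ≤ (2 * M + 1) * K ^ 2 := by gcongr; linarith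
      gcongr
    · rw [mul_left_comm]
      refine mul_le_mul_of_nonneg_left ?_ (by positivity)
      simp only [Fintype.sum_sum_type, Sum.elim_inl, Sum.elim_inr, sv, bb, ll,
        Fintype.sum_prod_type]
      simp only [Sum.inl.injEq, reduceCtorEq, if_false, add_zero, zero_add, mul_ite, mul_zero,
        Finset.sum_ite_eq, Finset.mem_univ, if_true, Sum.inr.injEq, Finset.sum_const_zero, mul_one,
        Finset.sum_const, Finset.card_univ, Fintype.card_prod, Fintype.card_fin, nsmul_eq_mul,
        smul_ite, smul_zero]
      have e : (n : ℝ) * (t * (lam / n) * K ^ 2 * K) = t * (lam * K ^ 3) := by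
        field_simp
      rw [e, ← mul_add]
      have e1 : t * (lam * K ^ 3) ≤ lam * K ^ 3 := mul_le_of_le_one_left (by positivity) ht1
      have e3 : h1 * K + δ * K ≤ (M + 1) * K := by rw [← add_mul]; gcongr
      have e4 : h2 * K ≤ (M + 1) * K := by gcongr; linarith
      have e5 : (t * (lam * K ^ 3) + h1 * K + δ * K) ^ 2 ≤ (lam * K ^ 3 + (M + 1) * K) ^ 2 := by
        refine pow_le_pow_left₀ (by positivity) ?_ 2; linarith
      have e6 : (t * (lam * K ^ 3) + h2 * K) ^ 2 ≤ (lam * K ^ 3 + (M + 1) * K) ^ 2 := by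
        refine pow_le_pow_left₀ (by positivity) ?_ 2; linarith
      refine mul_le_mul_of_nonneg_left ?_ hn'.le
      rw [two_mul]
      refine add_le_add ?_ ?_
      · simpa using e5
      · simpa using e6
  · rintro (k | k) x
    · exact bb_ok μU μV g n hg hK k x
    · exact hg _
  · rintro (k | k)
    · exact bb0 n hK k
    · exact hK
  · rintro (k | k) j
    · exact ll0 n hK k j
    · simp only [Sum.elim_inr]; positivity
  · rintro (k | k) x x'
    · exact ll_ok μU μV g n hg hK k x x'
    · simp [Mdl.ext, fu, Fintype.sum_sum_type]
  · rintro (k | k)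
    · exact sv_nonneg n hl ht hh1 hh2 k
    · exact hδ

end Bip

namespace Mdl
variable {X ι κ : Type} [Fintype X] [Fintype ι] [Fintype κ] (m : Mdl X ι)
variable (φ' : κ → X → ℝ)

lemma ext_Dv_zero (s : ι → ℝ) : (m.ext φ').Dv (Sum.elim s (fun _ => 0)) = m.Dv s := by
  have h0 : (fun _ : κ => (0 : ℝ)) = 0 := rfl
  have hi : Integrable (fun y => (m.ext φ').L (rt (Sum.elim s 0)) y
      * |Real.log ((m.ext φ').L (rt (Sum.elim s 0)) y) - (m.ext φ').Psi (Sum.elim s 0)|)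
      (gM (ι ⊕ κ)) :=
    (((m.ext φ').nice_L.eg _).mul ((m.ext φ').EG_abs_log _ _)).integrable
      ((((m.ext φ').nice_L.cont _).mul
        (((m.ext φ').nice_logL.sub (Nice.const _)).cont _).abs).measurable)
  rw [h0, Dv, gM_sum_integral _ hi]
  simp only [rt_elim, ext_L, rt_zero, L_zero, mul_one, ext_Psi_zero]
  simp [Dv]
end Mdl
end MI


namespace MI
namespace Mdl
variable {X ι : Type} [Fintype X] [Fintype ι] (m : Mdl X ι)

lemma thermal (f h : X → ℝ) {K : ℝ} (hf : ∀ x, |f x| ≤ K) (hh : ∀ x, |h x| ≤ K) (s : ι → ℝ)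
    {κ : ℝ} (hκ : 0 < κ) :
    |m.Q (fun x => f x * h x) s
      - ∫ y, m.L (rt s) y * (m.mn f (rt s) y ^ 2 * m.mn h (rt s) y ^ 2) ∂(gM ι)|
      ≤ K ^ 2 * (κ + m.Cv f h s / κ) := by
  have n1 : Nice fun r y => m.L r y * m.mn (fun x => f x * h x) r y ^ 2 :=
    m.nice_L.mul (m.nice_mn _).pow2
  have n2 : Nice fun r y => m.L r y * (m.mn f r y ^ 2 * m.mn h r y ^ 2) :=
    m.nice_L.mul ((m.nice_mn _).pow2.mul (m.nice_mn _).pow2)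
  have n3 : Nice fun r y => m.L r y * (m.mn (fun x => f x * h x) r y
      - m.mn f r y * m.mn h r y) ^ 2 :=
    m.nice_L.mul ((m.nice_mn _).sub ((m.nice_mn _).mul (m.nice_mn _))).pow2
  have i1 := n1.integrable (rt s)
  have i2 := n2.integrable (rt s)
  have i3 := n3.integrable (rt s)
  have i0 := m.nice_L.integrable (rt s)
  rw [Q_eq, ← integral_sub i1 i2, Cv_eq]
  have e : K ^ 2 * (κ + (∫ y, m.L (rt s) y * (m.mn (fun x => f x * h x) (rt s) y
      - m.mn f (rt s) y * m.mn h (rt s) y) ^ 2 ∂(gM ι)) / κ)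
      = ∫ y, (K ^ 2 * κ * m.L (rt s) y + K ^ 2 / κ * (m.L (rt s) y *
        (m.mn (fun x => f x * h x) (rt s) y - m.mn f (rt s) y * m.mn h (rt s) y) ^ 2)) ∂(gM ι) := by
    rw [integral_add (i0.const_mul _) (i3.const_mul _), integral_const_mul, integral_const_mul,
      m.int_L]
    ring
  rw [e]
  refine (abs_integral_le_integral_abs).trans
    (integral_mono (i1.sub i2).abs ((i0.const_mul _).add (i3.const_mul _)) fun y => ?_)
  simp only
  have hL := m.L_pos (rt s) y
  have b1 : |m.mn (fun x => f x * h x) (rt s) y| ≤ K ^ 2 :=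
    m.mn_abs_le _ _ (fun x => by
      rw [abs_mul, sq]
      exact mul_le_mul (hf x) (hh x) (abs_nonneg _) ((abs_nonneg _).trans (hf x))) _ _
  have b2 : |m.mn f (rt s) y * m.mn h (rt s) y| ≤ K ^ 2 := by
    have b3 := m.mn_abs_le f K hf (rt s) y
    have b4 := m.mn_abs_le h K hh (rt s) y
    rw [abs_mul, sq]
    exact mul_le_mul b3 b4 (abs_nonneg _) ((abs_nonneg _).trans b3)
  rw [← mul_pow]
  generalize m.mn (fun x => f x * h x) (rt s) y = A at *
  generalize m.mn f (rt s) y * m.mn h (rt s) y = B at *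
  generalize m.L (rt s) y = L at *
  rw [← mul_sub, abs_mul, abs_of_pos hL]
  have h1 : |A ^ 2 - B ^ 2| ≤ K ^ 2 * (2 * |A - B|) := by
    have : A ^ 2 - B ^ 2 = (A + B) * (A - B) := by ring
    rw [this, abs_mul]
    have h2 : |A + B| ≤ 2 * K ^ 2 := (abs_add_le _ _).trans (by linarith)
    calc |A + B| * |A - B| ≤ 2 * K ^ 2 * |A - B| := by gcongr
      _ = _ := by ring
  have h3 : 2 * |A - B| ≤ κ + (A - B) ^ 2 / κ := by
    rw [← sq_abs (A - B)]
    have : κ + |A - B| ^ 2 / κ - 2 * |A - B| = (κ - |A - B|) ^ 2 / κ := by field_simp; ring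
    have h4 : 0 ≤ (κ - |A - B|) ^ 2 / κ := by positivity
    linarith
  calc L * |A ^ 2 - B ^ 2| ≤ L * (K ^ 2 * (κ + (A - B) ^ 2 / κ)) := by
        gcongr
        exact h1.trans (mul_le_mul_of_nonneg_left h3 (sq_nonneg K))
    _ = _ := by ring

lemma disorder {κ κ' : Type} [Fintype κ] [Fintype κ'] (f : κ → X → ℝ) (h : κ' → X → ℝ) {K : ℝ}
    (hh : ∀ j x, |h j x| ≤ K) (s : ι → ℝ) :
    |∑ i, ∑ j, ∫ y, m.L (rt s) y * (m.mn (f i) (rt s) y ^ 2 * m.mn (h j) (rt s) y ^ 2) ∂(gM ι)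
      - (∑ i, m.Q (f i) s) * (∑ j, m.Q (h j) s)|
      ≤ Fintype.card κ' * K ^ 2 *
        ∫ y, m.L (rt s) y * |∑ k, m.mn (f k) (rt s) y ^ 2 - ∑ k, m.Q (f k) s| ∂(gM ι) := by
  set a := ∑ i, m.Q (f i) s with ha
  have nA : Nice fun r y => ∑ i, m.mn (f i) r y ^ 2 := Nice.sum _ fun k _ => (m.nice_mn _).pow2
  have nB : Nice fun r y => ∑ j, m.mn (h j) r y ^ 2 := Nice.sum _ fun k _ => (m.nice_mn _).pow2
  have e1 : ∑ i, ∑ j, ∫ y, m.L (rt s) y * (m.mn (f i) (rt s) y ^ 2 * m.mn (h j) (rt s) y ^ 2) ∂(gM ι)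
      = ∫ y, m.L (rt s) y * ((∑ i, m.mn (f i) (rt s) y ^ 2) * ∑ j, m.mn (h j) (rt s) y ^ 2)
        ∂(gM ι) := by
    simp_rw [Finset.sum_mul_sum, Finset.mul_sum]
    have hI : ∀ i j, Integrable (fun y => m.L (rt s) y *
        (m.mn (f i) (rt s) y ^ 2 * m.mn (h j) (rt s) y ^ 2)) (gM ι) := fun i j =>
      (m.nice_L.mul ((m.nice_mn _).pow2.mul (m.nice_mn _).pow2)).integrable (rt s)
    rw [integral_finsetSum _ fun i _ => integrable_finsetSum _ fun j _ => hI i j]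
    refine Finset.sum_congr rfl fun i _ => ?_
    rw [integral_finsetSum _ fun j _ => hI i j]
  have e2 : ∑ j, m.Q (h j) s = ∫ y, m.L (rt s) y * ∑ j, m.mn (h j) (rt s) y ^ 2 ∂(gM ι) := by
    simp_rw [Q_eq, Finset.mul_sum]
    rw [integral_finsetSum _ fun j _ => (m.nice_L.mul (m.nice_mn _).pow2).integrable (rt s)]
  rw [e1, e2, ← integral_const_mul, ← integral_const_mul,
    ← integral_sub ((m.nice_L.mul (nA.mul nB)).integrable (rt s))
      (((m.nice_L.mul nB).integrable (rt s)).const_mul _)]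
  have ni : Nice fun r y => m.L r y * ((∑ i, m.mn (f i) r y ^ 2) - a) :=
    m.nice_L.mul (nA.sub (Nice.const _))
  have i5 : Integrable (fun y => m.L (rt s) y * |(∑ i, m.mn (f i) (rt s) y ^ 2) - a|) (gM ι) := by
    have := (ni.integrable (rt s)).abs
    simpa only [abs_mul, abs_of_pos (m.L_pos _ _)] using this
  refine (abs_integral_le_integral_abs).trans
    (integral_mono (((m.nice_L.mul (nA.mul nB)).integrable (rt s)).sub
      (((m.nice_L.mul nB).integrable (rt s)).const_mul _)).abs (i5.const_mul _) fun y => ?_)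
  simp only
  have hB : ∑ j, m.mn (h j) (rt s) y ^ 2 ≤ Fintype.card κ' * K ^ 2 := by
    calc ∑ j, m.mn (h j) (rt s) y ^ 2 ≤ ∑ _j : κ', K ^ 2 :=
          Finset.sum_le_sum fun j _ => by
            rw [← sq_abs]
            exact pow_le_pow_left₀ (abs_nonneg _) (m.mn_abs_le _ K (hh j) _ _) 2
      _ = _ := by simp
  have hB0 : 0 ≤ ∑ j, m.mn (h j) (rt s) y ^ 2 := Finset.sum_nonneg fun _ _ => sq_nonneg _
  have hL := m.L_pos (rt s) y
  generalize ∑ j, m.mn (h j) (rt s) y ^ 2 = B at *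
  generalize ∑ i, m.mn (f i) (rt s) y ^ 2 = A at *
  generalize m.L (rt s) y = L at *
  have : L * (A * B) - a * (L * B) = B * (L * (A - a)) := by ring
  rw [this, abs_mul, abs_mul, abs_of_pos hL, abs_of_nonneg hB0]
  gcongr

end Mdl

namespace Bip
variable {σ : Type} [Fintype σ] [MeasurableSpace σ] [MeasurableSingletonClass σ]
  (μU μV : Measure σ) [IsProbabilityMeasure μU] [IsProbabilityMeasure μV] (g : σ → ℝ) (n : ℕ)
  {K : ℝ}

/-- constant in the fluctuation bound -/
def CD (K lam M : ℝ) : ℝ := √(lam * K ^ 4 + (2 * M + 1) * K ^ 2)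
        + √((2 * K) ^ 2 * (2 * (lam * K ^ 3 + (M + 1) * K) ^ 2))

lemma ext_Psi_eq {lam t h1 h2 δ : ℝ}
    (hl : 0 ≤ lam) (ht : 0 ≤ t) (hh1 : 0 ≤ h1) (hh2 : 0 ≤ h2) (hδ : 0 < δ) :
    ((bm μU μV g n).ext (fu g n)).Psi (Sum.elim (sv n lam t h1 h2) fun _ => δ)
      = (bm μU μV g n).Psi (sv n lam t (h1 + δ) h2) := by
  have h := (bm μU μV g n).ext_Psi_shift (fun k : Fin n => (Sum.inr (Sum.inl k) : Ix n))
    (sv n lam t h1 h2) (sv_nonneg n hl ht hh1 hh2) δ hδ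
  refine h.trans ?_
  congr 1
  ext k
  rcases k with k | k | k <;> simp [sv]

theorem err_pt (hg : ∀ a, |g a| ≤ K) (hK : 0 ≤ K) (hn : 0 < n) {lam t h1 h2 δ κ M : ℝ}
    (hl : 0 ≤ lam) (ht : 0 ≤ t) (ht1 : t ≤ 1) (hh1 : 0 ≤ h1) (hh2 : 0 ≤ h2) (h1M : h1 ≤ M)
    (h2M : h2 ≤ M) (hδ : 0 < δ) (hδ1 : δ ≤ 1) (hκ : 0 < κ) :
    |qc μU μV g n lam t h1 h2 - qa μU μV g n lam t h1 h2 * qb μU μV g n lam t h1 h2|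
      ≤ K ^ 2 * κ + K ^ 2 / (n * κ) * da μU μV g n lam t h1 h2
        + 8 * K ^ 2 * CD K lam M / (δ * √n)
        + 2 * K ^ 2 * (qa μU μV g n lam t (h1 + δ) h2 - qa μU μV g n lam t h1 h2) := by
  have hn' : (0 : ℝ) < n := by exact_mod_cast hn
  set m := bm μU μV g n with hm
  set s := sv n lam t h1 h2 with hs
  have hu : ∀ i x, |fu g n i x| ≤ K := fun i x => hg _
  have hv : ∀ i x, |fv g n i x| ≤ K := fun i x => hg _
  -- concentration
  have c1 := m.conc (fu g n) s δ hδ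
  have d1 := Dv_ext μU μV g n hg hK hn hl ht ht1 hh1 hh2 h1M h2M hδ.le hδ1
  have d2 := Dv_ext μU μV g n hg hK hn hl ht ht1 hh1 hh2 h1M h2M le_rfl zero_le_one
  rw [Mdl.ext_Dv_zero] at d2
  rw [← hm, ← hs] at d1 d2
  change _ ≤ √n * CD K lam M at d1
  change _ ≤ √n * CD K lam M at d2
  have d3 := ext_Psi_eq μU μV g n hl ht hh1 hh2 hδ
  rw [← hm, ← hs] at d3
  rw [d3] at c1
  have t1 := Ph_tangent μU μV g n hn (t := t) (h1 := h1 + δ) (h2 := h2) (t' := t) (h1' := h1)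
    (h2' := h2) hl ht (by linarith) hh2 ht hh1 hh2
  have ePh : m.Psi (sv n lam t (h1 + δ) h2) - m.Psi s
      = n * (Ph μU μV g n lam t (h1 + δ) h2 - Ph μU μV g n lam t h1 h2) := by
    simp only [Ph, ← hm, ← hs]; field_simp
  have eqa : ∑ k, m.Q (fu g n k) s = n * qa μU μV g n lam t h1 h2 := by
    simp only [qa, ← hm, ← hs]; field_simp
  have eqb : ∑ k, m.Q (fv g n k) s = n * qb μU μV g n lam t h1 h2 := by
    simp only [qb, ← hm, ← hs]; field_simp
  have eqc : ∑ i, ∑ j, m.Q (fun x => fu g n i x * fv g n j x) s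
      = n ^ 2 * qc μU μV g n lam t h1 h2 := by
    simp only [qc, ← hm, ← hs, Fintype.sum_prod_type]; field_simp
  have eda : ∑ i, ∑ j, m.Cv (fu g n i) (fv g n j) s = n * da μU μV g n lam t h1 h2 := by
    simp only [da, ← hm, ← hs]; field_simp
  set E := ∫ y, m.L (Mdl.rt s) y * |∑ k, m.mn (fu g n k) (Mdl.rt s) y ^ 2
    - ∑ k, m.Q (fu g n k) s| ∂(gM (Ix n)) with hE
  have c2 : E ≤ n * (8 * CD K lam M / (δ * √n)
      + 2 * (qa μU μV g n lam t (h1 + δ) h2 - qa μU μV g n lam t h1 h2)) := by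
    refine c1.trans ?_
    rw [ePh, eqa]
    have p1 : 2 / δ * (n * (Ph μU μV g n lam t (h1 + δ) h2 - Ph μU μV g n lam t h1 h2))
        ≤ n * qa μU μV g n lam t (h1 + δ) h2 := by
      have : Ph μU μV g n lam t (h1 + δ) h2 - Ph μU μV g n lam t h1 h2
        ≤ δ / 2 * qa μU μV g n lam t (h1 + δ) h2 := by
        simp only [sub_self, mul_zero, zero_mul, zero_div, add_zero] at t1
        linarith
      calc _ ≤ 2 / δ * (n * (δ / 2 * qa μU μV g n lam t (h1 + δ) h2)) := by gcongr
        _ = _ := by field_simp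
    have p2 : 4 / δ * (((m.ext (fu g n)).Dv (Sum.elim s fun _ => δ)) + m.Dv s)
        ≤ n * (8 * CD K lam M / (δ * √n)) := by
      calc _ ≤ 4 / δ * (√n * CD K lam M + √n * CD K lam M) := by gcongr
        _ = 8 * CD K lam M / δ * √n := by ring
        _ = 8 * CD K lam M / δ * (n / √n) := by rw [Real.div_sqrt]
        _ = _ := by field_simp
    linarith
  have dis := m.disorder (fu g n) (fv g n) hv s
  rw [← hE, eqa, eqb, Fintype.card_fin] at dis
  have th : |∑ i, ∑ j, m.Q (fun x => fu g n i x * fv g n j x) s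
      - ∑ i, ∑ j, ∫ y, m.L (Mdl.rt s) y * (m.mn (fu g n i) (Mdl.rt s) y ^ 2
        * m.mn (fv g n j) (Mdl.rt s) y ^ 2) ∂(gM (Ix n))|
      ≤ n ^ 2 * (K ^ 2 * κ + K ^ 2 / (n * κ) * da μU μV g n lam t h1 h2) := by
    simp only [← Finset.sum_sub_distrib]
    calc _ ≤ ∑ i, ∑ j, K ^ 2 * (κ + m.Cv (fu g n i) (fv g n j) s / κ) := by
          refine (Finset.abs_sum_le_sum_abs _ _).trans (Finset.sum_le_sum fun i _ => ?_)
          refine (Finset.abs_sum_le_sum_abs _ _).trans (Finset.sum_le_sum fun j _ => ?_)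
          exact m.thermal _ _ (hu i) (hv j) s hκ
      _ = K ^ 2 * (n ^ 2 * κ + (∑ i, ∑ j, m.Cv (fu g n i) (fv g n j) s) / κ) := by
          simp only [← Finset.mul_sum, Finset.sum_add_distrib, Finset.sum_const, Finset.card_univ,
            Fintype.card_fin, nsmul_eq_mul, ← Finset.sum_div]
          ring
      _ = _ := by rw [eda]; field_simp
  rw [eqc] at th
  generalize ∑ i, ∑ j, ∫ y, m.L (Mdl.rt s) y * (m.mn (fu g n i) (Mdl.rt s) y ^ 2
        * m.mn (fv g n j) (Mdl.rt s) y ^ 2) ∂(gM (Ix n)) = Z at *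
  generalize qc μU μV g n lam t h1 h2 = c at *
  generalize qa μU μV g n lam t h1 h2 = a at *
  generalize qb μU μV g n lam t h1 h2 = b at *
  have fin1 : n ^ 2 * |c - a * b| ≤ |n ^ 2 * c - Z| + |Z - n * a * (n * b)| := by
    have : (n : ℝ) ^ 2 * |c - a * b| = |n ^ 2 * c - n * a * (n * b)| := by
      rw [← abs_of_pos (show (0 : ℝ) < n ^ 2 by positivity), ← abs_mul,
        abs_of_pos (show (0 : ℝ) < n ^ 2 by positivity)]
      congr 1; ring
    rw [this]
    exact abs_sub_le _ _ _
  have fin2 : n * K ^ 2 * E ≤ n ^ 2 * (8 * K ^ 2 * CD K lam M / (δ * √n)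
      + 2 * K ^ 2 * (qa μU μV g n lam t (h1 + δ) h2 - a)) := by
    calc _ ≤ n * K ^ 2 * (n * (8 * CD K lam M / (δ * √n)
      + 2 * (qa μU μV g n lam t (h1 + δ) h2 - a))) := by gcongr
      _ = _ := by ring
  have fin3 : (n : ℝ) ^ 2 * |c - a * b| ≤ n ^ 2 * (K ^ 2 * κ + K ^ 2 / (n * κ) * da μU μV g n lam t h1 h2
        + 8 * K ^ 2 * CD K lam M / (δ * √n)
        + 2 * K ^ 2 * (qa μU μV g n lam t (h1 + δ) h2 - a)) := by linarith
  exact le_of_mul_le_mul_left fin3 (by positivity)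

end Bip
end MI


namespace MI

/-- iterated integral over the square -/
def I2 (M : ℝ) (f : ℝ → ℝ → ℝ) : ℝ := ∫ x in (0:ℝ)..M, ∫ y in (0:ℝ)..M, f x y

section I2
variable {M : ℝ} {f g : ℝ → ℝ → ℝ}

/-- joint continuity -/
def C2 (f : ℝ → ℝ → ℝ) : Prop := Continuous fun p : ℝ × ℝ => f p.1 p.2

lemma C2.y (h : C2 f) (x : ℝ) : Continuous (f x) := by
  have : Continuous fun y => (fun p : ℝ × ℝ => f p.1 p.2) (x, y) := h.comp (by fun_prop)
  exact this

lemma C2.x (h : C2 f) (y : ℝ) : Continuous (fun x => f x y) := by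
  have : Continuous fun x => (fun p : ℝ × ℝ => f p.1 p.2) (x, y) := h.comp (by fun_prop)
  exact this

lemma C2.inner (h : C2 f) (a b : ℝ) : Continuous fun x => ∫ y in a..b, f x y :=
  intervalIntegral.continuous_parametric_intervalIntegral_of_continuous' h a b

lemma C2.add (hf : C2 f) (hg : C2 g) : C2 (fun x y => f x y + g x y) := Continuous.add hf hg
lemma C2.sub (hf : C2 f) (hg : C2 g) : C2 (fun x y => f x y - g x y) := Continuous.sub hf hg
lemma C2.mul (hf : C2 f) (hg : C2 g) : C2 (fun x y => f x y * g x y) := Continuous.mul hf hg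
lemma C2.abs (hf : C2 f) : C2 (fun x y => |f x y|) := Continuous.abs hf
lemma C2.const (c : ℝ) : C2 (fun _ _ => c) := continuous_const

lemma I2_mono (hM : 0 ≤ M) (hf : C2 f) (hg : C2 g)
    (h : ∀ x ∈ Set.Icc 0 M, ∀ y ∈ Set.Icc 0 M, f x y ≤ g x y) : I2 M f ≤ I2 M g :=
  intervalIntegral.integral_mono_on hM ((hf.inner 0 M).intervalIntegrable _ _)
    ((hg.inner 0 M).intervalIntegrable _ _) fun x hx =>
    intervalIntegral.integral_mono_on hM ((hf.y x).intervalIntegrable _ _)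
    ((hg.y x).intervalIntegrable _ _) fun y hy => h x hx y hy

lemma I2_add (hf : C2 f) (hg : C2 g) : I2 M (fun x y => f x y + g x y) = I2 M f + I2 M g := by
  unfold I2
  rw [← intervalIntegral.integral_add ((hf.inner 0 M).intervalIntegrable _ _)
    ((hg.inner 0 M).intervalIntegrable _ _)]
  congr 1; ext x
  rw [← intervalIntegral.integral_add ((hf.y x).intervalIntegrable _ _)
    ((hg.y x).intervalIntegrable _ _)]

lemma I2_cmul (c : ℝ) : I2 M (fun x y => c * f x y) = c * I2 M f := by
  unfold I2
  simp only [intervalIntegral.integral_const_mul]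

lemma I2_const (c : ℝ) : I2 M (fun _ _ => c) = M ^ 2 * c := by
  unfold I2
  simp; ring

lemma I2_sub (hf : C2 f) (hg : C2 g) : I2 M (fun x y => f x y - g x y) = I2 M f - I2 M g := by
  have h1 : C2 (fun x y => (-1) * g x y) := (C2.const (-1)).mul hg
  have := I2_add (M := M) hf h1
  rw [I2_cmul] at this
  rw [sub_eq_add_neg, neg_eq_neg_one_mul, ← this]
  congr 1; ext x y; ring

lemma I2_nonneg (hM : 0 ≤ M) (hf : C2 f)
    (h : ∀ x ∈ Set.Icc 0 M, ∀ y ∈ Set.Icc 0 M, 0 ≤ f x y) : 0 ≤ I2 M f := by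
  have := I2_mono hM (C2.const 0) hf h
  rwa [I2_const, mul_zero] at this

lemma I2_exists (hM : 0 < M) (hf : C2 f) {η : ℝ} (h : I2 M f ≤ η) :
    ∃ x ∈ Set.Icc 0 M, ∃ y ∈ Set.Icc 0 M, f x y ≤ η / M ^ 2 := by
  by_contra hc
  push Not at hc
  obtain ⟨p, hp, hmin⟩ := (isCompact_Icc.prod isCompact_Icc :
    IsCompact (Set.Icc (0:ℝ) M ×ˢ Set.Icc (0:ℝ) M)).exists_isMinOn
    ⟨(0, 0), ⟨⟨le_rfl, hM.le⟩, ⟨le_rfl, hM.le⟩⟩⟩ (Continuous.continuousOn hf)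
  have h1 := hc p.1 hp.1 p.2 hp.2
  have h2 : I2 M (fun _ _ => f p.1 p.2) ≤ I2 M f := I2_mono hM.le (C2.const _) hf
    fun x hx y hy => hmin (Set.mk_mem_prod hx hy : (x, y) ∈ _)
  rw [I2_const] at h2
  rw [div_lt_iff₀ (by positivity)] at h1
  linarith

end I2

namespace Bip
variable {σ : Type} [Fintype σ] [MeasurableSpace σ] [MeasurableSingletonClass σ]
  (μU μV : Measure σ) [IsProbabilityMeasure μU] [IsProbabilityMeasure μV] (g : σ → ℝ) (n : ℕ)
  {K : ℝ}

lemma c2_of {F : ℝ → ℝ → ℝ → ℝ} (h : Continuous fun p : ℝ × ℝ × ℝ => F p.1 p.2.1 p.2.2) (t : ℝ) :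
    C2 (F t) := by
  have : Continuous fun q : ℝ × ℝ => (fun p : ℝ × ℝ × ℝ => F p.1 p.2.1 p.2.2) (t, q.1, q.2) :=
    h.comp (by fun_prop)
  exact this

lemma int_da (hg : ∀ a, |g a| ≤ K) (lam t h1 : ℝ) {M : ℝ} (hM : 0 ≤ M) :
    ∫ h2 in (0:ℝ)..M, da μU μV g n lam t h1 h2 ≤ K ^ 2 := by
  rw [intervalIntegral.integral_eq_sub_of_hasDerivAt_of_le hM
    (f := fun h2 => qa μU μV g n lam t h1 h2)
    ((c2_of (qa_cont μU μV g n lam) t).y h1).continuousOn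
    (fun x hx => qa_d2 μU μV g n hx.1 lam t h1)
    (((c2_of (da_cont μU μV g n lam) t).y h1).intervalIntegrable _ _)]
  have := qa_le μU μV g n hg lam t h1 M
  have := qa_nonneg μU μV g n lam t h1 0
  linarith

lemma int_shift (hg : ∀ a, |g a| ≤ K) (lam t : ℝ) {M δ : ℝ} (hM : 0 ≤ M) (hδ : 0 ≤ δ) :
    I2 M (fun h1 h2 => qa μU μV g n lam t (h1 + δ) h2 - qa μU μV g n lam t h1 h2)
      ≤ δ * (M * K ^ 2) := by
  have hc := c2_of (qa_cont μU μV g n lam) t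
  have hc' : C2 (fun h1 h2 => qa μU μV g n lam t (h1 + δ) h2) := by
    have : Continuous fun q : ℝ × ℝ => (fun p : ℝ × ℝ => qa μU μV g n lam t p.1 p.2) (q.1 + δ, q.2) :=
      Continuous.comp hc (by fun_prop)
    exact this
  rw [I2_sub hc' hc]
  set G : ℝ → ℝ := fun x => ∫ y in (0:ℝ)..M, qa μU μV g n lam t x y with hG
  have Gc : Continuous G := hc.inner 0 M
  have e1 : I2 M (fun h1 h2 => qa μU μV g n lam t (h1 + δ) h2) = ∫ x in δ..(M + δ), G x := by
    have := intervalIntegral.integral_comp_add_right (a := 0) (b := M) G δ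
    rw [zero_add] at this
    exact this
  have e2 : I2 M (fun h1 h2 => qa μU μV g n lam t h1 h2) = ∫ x in (0:ℝ)..M, G x := rfl
  rw [e1, e2]
  have ii : ∀ a b, IntervalIntegrable G volume a b := fun a b => Gc.intervalIntegrable a b
  have h1 := intervalIntegral.integral_add_adjacent_intervals (ii 0 δ) (ii δ (M + δ))
  have h2 := intervalIntegral.integral_add_adjacent_intervals (ii 0 M) (ii M (M + δ))
  have h3 : 0 ≤ ∫ x in (0:ℝ)..δ, G x := intervalIntegral.integral_nonneg hδ fun x _ =>
    intervalIntegral.integral_nonneg hM fun y _ => qa_nonneg _ _ _ _ _ _ _ _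
  have h4 : ∫ x in M..(M + δ), G x ≤ ∫ x in M..(M + δ), M * K ^ 2 := by
    refine intervalIntegral.integral_mono_on (by linarith) (ii _ _) (by simp) fun x _ => ?_
    have : G x ≤ ∫ y in (0:ℝ)..M, K ^ 2 :=
      intervalIntegral.integral_mono_on hM ((hc.y x).intervalIntegrable _ _) (by simp)
        fun y _ => qa_le μU μV g n hg _ _ _ _
    simpa using this
  rw [intervalIntegral.integral_const, smul_eq_mul, add_sub_cancel_left] at h4
  linarith

/-- the constant -/
def CE (K lam M : ℝ) : ℝ :=
  K ^ 2 * M ^ 2 + K ^ 4 * M + 8 * K ^ 2 * CD K lam M * M ^ 2 + 2 * K ^ 4 * M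

theorem err_int (hg : ∀ a, |g a| ≤ K) (hK : 0 ≤ K) (hn : 0 < n) {lam t M : ℝ}
    (hl : 0 ≤ lam) (ht : 0 ≤ t) (ht1 : t ≤ 1) (hM : 0 ≤ M) :
    I2 M (fun h1 h2 => |qc μU μV g n lam t h1 h2
      - qa μU μV g n lam t h1 h2 * qb μU μV g n lam t h1 h2|) ≤ CE K lam M / √√n := by
  have hn' : (1 : ℝ) ≤ n := by exact_mod_cast hn
  have hs1 : 1 ≤ √(n:ℝ) := Real.one_le_sqrt.2 hn'
  have hss1 : 1 ≤ √√(n:ℝ) := Real.one_le_sqrt.2 hs1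
  have ca := c2_of (qa_cont μU μV g n lam) t
  have cb := c2_of (qb_cont μU μV g n lam) t
  have cc := c2_of (qc_cont μU μV g n lam) t
  have cd := c2_of (da_cont μU μV g n lam) t
  set δ : ℝ := 1 / √√(n:ℝ) with hδ
  set κ : ℝ := 1 / √(n:ℝ) with hκ
  have hδ0 : 0 < δ := by positivity
  have hδ1 : δ ≤ 1 := by rw [hδ, div_le_one (by positivity)]; exact hss1
  have hκ0 : 0 < κ := by positivity
  have hκδ : κ ≤ δ := by
    refine one_div_le_one_div_of_le (by positivity) ?_
    nth_rewrite 2 [← Real.mul_self_sqrt (show 0 ≤ √(n:ℝ) by positivity)]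
    nlinarith
  have ca' : C2 (fun h1 h2 => qa μU μV g n lam t (h1 + δ) h2) := by
    have : Continuous fun q : ℝ × ℝ => (fun p : ℝ × ℝ => qa μU μV g n lam t p.1 p.2) (q.1 + δ, q.2) :=
      Continuous.comp ca (by fun_prop)
    exact this
  have h1 := I2_mono hM (cc.sub (ca.mul cb)).abs
    ((((C2.const (K ^ 2 * κ)).add ((C2.const (K ^ 2 / (n * κ))).mul cd)).add
      (C2.const (8 * K ^ 2 * CD K lam M / (δ * √n)))).add
      ((C2.const (2 * K ^ 2)).mul (ca'.sub ca)))
    (fun x hx y hy => err_pt μU μV g n hg hK hn hl ht ht1 hx.1 hy.1 hx.2 hy.2 hδ0 hδ1 hκ0)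
  refine h1.trans ?_
  rw [I2_add ((((C2.const (K ^ 2 * κ)).add ((C2.const (K ^ 2 / (n * κ))).mul cd)).add
      (C2.const (8 * K ^ 2 * CD K lam M / (δ * √n))))) ((C2.const (2 * K ^ 2)).mul (ca'.sub ca)),
    I2_add ((C2.const (K ^ 2 * κ)).add ((C2.const (K ^ 2 / (n * κ))).mul cd)) (C2.const _),
    I2_add (C2.const (K ^ 2 * κ)) ((C2.const (K ^ 2 / (n * κ))).mul cd), I2_const, I2_const,
    I2_cmul, I2_cmul]
  have g1 := int_shift μU μV g n hg lam t hM hδ0.le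
  have g2 : I2 M (fun x y => da μU μV g n lam t x y) ≤ M * K ^ 2 := by
    unfold I2
    have := intervalIntegral.integral_mono_on (μ := volume) hM ((cd.inner 0 M).intervalIntegrable _ _)
      (g := fun _ => K ^ 2) (continuous_const.intervalIntegrable _ _) (fun x _ => int_da μU μV g n hg lam t x hM)
    simpa using this
  have q1 : K ^ 2 / (n * κ) = K ^ 2 * κ := by
    rw [hκ, mul_one_div, Real.div_sqrt]; ring
  have q2 : 8 * K ^ 2 * CD K lam M / (δ * √n) = 8 * K ^ 2 * CD K lam M * δ := by
    have : δ * √(n:ℝ) = √√(n:ℝ) := by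
      rw [hδ, one_div_mul_eq_div, Real.div_sqrt]
    rw [this, hδ]; ring
  rw [q1, q2]
  have q3 : CE K lam M / √√n = CE K lam M * δ := by rw [hδ]; ring
  rw [q3, CE]
  have r1 : K ^ 2 * κ * I2 M (fun x y => da μU μV g n lam t x y) ≤ K ^ 2 * δ * (M * K ^ 2) := by
    have : 0 ≤ I2 M (fun x y => da μU μV g n lam t x y) :=
      I2_nonneg hM cd fun _ _ _ _ => da_nonneg _ _ _ _ _ _ _ _
    gcongr
  have r2 : 2 * K ^ 2 * I2 M (fun h1 h2 => qa μU μV g n lam t (h1 + δ) h2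
      - qa μU μV g n lam t h1 h2) ≤ 2 * K ^ 2 * (δ * (M * K ^ 2)) := by gcongr
  have r3 : M ^ 2 * (K ^ 2 * κ) ≤ M ^ 2 * (K ^ 2 * δ) := by gcongr
  linarith

end Bip
end MI


namespace MI

lemma swapC {f : ℝ → ℝ → ℝ} (hf : C2 f) (a b c d : ℝ) :
    ∫ x in a..b, ∫ y in c..d, f x y = ∫ y in c..d, ∫ x in a..b, f x y := by
  apply intervalIntegral_intervalIntegral_swap
  have : IntegrableOn (Function.uncurry f) (Set.uIcc a b ×ˢ Set.uIcc c d) volume :=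
    (Continuous.continuousOn hf).integrableOn_compact (isCompact_uIcc.prod isCompact_uIcc)
  exact this.mono_set (Set.prod_mono Set.uIoc_subset_uIcc Set.uIoc_subset_uIcc)

lemma I2_swap {M : ℝ} {f : ℝ → ℝ → ℝ} (hf : C2 f) :
    I2 M f = ∫ y in (0:ℝ)..M, ∫ x in (0:ℝ)..M, f x y := swapC hf _ _ _ _

/-- Scalar channel data -/
structure SC (K2 : ℝ) (ψ F : ℝ → ℝ) : Prop where
  cψ : Continuous ψ
  cF : Continuous F
  z : ψ 0 = 0
  F0 : ∀ h, 0 ≤ F h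
  FK : ∀ h, F h ≤ K2
  tan : ∀ h h', 0 ≤ h → 0 ≤ h' → ψ h + (h' - h) / 2 * F h ≤ ψ h'

/-- free energy data at fixed size -/
structure AD (lam K2 : ℝ) (ψU ψV : ℝ → ℝ) (Φ a b c d : ℝ → ℝ → ℝ → ℝ) : Prop where
  cΦ : Continuous fun p : ℝ × ℝ × ℝ => Φ p.1 p.2.1 p.2.2
  ca : Continuous fun p : ℝ × ℝ × ℝ => a p.1 p.2.1 p.2.2
  cb : Continuous fun p : ℝ × ℝ × ℝ => b p.1 p.2.1 p.2.2
  cc : Continuous fun p : ℝ × ℝ × ℝ => c p.1 p.2.1 p.2.2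
  cd : Continuous fun p : ℝ × ℝ × ℝ => d p.1 p.2.1 p.2.2
  a0 : ∀ t x y, 0 ≤ a t x y
  aK : ∀ t x y, a t x y ≤ K2
  b0 : ∀ t x y, 0 ≤ b t x y
  bK : ∀ t x y, b t x y ≤ K2
  c0 : ∀ t x y, 0 ≤ c t x y
  d0 : ∀ t x y, 0 ≤ d t x y
  tan : ∀ t x y t' x' y', 0 ≤ t → 0 ≤ x → 0 ≤ y → 0 ≤ t' → 0 ≤ x' → 0 ≤ y' →
    Φ t x y + lam / 2 * (t' - t) * c t x y + (x' - x) / 2 * a t x y + (y' - y) / 2 * b t x y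
      ≤ Φ t' x' y'
  dT : ∀ t x y, 0 < t → HasDerivAt (fun t => Φ t x y) (lam / 2 * c t x y) t
  d1 : ∀ t x y, 0 < x → HasDerivAt (fun x => Φ t x y) (a t x y / 2) x
  d2 : ∀ t x y, 0 < y → HasDerivAt (fun y => Φ t x y) (b t x y / 2) y
  db1 : ∀ t x y, 0 < x → HasDerivAt (fun x => b t x y) (d t x y) x
  start0 : ∀ x y, 0 ≤ x → 0 ≤ y → Φ 0 x y = ψU x + ψV y

section upper
variable {lam K2 : ℝ} {ψU ψV FU FV : ℝ → ℝ} {Φ a b c d : ℝ → ℝ → ℝ → ℝ}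

/-- potential in reduced variables -/
def GG (lam : ℝ) (ψU ψV : ℝ → ℝ) (p h : ℝ) : ℝ := ψU (2 * lam * p) + ψV h - p * h

/-- inner minimum -/
def JJ (lam H : ℝ) (ψU ψV : ℝ → ℝ) (p : ℝ) : ℝ := sInf (GG lam ψU ψV p '' Set.Icc 0 H)

lemma GG_cont (hU : Continuous ψU) (hV : Continuous ψV) :
    Continuous (Function.uncurry (GG lam ψU ψV)) := by
  unfold Function.uncurry GG
  fun_prop

lemma JJ_cont (H : ℝ) (hU : Continuous ψU) (hV : Continuous ψV) :
    Continuous (JJ lam H ψU ψV) :=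
  (isCompact_Icc (a := (0:ℝ)) (b := H)).continuous_sInf (GG_cont hU hV)

lemma JJ_att {H : ℝ} (hH : 0 ≤ H) (hU : Continuous ψU) (hV : Continuous ψV) (p : ℝ) :
    ∃ h ∈ Set.Icc 0 H, GG lam ψU ψV p h = JJ lam H ψU ψV p ∧
      ∀ h' ∈ Set.Icc 0 H, JJ lam H ψU ψV p ≤ GG lam ψU ψV p h' := by
  have hc : Continuous (GG lam ψU ψV p) := by unfold GG; fun_prop
  obtain ⟨h, hh, e, hm⟩ := (isCompact_Icc (a := (0:ℝ)) (b := H)).exists_sInf_image_eq_and_le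
    ⟨0, le_rfl, hH⟩ hc.continuousOn
  exact ⟨h, hh, e.symm, fun h' hh' => by unfold JJ; rw [e]; exact hm h' hh'⟩

lemma SC.lin {ψ F : ℝ → ℝ} (hS : SC K2 ψ F) {h h' : ℝ} (hh : 0 ≤ h) (hh' : 0 ≤ h') :
    ψ h - F h / 2 * h ≤ ψ h' - F h / 2 * h' := by
  have := hS.tan h h' hh hh'
  linarith

lemma SC.nonneg {ψ F : ℝ → ℝ} (hS : SC K2 ψ F) {h : ℝ} (hh : 0 ≤ h) : 0 ≤ ψ h := by
  have := hS.tan 0 h le_rfl hh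
  have h2 := hS.F0 0
  rw [hS.z] at this
  nlinarith

lemma crit (hl : 0 < lam) (hU : SC K2 ψU FU) (hV : SC K2 ψV FV) {H : ℝ} (hH : H = lam * K2 + 1)
    {p : ℝ} (hp : p ∈ Set.Icc 0 (K2 / 2))
    (hmax : ∀ r ∈ Set.Icc 0 (K2 / 2), JJ lam H ψU ψV r ≤ JJ lam H ψU ψV p) :
    JJ lam H ψU ψV p = GG lam ψU ψV p (lam * FU (2 * lam * p)) ∧
    (0 < FU (2 * lam * p) → FV (lam * FU (2 * lam * p)) = 2 * p) := by
  set hs := lam * FU (2 * lam * p) with hhs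
  have hK : 0 ≤ K2 := (hU.F0 0).trans (hU.FK 0)
  have hH0 : 0 ≤ H := by rw [hH]; positivity
  have hs0 : 0 ≤ hs := mul_nonneg hl.le (hU.F0 _)
  have hs1 : hs < H := by
    have : hs ≤ lam * K2 := mul_le_mul_of_nonneg_left (hU.FK _) hl.le
    linarith
  obtain ⟨h0, hh0, e0, m0⟩ := JJ_att (lam := lam) hH0 hU.cψ hV.cψ p
  set r := FV hs / 2 with hr
  have hr' : r ∈ Set.Icc 0 (K2 / 2) := ⟨by have := hV.F0 hs; positivity, by
    have := hV.FK hs; rw [hr]; linarith⟩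
  obtain ⟨h1, hh1, e1, m1⟩ := JJ_att (lam := lam) hH0 hU.cψ hV.cψ r
  have hm := hmax r hr'
  have t1 := hV.lin hs0 hh1.1
  have t2 := hU.tan (2 * lam * p) (2 * lam * r) (by have := hp.1; positivity)
    (by have := hr'.1; positivity)
  have key : GG lam ψU ψV p hs ≤ JJ lam H ψU ψV p := by
    rw [← e1] at hm
    refine le_trans ?_ hm
    unfold GG
    have : (2 * lam * r - 2 * lam * p) / 2 * FU (2 * lam * p) = (r - p) * hs := by rw [hhs]; ring
    rw [this] at t2
    rw [← hr] at t1
    nlinarith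
  have eq : JJ lam H ψU ψV p = GG lam ψU ψV p hs := le_antisymm (m0 hs ⟨hs0, hs1.le⟩) key
  refine ⟨eq, fun hpos => ?_⟩
  have hs2 : 0 < hs := mul_pos hl hpos
  have hmin : ∀ h ∈ Set.Icc 0 H, p * (h - hs) ≤ FV h / 2 * (h - hs) := by
    intro h hh
    have := m0 h hh
    rw [eq] at this
    unfold GG at this
    have t := hV.tan h hs hh.1 hs0
    linarith
  have ct : Tendsto (fun h => FV h / 2) (𝓝 hs) (𝓝 (FV hs / 2)) := (hV.cF.div_const 2).tendsto hs
  have g1 : p ≤ FV hs / 2 := by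
    refine ge_of_tendsto (ct.mono_left (nhdsWithin_le_nhds (s := Set.Ioi hs))) ?_
    filter_upwards [Ioo_mem_nhdsGT hs1] with h hh
    have := hmin h ⟨hs0.trans hh.1.le, hh.2.le⟩
    exact le_of_mul_le_mul_right this (sub_pos.2 hh.1)
  have g2 : FV hs / 2 ≤ p := by
    refine le_of_tendsto (ct.mono_left (nhdsWithin_le_nhds (s := Set.Iio hs))) ?_
    filter_upwards [Ioo_mem_nhdsLT hs2] with h hh
    have := hmin h ⟨hh.1.le, hh.2.le.trans hs1.le⟩
    have hd := sub_pos.2 hh.2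
    by_contra hc
    push Not at hc
    nlinarith
  linarith

/-- RS fixed points -/
def GamA (lam : ℝ) (FU FV : ℝ → ℝ) : Set (ℝ × ℝ) :=
  {q | 0 ≤ q.1 ∧ 0 ≤ q.2 ∧ q.2 = FU (lam * q.1) ∧ q.1 = FV (lam * q.2)}

/-- RS potential -/
def rsA (lam : ℝ) (ψU ψV : ℝ → ℝ) (q₁ q₂ : ℝ) : ℝ :=
  ψU (lam * q₁) + ψV (lam * q₂) - lam / 2 * q₁ * q₂

lemma exists_gam (hl : 0 < lam) (hU : SC K2 ψU FU) (hV : SC K2 ψV FV) :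
    ∃ q ∈ GamA lam FU FV, ∀ p ∈ Set.Icc 0 (K2 / 2), ∃ h, 0 ≤ h ∧
      GG lam ψU ψV p h ≤ rsA lam ψU ψV q.1 q.2 := by
  set H := lam * K2 + 1 with hH
  have hK : 0 ≤ K2 := (hU.F0 0).trans (hU.FK 0)
  have hH0 : 0 ≤ H := by rw [hH]; positivity
  obtain ⟨p, hp, hmax⟩ := (isCompact_Icc (a := (0:ℝ)) (b := K2 / 2)).exists_isMaxOn
    ⟨0, le_rfl, by positivity⟩ (JJ_cont (lam := lam) H hU.cψ hV.cψ).continuousOn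
  have hmax' : ∀ r ∈ Set.Icc 0 (K2 / 2), JJ lam H ψU ψV r ≤ JJ lam H ψU ψV p := fun r hr => hmax hr
  suffices ∃ q ∈ GamA lam FU FV, JJ lam H ψU ψV p ≤ rsA lam ψU ψV q.1 q.2 by
    obtain ⟨q, hq, hle⟩ := this
    refine ⟨q, hq, fun r hr => ?_⟩
    obtain ⟨h, hh, e, -⟩ := JJ_att (lam := lam) hH0 hU.cψ hV.cψ r
    exact ⟨h, hh.1, by rw [e]; exact (hmax' r hr).trans hle⟩
  have gen : ∀ r ∈ Set.Icc 0 (K2 / 2),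
      (∀ r' ∈ Set.Icc 0 (K2 / 2), JJ lam H ψU ψV r' ≤ JJ lam H ψU ψV r) →
      0 < FU (2 * lam * r) →
      ∃ q ∈ GamA lam FU FV, JJ lam H ψU ψV r ≤ rsA lam ψU ψV q.1 q.2 := by
    intro r hr hm hpos
    obtain ⟨e1, e2⟩ := crit hl hU hV hH hr hm
    refine ⟨(2 * r, FU (2 * lam * r)), ⟨by have := hr.1; positivity, hpos.le, ?_, (e2 hpos).symm⟩, ?_⟩
    · show FU (2 * lam * r) = FU (lam * (2 * r)); ring_nf
    · rw [e1]
      unfold GG rsA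
      simp only
      rw [show lam * (2 * r) = 2 * lam * r by ring]
      apply le_of_eq; ring
  rcases (hU.F0 (2 * lam * p)).lt_or_eq with hpos | hz
  · exact gen p hp hmax' hpos
  · obtain ⟨e1, -⟩ := crit hl hU hV hH hp hmax'
    have hA : ψU (2 * lam * p) ≤ 0 := by
      have := hU.tan (2 * lam * p) 0 (by have := hp.1; positivity) le_rfl
      rw [← hz, hU.z] at this
      linarith
    have hJ : JJ lam H ψU ψV p ≤ 0 := by
      rw [e1, ← hz]
      unfold GG
      rw [mul_zero, hV.z]
      linarith
    set r := FV 0 / 2 with hr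
    have hr' : r ∈ Set.Icc 0 (K2 / 2) := ⟨by have := hV.F0 0; positivity, by
      have := hV.FK 0; rw [hr]; linarith⟩
    have hA' : 0 ≤ ψU (2 * lam * r) := hU.nonneg (by have := hr'.1; positivity)
    have hJ' : 0 ≤ JJ lam H ψU ψV r := by
      obtain ⟨h, hh, e, -⟩ := JJ_att (lam := lam) hH0 hU.cψ hV.cψ r
      rw [← e]
      have := hV.lin le_rfl hh.1
      rw [hV.z, ← hr] at this
      unfold GG
      linarith
    have hm' : ∀ r' ∈ Set.Icc 0 (K2 / 2), JJ lam H ψU ψV r' ≤ JJ lam H ψU ψV r :=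
      fun r' h' => (hmax' r' h').trans (hJ.trans hJ')
    rcases (hU.F0 (2 * lam * r)).lt_or_eq with hpos | hz'
    · obtain ⟨q, hq, hle⟩ := gen r hr' hm' hpos
      exact ⟨q, hq, (hJ.trans hJ').trans hle⟩
    · refine ⟨(FV 0, 0), ⟨hV.F0 0, le_rfl, ?_, by simp⟩, ?_⟩
      · show (0:ℝ) = FU (lam * FV 0)
        have : 2 * lam * r = lam * FV 0 := by rw [hr]; ring
        rw [← this]; exact hz'
      · refine hJ.trans ?_
        unfold rsA
        simp only [mul_zero, sub_zero, hV.z, add_zero]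
        have : 2 * lam * r = lam * FV 0 := by rw [hr]; ring
        rw [← this]; exact hA'

lemma AD.upper (hA : AD lam K2 ψU ψV Φ a b c d) (hl : 0 < lam) {R δ E : ℝ} (hδ : 0 < δ)
    (hR : ∀ p ∈ Set.Icc 0 (K2 / 2), ∃ h, 0 ≤ h ∧ GG lam ψU ψV p h ≤ R)
    (hE : I2 δ (fun x y => |c 1 x y - a 1 x y * b 1 x y|) ≤ E) :
    Φ 1 0 0 ≤ R + lam / 2 * (E / δ ^ 2) + K2 * δ := by
  have C := fun {F : ℝ → ℝ → ℝ → ℝ} (h : Continuous fun p : ℝ × ℝ × ℝ => F p.1 p.2.1 p.2.2) =>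
    Bip.c2_of h 1
  obtain ⟨x, hx, y, hy, he⟩ := I2_exists hδ
    (((C hA.cc).sub ((C hA.ca).mul (C hA.cb))).abs) hE
  have e1 := (le_abs_self _).trans he
  have b0 := hA.b0 1 x y
  have bK := hA.bK 1 x y
  have a0 := hA.a0 1 x y
  have aK := hA.aK 1 x y
  obtain ⟨h, hh, hG⟩ := hR (b 1 x y / 2) ⟨by linarith, by linarith⟩
  have t1 := hA.tan 1 0 0 1 x y zero_le_one le_rfl le_rfl zero_le_one hx.1 hy.1
  have t2 := hA.tan 1 x y 0 (lam * b 1 x y) h zero_le_one hx.1 hy.1 le_rfl (by positivity) hh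
  rw [hA.start0 _ _ (by positivity) hh] at t2
  unfold GG at hG
  rw [show 2 * lam * (b 1 x y / 2) = lam * b 1 x y by ring] at hG
  have u1 : 0 ≤ x * a 1 0 0 := mul_nonneg hx.1 (hA.a0 _ _ _)
  have u2 : 0 ≤ y * b 1 0 0 := mul_nonneg hy.1 (hA.b0 _ _ _)
  have u3 : x * a 1 x y ≤ δ * K2 := mul_le_mul hx.2 aK a0 hδ.le
  have u4 : y * b 1 x y ≤ δ * K2 := mul_le_mul hy.2 bK b0 hδ.le
  have u5 := mul_le_mul_of_nonneg_left e1 (by positivity : 0 ≤ lam / 2)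
  nlinarith

end upper

end MI


namespace MI

lemma I2_subset {M δ : ℝ} {f : ℝ → ℝ → ℝ} (hδ : 0 ≤ δ) (hM : δ ≤ M) (hf : C2 f)
    (h : ∀ x y, 0 ≤ f x y) : I2 δ f ≤ I2 M f := by
  have key : ∀ G : ℝ → ℝ, Continuous G → (∀ x, 0 ≤ G x) →
      ∫ x in (0:ℝ)..δ, G x ≤ ∫ x in (0:ℝ)..M, G x := by
    intro G hG h0
    have e := intervalIntegral.integral_add_adjacent_intervals
      (hG.intervalIntegrable (μ := volume) 0 δ) (hG.intervalIntegrable (μ := volume) δ M)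
    have := intervalIntegral.integral_nonneg (μ := volume) hM (fun x _ => h0 x)
    linarith
  unfold I2
  refine le_trans ?_ (key _ (hf.inner 0 M) fun x =>
    intervalIntegral.integral_nonneg (hδ.trans hM) fun y _ => h x y)
  exact intervalIntegral.integral_mono_on hδ ((hf.inner 0 δ).intervalIntegrable _ _)
    ((hf.inner 0 M).intervalIntegrable _ _) fun x _ => key _ (hf.y x) (h x)

section lower
variable {lam K2 : ℝ} {ψU ψV FU FV : ℝ → ℝ} {Φ a b c d : ℝ → ℝ → ℝ → ℝ}

/-- the weight -/
def ww (Φ : ℝ → ℝ → ℝ → ℝ) (p1 p2 κ ε : ℝ) (t x y : ℝ) : ℝ :=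
  Real.exp (-(Φ t x y - p1 * x - p2 * y - κ * t) / ε)

variable (hA : AD lam K2 ψU ψV Φ a b c d) (p1 p2 κ ε : ℝ)

lemma ww_cont (hA : AD lam K2 ψU ψV Φ a b c d) (p1 p2 κ ε : ℝ) :
    Continuous fun p : ℝ × ℝ × ℝ => ww Φ p1 p2 κ ε p.1 p.2.1 p.2.2 := by
  have := hA.cΦ
  unfold ww
  fun_prop

lemma ww_dT (hA : AD lam K2 ψU ψV Φ a b c d) (p1 p2 κ ε : ℝ) {t : ℝ} (x y : ℝ) (ht : 0 < t) :
    HasDerivAt (fun t => ww Φ p1 p2 κ ε t x y)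
      (ww Φ p1 p2 κ ε t x y * (-(lam / 2 * c t x y - κ) / ε)) t := by
  unfold ww
  have h1 := (((((hA.dT t x y ht).sub_const (p1 * x)).sub_const (p2 * y)).sub
    ((hasDerivAt_id t).const_mul κ)).neg.div_const ε).exp
  refine h1.congr_deriv ?_
  simp

lemma ww_d1 (hA : AD lam K2 ψU ψV Φ a b c d) (p1 p2 κ ε t : ℝ) {x : ℝ} (y : ℝ) (hx : 0 < x) :
    HasDerivAt (fun x => ww Φ p1 p2 κ ε t x y)
      (ww Φ p1 p2 κ ε t x y * (-(a t x y / 2 - p1) / ε)) x := by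
  unfold ww
  have h1 := ((((((hA.d1 t x y hx).sub ((hasDerivAt_id x).const_mul p1)).sub_const
    (p2 * y)).sub_const (κ * t))).neg.div_const ε).exp
  refine h1.congr_deriv ?_
  simp

lemma ww_d2 (hA : AD lam K2 ψU ψV Φ a b c d) (p1 p2 κ ε t : ℝ) (x : ℝ) {y : ℝ} (hy : 0 < y) :
    HasDerivAt (fun y => ww Φ p1 p2 κ ε t x y)
      (ww Φ p1 p2 κ ε t x y * (-(b t x y / 2 - p2) / ε)) y := by
  unfold ww
  have h1 := ((((((hA.d2 t x y hy).sub_const (p1 * x)).sub ((hasDerivAt_id y).const_mul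
    p2)).sub_const (κ * t))).neg.div_const ε).exp
  refine h1.congr_deriv ?_
  simp

/-- time derivative -/
def wT (lam : ℝ) (Φ c : ℝ → ℝ → ℝ → ℝ) (p1 p2 κ ε : ℝ) (t x y : ℝ) : ℝ :=
  ww Φ p1 p2 κ ε t x y * (-(lam / 2 * c t x y - κ) / ε)

lemma wT_cont (hA : AD lam K2 ψU ψV Φ a b c d) (p1 p2 κ ε : ℝ) :
    Continuous fun p : ℝ × ℝ × ℝ => wT lam Φ c p1 p2 κ ε p.1 p.2.1 p.2.2 := by
  have h1 := ww_cont hA p1 p2 κ ε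
  have h2 := hA.cc
  unfold wT
  fun_prop

lemma W_diff (hA : AD lam K2 ψU ψV Φ a b c d) (p1 p2 κ ε M : ℝ) :
    I2 M (ww Φ p1 p2 κ ε 1) - I2 M (ww Φ p1 p2 κ ε 0)
      = ∫ t in (0:ℝ)..1, I2 M (wT lam Φ c p1 p2 κ ε t) := by
  have cw := ww_cont hA p1 p2 κ ε
  have cT := wT_cont hA p1 p2 κ ε
  rw [← I2_sub (Bip.c2_of cw 1) (Bip.c2_of cw 0)]
  have e : ∀ x y, ww Φ p1 p2 κ ε 1 x y - ww Φ p1 p2 κ ε 0 x y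
      = ∫ t in (0:ℝ)..1, wT lam Φ c p1 p2 κ ε t x y := by
    intro x y
    have c1 : Continuous fun t => ww Φ p1 p2 κ ε t x y := by
      have : Continuous fun t => (fun p : ℝ × ℝ × ℝ => ww Φ p1 p2 κ ε p.1 p.2.1 p.2.2) (t, x, y) :=
        cw.comp (by fun_prop)
      exact this
    have c3 : Continuous fun t => wT lam Φ c p1 p2 κ ε t x y := by
      have : Continuous fun t =>
          (fun p : ℝ × ℝ × ℝ => wT lam Φ c p1 p2 κ ε p.1 p.2.1 p.2.2) (t, x, y) :=
        cT.comp (by fun_prop)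
      exact this
    exact (intervalIntegral.integral_eq_sub_of_hasDerivAt_of_le zero_le_one c1.continuousOn
      (fun t ht => ww_dT hA p1 p2 κ ε x y ht.1) (c3.intervalIntegrable _ _)).symm
  simp only [e]
  unfold I2
  have s1 : ∀ x, ∫ y in (0:ℝ)..M, ∫ t in (0:ℝ)..1, wT lam Φ c p1 p2 κ ε t x y
      = ∫ t in (0:ℝ)..1, ∫ y in (0:ℝ)..M, wT lam Φ c p1 p2 κ ε t x y := by
    intro x
    apply swapC
    have : Continuous fun q : ℝ × ℝ =>
        (fun p : ℝ × ℝ × ℝ => wT lam Φ c p1 p2 κ ε p.1 p.2.1 p.2.2) (q.2, x, q.1) :=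
      cT.comp (by fun_prop)
    exact this
  simp only [s1]
  apply swapC (f := fun x t => ∫ y in (0:ℝ)..M, wT lam Φ c p1 p2 κ ε t x y)
  have : Continuous (Function.uncurry fun (q : ℝ × ℝ) (y : ℝ) =>
      (fun p : ℝ × ℝ × ℝ => wT lam Φ c p1 p2 κ ε p.1 p.2.1 p.2.2) (q.2, q.1, y)) :=
    cT.comp (by fun_prop)
  exact intervalIntegral.continuous_parametric_intervalIntegral_of_continuous' this 0 M

lemma wT_bound (hA : AD lam K2 ψU ψV Φ a b c d) (hl : 0 < lam) {p1 p2 κ ε M B0 Wm E t : ℝ}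
    (hp1 : 0 ≤ p1) (hp2 : 0 ≤ p2) (hκ : κ = 2 * lam * p1 * p2) (hε : 0 < ε) (hM : 0 ≤ M)
    (ht : t ∈ Set.Icc (0:ℝ) 1)
    (hB1 : ∀ y ∈ Set.Icc 0 M, ww Φ p1 p2 κ ε t M y ≤ B0)
    (hB2 : ∀ x ∈ Set.Icc 0 M, ww Φ p1 p2 κ ε t x M ≤ B0)
    (hW : ∀ x ∈ Set.Icc 0 M, ∀ y ∈ Set.Icc 0 M, ww Φ p1 p2 κ ε t x y ≤ Wm)
    (hE : I2 M (fun x y => |c t x y - a t x y * b t x y|) ≤ E) :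
    I2 M (wT lam Φ c p1 p2 κ ε t)
      ≤ lam / (2 * ε) * Wm * E + lam * (K2 + 2 * p1) * M * B0 := by
  have cw := Bip.c2_of (ww_cont hA p1 p2 κ ε) t
  have cT := Bip.c2_of (wT_cont hA p1 p2 κ ε) t
  have ca := Bip.c2_of hA.ca t
  have cb := Bip.c2_of hA.cb t
  have cc := Bip.c2_of hA.cc t
  have cd := Bip.c2_of hA.cd t
  have w0 : ∀ x y, 0 ≤ ww Φ p1 p2 κ ε t x y := fun x y => (Real.exp_pos _).le
  have hK : 0 ≤ K2 := (hA.a0 0 0 0).trans (hA.aK 0 0 0)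
  have hB0 : 0 ≤ B0 := (w0 _ _).trans (hB1 0 ⟨le_rfl, hM⟩)
  set X1 : ℝ → ℝ → ℝ := fun x y =>
    d t x y * ww Φ p1 p2 κ ε t x y
      + b t x y * (ww Φ p1 p2 κ ε t x y * (-(a t x y / 2 - p1) / ε)) with hX1
  set X2 : ℝ → ℝ → ℝ := fun x y => ww Φ p1 p2 κ ε t x y * (-(b t x y / 2 - p2) / ε) with hX2
  set X0 : ℝ → ℝ → ℝ := fun x y => |c t x y - a t x y * b t x y| with hX0
  have cX0 : C2 X0 := (cc.sub (ca.mul cb)).abs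
  have cX1 : C2 X1 := by
    unfold C2 at *
    simp only [hX1]
    fun_prop
  have cX2 : C2 X2 := by
    unfold C2 at *
    simp only [hX2]
    fun_prop
  have step : I2 M (wT lam Φ c p1 p2 κ ε t) ≤
      I2 M (fun x y => (lam / (2 * ε) * Wm) * X0 x y + lam * X1 x y + (2 * p1 * lam) * X2 x y) := by
    refine I2_mono hM cT ((((C2.const _).mul cX0).add ((C2.const _).mul cX1)).add
      ((C2.const _).mul cX2)) fun x hx y hy => ?_
    have hw := hW x hx y hy
    have hw0 := w0 x y
    have hd : 0 ≤ d t x y * ww Φ p1 p2 κ ε t x y := mul_nonneg (hA.d0 t x y) hw0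
    have e : wT lam Φ c p1 p2 κ ε t x y
        = lam / (2 * ε) * (ww Φ p1 p2 κ ε t x y * (-(c t x y - a t x y * b t x y)))
          + lam * (b t x y * (ww Φ p1 p2 κ ε t x y * (-(a t x y / 2 - p1) / ε)))
          + 2 * p1 * lam * X2 x y := by
      simp only [wT, hX2, hκ]
      field_simp
      ring
    rw [e]
    have i1 : ww Φ p1 p2 κ ε t x y * (-(c t x y - a t x y * b t x y)) ≤ Wm * X0 x y := by
      refine (mul_le_mul_of_nonneg_left (neg_le_abs _) hw0).trans ?_
      exact mul_le_mul_of_nonneg_right hw (abs_nonneg _)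
    have i2 := mul_le_mul_of_nonneg_left i1 (by positivity : 0 ≤ lam / (2 * ε))
    have i3 : lam * (b t x y * (ww Φ p1 p2 κ ε t x y * (-(a t x y / 2 - p1) / ε)))
        ≤ lam * X1 x y := by
      apply mul_le_mul_of_nonneg_left _ hl.le
      simp only [hX1]; linarith
    linarith
  refine step.trans ?_
  rw [I2_add (((C2.const _).mul cX0).add ((C2.const _).mul cX1)) ((C2.const _).mul cX2),
    I2_add ((C2.const _).mul cX0) ((C2.const _).mul cX1), I2_cmul, I2_cmul, I2_cmul]
  have b1 : I2 M X1 ≤ M * (K2 * B0) := by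
    rw [I2_swap cX1]
    have inner : ∀ y ∈ Set.Icc 0 M, ∫ x in (0:ℝ)..M, X1 x y ≤ K2 * B0 := by
      intro y hy
      rw [intervalIntegral.integral_eq_sub_of_hasDerivAt_of_le hM
        (f := fun x => b t x y * ww Φ p1 p2 κ ε t x y)
        ((cb.mul cw).x y).continuousOn
        (fun x hx => (hA.db1 t x y hx.1).mul (ww_d1 hA p1 p2 κ ε t y hx.1))
        ((cX1.x y).intervalIntegrable _ _)]
      have g1 : b t M y * ww Φ p1 p2 κ ε t M y ≤ K2 * B0 :=
        mul_le_mul (hA.bK _ _ _) (hB1 y hy) (w0 _ _) hK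
      have g2 : 0 ≤ b t 0 y * ww Φ p1 p2 κ ε t 0 y := mul_nonneg (hA.b0 _ _ _) (w0 _ _)
      linarith
    have cX1' : C2 (fun y x => X1 x y) := by
      have : Continuous fun q : ℝ × ℝ => (fun p : ℝ × ℝ => X1 p.1 p.2) (q.2, q.1) :=
        Continuous.comp cX1 (by fun_prop)
      exact this
    have := intervalIntegral.integral_mono_on (μ := volume) hM
      ((cX1'.inner 0 M).intervalIntegrable _ _)
      (g := fun _ => K2 * B0) (continuous_const.intervalIntegrable _ _) inner
    rw [intervalIntegral.integral_const, sub_zero, smul_eq_mul] at this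
    exact this
  have b2 : I2 M X2 ≤ M * B0 := by
    have inner : ∀ x ∈ Set.Icc 0 M, ∫ y in (0:ℝ)..M, X2 x y ≤ B0 := by
      intro x hx
      rw [intervalIntegral.integral_eq_sub_of_hasDerivAt_of_le hM
        (f := fun y => ww Φ p1 p2 κ ε t x y)
        (cw.y x).continuousOn
        (fun y hy => ww_d2 hA p1 p2 κ ε t x hy.1)
        ((cX2.y x).intervalIntegrable _ _)]
      have := hB2 x hx
      have := w0 x 0
      linarith
    have := intervalIntegral.integral_mono_on (μ := volume) hM
      ((cX2.inner 0 M).intervalIntegrable _ _)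
      (g := fun _ => B0) (continuous_const.intervalIntegrable _ _) inner
    rw [intervalIntegral.integral_const, sub_zero, smul_eq_mul] at this
    exact this
  have hWm : 0 ≤ Wm := (w0 _ _).trans (hW 0 ⟨le_rfl, hM⟩ 0 ⟨le_rfl, hM⟩)
  have j0 := mul_le_mul_of_nonneg_left hE (by positivity : 0 ≤ lam / (2 * ε) * Wm)
  have j1 := mul_le_mul_of_nonneg_left b1 hl.le
  have j2 := mul_le_mul_of_nonneg_left b2 (by positivity : 0 ≤ 2 * p1 * lam)
  linarith

lemma AD.lower (hA : AD lam K2 ψU ψV Φ a b c d) (hl : 0 < lam) {p1 p2 κ ε M g η δ E : ℝ}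
    (hp1 : 0 ≤ p1) (hp2 : 0 ≤ p2) (hκ : κ = 2 * lam * p1 * p2) (hε : 0 < ε) (hη : 0 < η)
    (hM : 1 ≤ M) (hMκ : κ ≤ η * M) (hδ : 0 < δ) (hδ1 : δ ≤ 1)
    (hg : ∀ x y, 0 ≤ x → 0 ≤ y → g + (p1 + η) * x + (p2 + η) * y ≤ ψU x + ψV y)
    (hE : ∀ t ∈ Set.Icc (0:ℝ) 1, I2 M (fun x y => |c t x y - a t x y * b t x y|) ≤ E)
    (hEs : lam / (2 * ε) * Real.exp ((p1 * M + p2 * M + κ) / ε - Φ 0 0 0 / ε) * E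
      ≤ Real.exp (-g / ε)) :
    g + κ - K2 * δ - ε * Real.log ((M ^ 2 + lam * (K2 + 2 * p1) * M + 1) / δ ^ 2) ≤ Φ 1 0 0 := by
  have hκ0 : 0 ≤ κ := by rw [hκ]; positivity
  have hM0 : 0 ≤ M := zero_le_one.trans hM
  have hK : 0 ≤ K2 := (hA.a0 0 0 0).trans (hA.aK 0 0 0)
  have cw := ww_cont hA p1 p2 κ ε
  have cT := wT_cont hA p1 p2 κ ε
  have low : ∀ t x y, 0 ≤ t → 0 ≤ x → 0 ≤ y → ψU x + ψV y ≤ Φ t x y := by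
    intro t x y ht hx hy
    have := hA.tan 0 x y t x y le_rfl hx hy ht hx hy
    rw [hA.start0 x y hx hy] at this
    have h2 : 0 ≤ lam / 2 * (t - 0) * c 0 x y := by
      have := hA.c0 0 x y
      rw [sub_zero]; positivity
    linarith
  have low0 : ∀ t x y, 0 ≤ t → 0 ≤ x → 0 ≤ y → Φ 0 0 0 ≤ Φ t x y := by
    intro t x y ht hx hy
    have := hA.tan 0 0 0 t x y le_rfl le_rfl le_rfl ht hx hy
    have h2 : 0 ≤ lam / 2 * (t - 0) * c 0 0 0 := by
      have := hA.c0 0 0 0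
      rw [sub_zero]; positivity
    have h3 : 0 ≤ (x - 0) / 2 * a 0 0 0 := by
      have := hA.a0 0 0 0
      rw [sub_zero]; positivity
    have h4 : 0 ≤ (y - 0) / 2 * b 0 0 0 := by
      have := hA.b0 0 0 0
      rw [sub_zero]; positivity
    linarith
  have bd : ∀ t ∈ Set.Icc (0:ℝ) 1, ∀ x ∈ Set.Icc 0 M, ∀ y ∈ Set.Icc 0 M, M ≤ x + y →
      ww Φ p1 p2 κ ε t x y ≤ Real.exp (-g / ε) := by
    intro t ht x hx y hy hxy
    unfold ww
    apply Real.exp_le_exp.2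
    apply div_le_div_of_nonneg_right _ hε.le
    have h1 := low t x y ht.1 hx.1 hy.1
    have h2 := hg x y hx.1 hy.1
    have h3 : κ * t ≤ κ := mul_le_of_le_one_right hκ0 ht.2
    have h4 : η * M ≤ η * (x + y) := mul_le_mul_of_nonneg_left hxy hη.le
    linarith
  set Wm := Real.exp ((p1 * M + p2 * M + κ) / ε - Φ 0 0 0 / ε) with hWm
  have wm : ∀ t ∈ Set.Icc (0:ℝ) 1, ∀ x ∈ Set.Icc 0 M, ∀ y ∈ Set.Icc 0 M,
      ww Φ p1 p2 κ ε t x y ≤ Wm := by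
    intro t ht x hx y hy
    unfold ww
    apply Real.exp_le_exp.2
    rw [← sub_div]
    apply div_le_div_of_nonneg_right _ hε.le
    have h1 := low0 t x y ht.1 hx.1 hy.1
    have h3 : κ * t ≤ κ := mul_le_of_le_one_right hκ0 ht.2
    have h4 : p1 * x ≤ p1 * M := mul_le_mul_of_nonneg_left hx.2 hp1
    have h5 : p2 * y ≤ p2 * M := mul_le_mul_of_nonneg_left hy.2 hp2
    linarith
  have hMM : M ∈ Set.Icc 0 M := ⟨hM0, le_rfl⟩
  set B0 := Real.exp (-g / ε) with hB0
  have hd := W_diff hA p1 p2 κ ε M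
  have h_integ : ∫ t in (0:ℝ)..1, I2 M (wT lam Φ c p1 p2 κ ε t)
      ≤ lam / (2 * ε) * Wm * E + lam * (K2 + 2 * p1) * M * B0 := by
    have cI : Continuous fun t => I2 M (wT lam Φ c p1 p2 κ ε t) := by
      unfold I2
      apply intervalIntegral.continuous_parametric_intervalIntegral_of_continuous'
        (f := fun t x => ∫ y in (0:ℝ)..M, wT lam Φ c p1 p2 κ ε t x y)
      have : Continuous (Function.uncurry fun (q : ℝ × ℝ) (y : ℝ) =>
          (fun p : ℝ × ℝ × ℝ => wT lam Φ c p1 p2 κ ε p.1 p.2.1 p.2.2) (q.1, q.2, y)) :=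
        cT.comp (by fun_prop)
      exact intervalIntegral.continuous_parametric_intervalIntegral_of_continuous' this 0 M
    have := intervalIntegral.integral_mono_on (μ := volume) zero_le_one
      (cI.intervalIntegrable _ _)
      (g := fun _ => lam / (2 * ε) * Wm * E + lam * (K2 + 2 * p1) * M * B0)
      (continuous_const.intervalIntegrable _ _)
      (fun t ht => wT_bound hA hl hp1 hp2 hκ hε hM0 ht
        (fun y hy => bd t ht M hMM y hy (by linarith [hy.1]))
        (fun x hx => bd t ht x hx M hMM (by linarith [hx.1])) (wm t ht) (hE t ht))
    simpa using this
  have hW0 : I2 M (ww Φ p1 p2 κ ε 0) ≤ M ^ 2 * B0 := by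
    rw [← I2_const]
    refine I2_mono hM0 (Bip.c2_of cw 0) (C2.const _) fun x hx y hy => ?_
    unfold ww
    apply Real.exp_le_exp.2
    apply div_le_div_of_nonneg_right _ hε.le
    have h1 := low 0 x y le_rfl hx.1 hy.1
    have h2 := hg x y hx.1 hy.1
    have h4 : 0 ≤ η * x := mul_nonneg hη.le hx.1
    have h5 : 0 ≤ η * y := mul_nonneg hη.le hy.1
    linarith
  have hW1 : δ ^ 2 * Real.exp (-(Φ 1 0 0 + K2 * δ - κ) / ε) ≤ I2 M (ww Φ p1 p2 κ ε 1) := by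
    refine le_trans ?_ (I2_subset hδ.le (hδ1.trans hM) (Bip.c2_of cw 1) fun x y =>
      (Real.exp_pos _).le)
    rw [← I2_const]
    refine I2_mono hδ.le (C2.const _) (Bip.c2_of cw 1) fun x hx y hy => ?_
    unfold ww
    apply Real.exp_le_exp.2
    apply div_le_div_of_nonneg_right _ hε.le
    have h1 := hA.tan 1 x y 1 0 0 zero_le_one hx.1 hy.1 zero_le_one le_rfl le_rfl
    have u3 : x * a 1 x y ≤ δ * K2 := mul_le_mul hx.2 (hA.aK _ _ _) (hA.a0 _ _ _) hδ.le
    have u4 : y * b 1 x y ≤ δ * K2 := mul_le_mul hy.2 (hA.bK _ _ _) (hA.b0 _ _ _) hδ.le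
    have h4 : 0 ≤ p1 * x := mul_nonneg hp1 hx.1
    have h5 : 0 ≤ p2 * y := mul_nonneg hp2 hy.1
    linarith
  set D := M ^ 2 + lam * (K2 + 2 * p1) * M + 1 with hD
  have hDpos : 0 < D := by positivity
  have fin : δ ^ 2 * Real.exp (-(Φ 1 0 0 + K2 * δ - κ) / ε) ≤ D * B0 := by
    rw [hD]; linarith
  have fin2 : Real.exp (-(Φ 1 0 0 + K2 * δ - κ) / ε) ≤ Real.exp (Real.log (D / δ ^ 2) + -g / ε) := by
    rw [Real.exp_add, Real.exp_log (by positivity), div_mul_eq_mul_div, le_div_iff₀ (by positivity)]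
    linarith
  have fin3 := Real.exp_le_exp.1 fin2
  rw [div_le_iff₀ hε, add_mul, div_mul_cancel₀ _ hε.ne'] at fin3
  linarith

end lower

end MI


namespace MI

section limit
variable {lam K2 : ℝ} {ψU ψV FU FV : ℝ → ℝ}

lemma lower_lim (hl : 0 < lam) (hU : SC K2 ψU FU) (hV : SC K2 ψV FV)
    (Φ a b c d : ℕ → ℝ → ℝ → ℝ → ℝ)
    (hA : ∀ n, 0 < n → AD lam K2 ψU ψV (Φ n) (a n) (b n) (c n) (d n))
    (E : ℕ → ℝ → ℝ) (hE0 : ∀ M, 0 < M → Tendsto (fun n => E n M) atTop (𝓝 0))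
    (hE : ∀ n M t, 0 < n → 0 < M → t ∈ Set.Icc (0:ℝ) 1 →
      I2 M (fun x y => |c n t x y - a n t x y * b n t x y|) ≤ E n M)
    (q : ℝ × ℝ) (hq : q ∈ GamA lam FU FV) (θ : ℝ) (hθ : 0 < θ) :
    ∀ᶠ n in atTop, rsA lam ψU ψV q.1 q.2 - θ ≤ Φ n 1 0 0 := by
  obtain ⟨q1, q2⟩ := q
  obtain ⟨hq1, hq2, e2, e1⟩ := hq
  simp only at hq1 hq2 e1 e2 ⊢
  have hK : 0 ≤ K2 := (hU.F0 0).trans (hU.FK 0)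
  have init0 : ∀ n, 0 < n → Φ n 0 0 0 = 0 := fun n hn => by
    rw [(hA n hn).start0 0 0 le_rfl le_rfl, hU.z, hV.z, add_zero]
  have lin : ∀ x y, 0 ≤ x → 0 ≤ y →
      (ψU (lam * q1) + ψV (lam * q2) - lam * q1 * q2) + q2 / 2 * x + q1 / 2 * y ≤ ψU x + ψV y := by
    intro x y hx hy
    have h1 := hU.lin (by positivity : 0 ≤ lam * q1) hx
    have h2 := hV.lin (by positivity : 0 ≤ lam * q2) hy
    rw [← e2] at h1
    rw [← e1] at h2
    linarith
  set g := ψU (lam * q1) + ψV (lam * q2) - lam * q1 * q2 with hg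
  have hgr : g + 2 * lam * (q2 / 2) * (q1 / 2) = rsA lam ψU ψV q1 q2 := by
    unfold rsA; rw [hg]; ring
  by_cases hz : q1 * q2 = 0
  · filter_upwards [eventually_gt_atTop 0] with n hn
    have h0 := lin 0 0 le_rfl le_rfl
    rw [hU.z, hV.z] at h0
    have h1 := (hA n hn).tan 0 0 0 1 0 0 le_rfl le_rfl le_rfl zero_le_one le_rfl le_rfl
    rw [init0 n hn] at h1
    have h2 := mul_nonneg hl.le ((hA n hn).c0 0 0 0)
    have : rsA lam ψU ψV q1 q2 = g := by rw [← hgr]; linear_combination (lam / 2) * hz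
    rw [this]
    linarith
  have hq1' : 0 < q1 := hq1.lt_of_ne fun h => hz (by rw [← h]; ring)
  have hq2' : 0 < q2 := hq2.lt_of_ne fun h => hz (by rw [← h]; ring)
  -- choose η
  have hη : ∃ η, 0 < η ∧ η ≤ q2 / 2 ∧ η ≤ q1 / 2 ∧
      2 * lam * (q2 / 2) * (q1 / 2) - θ / 4 ≤ 2 * lam * (q2 / 2 - η) * (q1 / 2 - η) := by
    have ct : Tendsto (fun η : ℝ => 2 * lam * (q2 / 2 - η) * (q1 / 2 - η)) (𝓝[>] 0)
        (𝓝 (2 * lam * (q2 / 2) * (q1 / 2))) := by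
      have : Continuous fun η : ℝ => 2 * lam * (q2 / 2 - η) * (q1 / 2 - η) := by fun_prop
      have := this.tendsto 0
      simp only [sub_zero] at this
      exact this.mono_left nhdsWithin_le_nhds
    have ev := ct.eventually (eventually_ge_nhds
      (by linarith : 2 * lam * (q2 / 2) * (q1 / 2) - θ / 4 < 2 * lam * (q2 / 2) * (q1 / 2)))
    have ev2 : ∀ᶠ η in 𝓝[>] (0:ℝ), η ∈ Set.Ioo 0 (q2 / 2) := Ioo_mem_nhdsGT (by positivity)
    have ev3 : ∀ᶠ η in 𝓝[>] (0:ℝ), η ∈ Set.Ioo 0 (q1 / 2) := Ioo_mem_nhdsGT (by positivity)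
    obtain ⟨η, h1, h2, h3⟩ := (ev.and (ev2.and ev3)).exists
    exact ⟨η, h2.1, h2.2.le, h3.2.le, h1⟩
  obtain ⟨η, hη0, hη2, hη1, hηθ⟩ := hη
  set p1 := q2 / 2 - η with hp1
  set p2 := q1 / 2 - η with hp2
  have hp10 : 0 ≤ p1 := by rw [hp1]; linarith
  have hp20 : 0 ≤ p2 := by rw [hp2]; linarith
  set κ := 2 * lam * p1 * p2 with hκ
  set M := max (κ / η) 1 with hM
  have hM1 : 1 ≤ M := le_max_right _ _
  have hM0 : 0 < M := zero_lt_one.trans_le hM1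
  have hMκ : κ ≤ η * M := by
    have : κ / η ≤ M := le_max_left _ _
    rw [div_le_iff₀ hη0] at this
    linarith
  set δ := min 1 (θ / (4 * (K2 + 1))) with hδ
  have hδ0 : 0 < δ := lt_min one_pos (by positivity)
  have hδ1 : δ ≤ 1 := min_le_left _ _
  have hδK : K2 * δ ≤ θ / 4 := by
    have : δ ≤ θ / (4 * (K2 + 1)) := min_le_right _ _
    rw [le_div_iff₀ (by positivity)] at this
    nlinarith
  set Lg := Real.log ((M ^ 2 + lam * (K2 + 2 * p1) * M + 1) / δ ^ 2) with hLg
  set ε := θ / (4 * (|Lg| + 1)) with hε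
  have hε0 : 0 < ε := by positivity
  have hεL : ε * Lg ≤ θ / 4 := by
    have h1 : ε * Lg ≤ ε * (|Lg| + 1) := mul_le_mul_of_nonneg_left
      ((le_abs_self _).trans (by linarith)) hε0.le
    have h2 : ε * (|Lg| + 1) = θ / 4 := by rw [hε]; field_simp
    linarith
  have small : ∀ᶠ n in atTop,
      lam / (2 * ε) * Real.exp ((p1 * M + p2 * M + κ) / ε - 0 / ε) * E n M ≤ Real.exp (-g / ε) := by
    have := (hE0 M hM0).const_mul (lam / (2 * ε) * Real.exp ((p1 * M + p2 * M + κ) / ε - 0 / ε))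
    rw [mul_zero] at this
    exact this.eventually (eventually_le_nhds (Real.exp_pos _))
  filter_upwards [small, eventually_gt_atTop 0] with n hs hn
  rw [← init0 n hn] at hs
  have := (hA n hn).lower hl hp10 hp20 hκ hε0 hη0 hM1 hMκ hδ0 hδ1
    (g := g) (fun x y hx hy => by
      have := lin x y hx hy
      rw [hp1, hp2]
      linarith) (fun t ht => hE n M t hn hM0 ht) hs
  rw [← hLg] at this
  linarith

theorem limit (hl : 0 < lam) (hU : SC K2 ψU FU) (hV : SC K2 ψV FV)
    (Φ a b c d : ℕ → ℝ → ℝ → ℝ → ℝ)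
    (hA : ∀ n, 0 < n → AD lam K2 ψU ψV (Φ n) (a n) (b n) (c n) (d n))
    (E : ℕ → ℝ → ℝ) (hE0 : ∀ M, 0 < M → Tendsto (fun n => E n M) atTop (𝓝 0))
    (hE : ∀ n M t, 0 < n → 0 < M → t ∈ Set.Icc (0:ℝ) 1 →
      I2 M (fun x y => |c n t x y - a n t x y * b n t x y|) ≤ E n M) :
    Tendsto (fun n => Φ n 1 0 0) atTop
      (𝓝 (sSup ((fun q : ℝ × ℝ => rsA lam ψU ψV q.1 q.2) '' GamA lam FU FV))) := by
  have hK : 0 ≤ K2 := (hU.F0 0).trans (hU.FK 0)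
  obtain ⟨q0, hq0, hR⟩ := exists_gam hl hU hV
  have up : ∀ θ > 0, ∀ᶠ n in atTop, Φ n 1 0 0 ≤ rsA lam ψU ψV q0.1 q0.2 + θ := by
    intro θ hθ
    set δ := θ / (2 * (K2 + 1)) with hδ
    have hδ0 : 0 < δ := by positivity
    have hδK : K2 * δ ≤ θ / 2 := by
      have : δ * (2 * (K2 + 1)) = θ := by rw [hδ]; field_simp
      nlinarith
    have small : ∀ᶠ n in atTop, lam / 2 * (E n δ / δ ^ 2) ≤ θ / 2 := by
      have := ((hE0 δ hδ0).div_const (δ ^ 2)).const_mul (lam / 2)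
      rw [zero_div, mul_zero] at this
      exact this.eventually (eventually_le_nhds (by positivity))
    filter_upwards [small, eventually_gt_atTop 0] with n hs hn
    have := (hA n hn).upper hl hδ0 hR (hE n δ 1 hn hδ0 ⟨zero_le_one, le_rfl⟩)
    linarith
  have low := lower_lim hl hU hV Φ a b c d hA E hE0 hE
  have hmax : ∀ q ∈ GamA lam FU FV, rsA lam ψU ψV q.1 q.2 ≤ rsA lam ψU ψV q0.1 q0.2 := by
    intro q hq
    by_contra hc
    push Not at hc
    set θ := (rsA lam ψU ψV q.1 q.2 - rsA lam ψU ψV q0.1 q0.2) / 3 with hθ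
    have hθ0 : 0 < θ := by rw [hθ]; linarith
    obtain ⟨n, h1, h2⟩ := ((up θ hθ0).and (low q hq θ hθ0)).exists
    linarith
  have hS : sSup ((fun q : ℝ × ℝ => rsA lam ψU ψV q.1 q.2) '' GamA lam FU FV)
      = rsA lam ψU ψV q0.1 q0.2 := by
    refine IsGreatest.csSup_eq ⟨⟨q0, hq0, rfl⟩, ?_⟩
    rintro _ ⟨q, hq, rfl⟩
    exact hmax q hq
  rw [hS]
  refine Metric.tendsto_nhds.2 fun θ hθ => ?_
  filter_upwards [up (θ / 2) (by positivity), low q0 hq0 (θ / 2) (by positivity)] with n h1 h2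
  rw [Real.dist_eq, abs_lt]
  constructor <;> linarith

end limit

end MI


namespace MI

section generic
variable {X Y Ω : Type} [Fintype X] [MeasurableSpace X] [MeasurableSingletonClass X]
  [MeasurableSpace Y] [MeasurableSingletonClass Y] [MeasurableSpace Ω]

lemma emb_of_inj (j : X → Y) (hj : Function.Injective j) : MeasurableEmbedding j where
  injective := hj
  measurable := measurable_of_finite j
  measurableSet_image' := fun {s} _ => (s.toFinite.image j).measurableSet

lemma int_map (m : Measure X) [IsProbabilityMeasure m] (j : X → Y) (hj : Function.Injective j)
    (f : Y → ℝ) : ∫ y, f y ∂(m.map j) = ∑ x, m.real {x} * f (j x) := by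
  rw [(emb_of_inj j hj).integral_map, integral_fintype Integrable.of_finite]
  simp only [smul_eq_mul]

lemma int_fin_prod (m : Measure X) [IsProbabilityMeasure m] (ν : Measure Ω) [IsProbabilityMeasure ν]
    (f : X × Ω → ℝ) (hm : ∀ x, Measurable fun z => f (x, z))
    (hi : ∀ x, Integrable (fun z => f (x, z)) ν) :
    ∫ p, f p ∂(m.prod ν) = ∑ x, m.real {x} * ∫ z, f (x, z) ∂ν := by
  have hf : Measurable f := measurable_from_prod_countable_right hm
  have hI : Integrable f (m.prod ν) := by
    rw [integrable_prod_iff hf.aestronglyMeasurable]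
    exact ⟨Eventually.of_forall hi, Integrable.of_finite⟩
  rw [integral_prod _ hI, integral_fintype Integrable.of_finite]
  simp only [smul_eq_mul]

lemma int_map_prod (m : Measure X) [IsProbabilityMeasure m] (j : X → Y) (hj : Function.Injective j)
    (ν : Measure Ω) [IsProbabilityMeasure ν]
    (f : Y × Ω → ℝ) (hm : ∀ x, Measurable fun z => f (j x, z))
    (hi : ∀ x, Integrable (fun z => f (j x, z)) ν) :
    ∫ p, f p ∂((m.map j).prod ν) = ∑ x, m.real {x} * ∫ z, f (j x, z) ∂ν := by
  have he := emb_of_inj j hj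
  have e : (m.map j).prod ν = (m.prod ν).map (Prod.map j id) := by
    rw [← Measure.map_prod_map _ _ he.measurable measurable_id, Measure.map_id]
  have he2 : MeasurableEmbedding (Prod.map j (id : Ω → Ω)) :=
    he.prodMap MeasurableEmbedding.id
  rw [e, he2.integral_map]
  exact int_fin_prod m ν (fun p => f (Prod.map j id p)) hm hi

lemma int_eval {ι : Type} [Fintype ι] (μ : ι → Measure Ω) [∀ i, IsProbabilityMeasure (μ i)] (i : ι)
    (f : Ω → ℝ) (hf : AEStronglyMeasurable f (μ i)) :
    ∫ x, f (x i) ∂(Measure.pi μ) = ∫ a, f a ∂(μ i) := by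
  have h := measurePreserving_eval μ i
  rw [← h.map_eq, integral_map h.measurable.aemeasurable (by rw [h.map_eq]; exact hf)]

end generic

lemma noise_uncurry (n : ℕ) :
    (noiseM n).map (MeasurableEquiv.curry (Fin n) (Fin n) ℝ).symm = gM (Fin n × Fin n) := by
  symm
  refine Measure.pi_eq fun s hs => ?_
  rw [MeasurableEquiv.map_apply]
  have : (MeasurableEquiv.curry (Fin n) (Fin n) ℝ).symm ⁻¹' (Set.univ.pi s)
      = Set.univ.pi fun i => Set.univ.pi fun j => s (i, j) := by
    ext y
    simp only [Set.mem_preimage, Set.mem_univ_pi, Prod.forall]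
    rfl
  rw [this, noiseM, Measure.pi_pi]
  simp only [Measure.pi_pi]
  rw [Fintype.prod_prod_type]

lemma int_noise (n : ℕ) (f : (Fin n → Fin n → ℝ) → ℝ) :
    ∫ z, f z ∂(noiseM n) = ∫ y, f (fun i j => y (i, j)) ∂(gM (Fin n × Fin n)) := by
  rw [← noise_uncurry, integral_map_equiv]
  rfl

section scalar
variable {σ : Type} [Fintype σ] [MeasurableSpace σ] [MeasurableSingletonClass σ]
  (μ : Measure σ) [IsProbabilityMeasure μ] (g : σ → ℝ)

/-- scalar model -/
def sm : Mdl σ Unit where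
  w x := μ.real {x}
  w0 x := measureReal_nonneg
  w1 := by
    have := integral_fintype (μ := μ) (f := fun _ => (1 : ℝ)) Integrable.of_finite
    simpa using this.symm
  φ _ := g

/-- scalar partition function -/
def l1 (r z : ℝ) : ℝ := ∑ a, μ.real {a} * Real.exp (r * g a * z - (r * g a) ^ 2 / 2)

lemma sm_L (r y : Unit → ℝ) : (sm μ g).L r y = l1 μ g (r ()) (y ()) := by
  simp [Mdl.L, Mdl.ex, Mdl.en, sm, l1]

lemma l1_pos (r z : ℝ) : 0 < l1 μ g r z := by
  have := (sm μ g).L_pos (fun _ => r) (fun _ => z)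
  rwa [sm_L] at this

lemma l1_cont (r : ℝ) : Continuous (l1 μ g r) := by unfold l1; fun_prop

lemma logl1_cont (r : ℝ) : Continuous fun z => Real.log (l1 μ g r z) :=
  (l1_cont μ g r).log fun z => (l1_pos μ g r z).ne'

lemma gM_unit (f : ℝ → ℝ) (hf : Measurable f) : ∫ y, f (y ()) ∂(gM Unit) = ∫ z, f z ∂stdG :=
  int_eval (fun _ : Unit => stdG) () f hf.aestronglyMeasurable

lemma gM_int_eval {ι : Type} [Fintype ι] (k : ι) (f : ℝ → ℝ) (hf : Measurable f) :
    ∫ y, f (y k) ∂(gM ι) = ∫ z, f z ∂stdG :=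
  int_eval (fun _ : ι => stdG) k f hf.aestronglyMeasurable

lemma EG.shift {ι : Type} [Fintype ι] {f : (ι → ℝ) → ℝ} (h : EG f) (c : ι → ℝ) :
    EG fun y => f (y + c) := by
  obtain ⟨C, hC, hf⟩ := h
  set A := ∑ k, |c k| with hA
  have hA0 : 0 ≤ A := Finset.sum_nonneg fun _ _ => abs_nonneg _
  refine ⟨C * Real.exp (C * A) , by positivity, fun y => (hf _).trans ?_⟩
  have h1 : ∑ k, |(y + c) k| ≤ ∑ k, |y k| + A := by
    rw [hA, ← Finset.sum_add_distrib]
    exact Finset.sum_le_sum fun k _ => abs_add_le _ _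
  have h0 : 0 ≤ ∑ k, |y k| := Finset.sum_nonneg fun _ _ => abs_nonneg _
  have h2 : (1:ℝ) ≤ Real.exp (C * A) := Real.one_le_exp (by positivity)
  calc C * Real.exp (C * ∑ k, |(y + c) k|)
      ≤ C * Real.exp (C * (∑ k, |y k| + A)) := by gcongr
    _ = C * Real.exp (C * A) * Real.exp (C * ∑ k, |y k|) := by
        rw [mul_assoc, ← Real.exp_add]; ring_nf
    _ ≤ _ := by
        gcongr
        nlinarith

lemma integrable_of_unit (f : ℝ → ℝ) (hf : Measurable f)
    (h : Integrable (fun y : Unit → ℝ => f (y ())) (gM Unit)) : Integrable f stdG := by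
  have hp : MeasurePreserving (Function.eval ()) (gM Unit) stdG :=
    measurePreserving_eval (fun _ : Unit => stdG) ()
  exact (hp.integrable_comp hf.aestronglyMeasurable).1 h

lemma logl1_integrable (r c : ℝ) : Integrable (fun z => Real.log (l1 μ g r (z + c))) stdG := by
  have h := ((sm μ g).nice_logL.eg (fun _ => r)).shift (fun _ => c)
  have hm : Measurable fun z => Real.log (l1 μ g r (z + c)) :=
    ((logl1_cont μ g r).comp (continuous_id.add continuous_const)).measurable
  refine integrable_of_unit _ hm ?_
  have := h.integrable (by
    simp only [sm_L]
    exact hm.comp (measurable_pi_apply ()))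
  simpa only [sm_L, Pi.add_apply] using this

/-- scalar free energy -/
def ps (h : ℝ) : ℝ := (sm μ g).Psi (fun _ => h)
/-- scalar overlap -/
def ov (h : ℝ) : ℝ := (sm μ g).Q g (fun _ => h)

lemma sc_inst {K : ℝ} (hg : ∀ a, |g a| ≤ K) : SC (K ^ 2) (ps μ g) (ov μ g) where
  cψ := (sm μ g).Psi_cont.comp (continuous_pi fun _ => continuous_id)
  cF := ((sm μ g).Q_cont g).comp (continuous_pi fun _ => continuous_id)
  z := (sm μ g).Psi_zero
  F0 h := (sm μ g).Q_nonneg _ _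
  FK h := (sm μ g).Q_le _ K hg _
  tan h h' hh hh' := by
    have := (sm μ g).Psi_tangent (fun _ => h) (fun _ => h') (fun _ => hh) (fun _ => hh')
    simpa [ps, ov, sm] using this

lemma ps_eq (h : ℝ) : ps μ g h = ∑ a, μ.real {a} * ∫ z, Real.log (l1 μ g √h (z + √h * g a)) ∂stdG := by
  rw [ps, Mdl.Psi_eq]
  refine Finset.sum_congr rfl fun a _ => ?_
  congr 1
  rw [← gM_unit (fun z => Real.log (l1 μ g √h (z + √h * g a)))
    ((logl1_cont μ g _).comp (continuous_id.add continuous_const)).measurable]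
  simp only [sm_L, Mdl.rt, Pi.add_apply]
  rfl

/-- scalar numerator -/
def s1 (r z : ℝ) : ℝ := ∑ a, μ.real {a} * g a * Real.exp (r * g a * z - (r * g a) ^ 2 / 2)

lemma sm_S (r y : Unit → ℝ) : (sm μ g).S g r y = s1 μ g (r ()) (y ()) := by
  simp [Mdl.S, Mdl.ex, Mdl.en, sm, s1]

lemma s1_cont (r : ℝ) : Continuous (s1 μ g r) := by unfold s1; fun_prop

lemma mean_cont (r : ℝ) : Continuous fun z => s1 μ g r z / l1 μ g r z :=
  (s1_cont μ g r).div (l1_cont μ g r) fun z => (l1_pos μ g r z).ne'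

lemma mean_integrable (r c : ℝ) :
    Integrable (fun z => s1 μ g r (z + c) / l1 μ g r (z + c)) stdG := by
  have h := (((sm μ g).nice_mn g).eg (fun _ => r)).shift (fun _ => c)
  have hm : Measurable fun z => s1 μ g r (z + c) / l1 μ g r (z + c) :=
    ((mean_cont μ g r).comp (continuous_id.add continuous_const)).measurable
  refine integrable_of_unit _ hm ?_
  have := h.integrable (by
    simp only [Mdl.mn, sm_L, sm_S, ← div_eq_mul_inv]
    exact hm.comp (measurable_pi_apply ()))
  simpa only [Mdl.mn, sm_L, sm_S, ← div_eq_mul_inv, Pi.add_apply] using this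

lemma ov_eq (h : ℝ) : ov μ g h = ∑ a, μ.real {a} *
    (g a * ∫ z, s1 μ g √h (z + √h * g a) / l1 μ g √h (z + √h * g a) ∂stdG) := by
  have e : ∀ a, g a * ∫ z, s1 μ g √h (z + √h * g a) / l1 μ g √h (z + √h * g a) ∂stdG
      = ∫ y, g a * ((sm μ g).ex (fun _ => √h) y a * (sm μ g).mn g (fun _ => √h) y) ∂(gM Unit) := by
    intro a
    rw [integral_const_mul]
    congr 1
    rw [← gM_unit (fun z => s1 μ g √h (z + √h * g a) / l1 μ g √h (z + √h * g a))
      ((mean_cont μ g _).comp (continuous_id.add continuous_const)).measurable]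
    have := gM_shift (fun _ : Unit => √h * g a) ((sm μ g).mn g (fun _ => √h))
      (((sm μ g).nice_mn g).cont _).measurable
    simp only [Mdl.mn, sm_L, sm_S, ← div_eq_mul_inv, Pi.add_apply] at this ⊢
    rw [this]
    rfl
  simp only [e, ← integral_const_mul]
  rw [← integral_finsetSum]
  · rw [ov, Mdl.Q]
    congr 1; ext y
    have : ∀ a, μ.real {a} * (g a * ((sm μ g).ex (fun _ => √h) y a * (sm μ g).mn g (fun _ => √h) y))
      = (sm μ g).w a * g a * (sm μ g).ex (fun _ => √h) y a * (sm μ g).mn g (fun _ => √h) y := by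
      intro a; simp only [sm]; ring
    simp only [this]
    rw [← Finset.sum_mul]
    change _ = (sm μ g).S g (fun _ => √h) y * _
    rw [Mdl.mn, sq, mul_assoc]; rfl
  · intro a _
    refine Integrable.const_mul (Integrable.const_mul ?_ _) _
    exact ((((sm μ g).nice_ex a).mul ((sm μ g).nice_mn g)).eg _).integrable
      ((((sm μ g).nice_ex a).mul ((sm μ g).nice_mn g)).cont _).measurable

end scalar

section ident
variable {σ : Type} [Fintype σ] [MeasurableSpace σ] [MeasurableSingletonClass σ]
  (μ : Measure σ) [IsProbabilityMeasure μ] (g : σ → ℝ)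
  (P : Measure ℝ) [IsProbabilityMeasure P]

lemma scalarWeight_eq {h : ℝ} (hh : 0 ≤ h) (x0 z x : ℝ) : scalarWeight h x0 z x
    = Real.exp (√h * x * (z + √h * x0) - (√h * x) ^ 2 / 2) := by
  unfold scalarWeight
  congr 1
  have := Real.sq_sqrt hh
  linear_combination (-x * x0 + x^2/2) * this

lemma int_sw (hg : Function.Injective g) (hP : P = μ.map g) {h : ℝ} (hh : 0 ≤ h) (x0 z : ℝ) :
    ∫ x, scalarWeight h x0 z x ∂P = l1 μ g √h (z + √h * x0) := by
  rw [hP, int_map μ g hg]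
  simp only [scalarWeight_eq hh, l1]

lemma int_xsw (hg : Function.Injective g) (hP : P = μ.map g) {h : ℝ} (hh : 0 ≤ h) (x0 z : ℝ) :
    ∫ x, x * scalarWeight h x0 z x ∂P = s1 μ g √h (z + √h * x0) := by
  rw [hP, int_map μ g hg]
  simp only [scalarWeight_eq hh, s1, mul_assoc]

lemma logl1_meas (r c : ℝ) : Measurable fun z => Real.log (l1 μ g r (z + c)) :=
  ((logl1_cont μ g r).comp (continuous_id.add continuous_const)).measurable

lemma mean_meas (r c : ℝ) : Measurable fun z => s1 μ g r (z + c) / l1 μ g r (z + c) :=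
  ((mean_cont μ g r).comp (continuous_id.add continuous_const)).measurable

lemma psiF_eq (hg : Function.Injective g) (hP : P = μ.map g) {h : ℝ} (hh : 0 ≤ h) :
    psiF P h = ps μ g h := by
  unfold psiF
  simp only [int_sw μ g P hg hP hh]
  have : P.prod stdG = (μ.map g).prod stdG := by rw [hP]
  rw [this, int_map_prod μ g hg, ps_eq]
  · intro x
    exact logl1_meas μ g √h (√h * g x)
  · intro x
    exact logl1_integrable μ g √h (√h * g x)

lemma Fov_eq (hg : Function.Injective g) (hP : P = μ.map g) {h : ℝ} (hh : 0 ≤ h) :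
    Fov P h = ov μ g h := by
  unfold Fov postMean
  simp only [int_sw μ g P hg hP hh, int_xsw μ g P hg hP hh]
  have : P.prod stdG = (μ.map g).prod stdG := by rw [hP]
  rw [this, int_map_prod μ g hg, ov_eq]
  · simp only [integral_const_mul]
  · intro x
    exact (mean_meas μ g √h (√h * g x)).const_mul (g x)
  · intro x
    exact (mean_integrable μ g √h (√h * g x)).const_mul (g x)

end ident
end MI


namespace MI
namespace Bip

variable {σ : Type} [Fintype σ] [MeasurableSpace σ] [MeasurableSingletonClass σ]
  (μU μV : Measure σ) [IsProbabilityMeasure μU] [IsProbabilityMeasure μV] (g : σ → ℝ) (n : ℕ)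

/-- side SNRs -/
def hv (h1 h2 : ℝ) : Fin n ⊕ Fin n → ℝ := Sum.elim (fun _ => h1) (fun _ => h2)

lemma bm_phi (k : Fin n ⊕ Fin n) (x : Fin n ⊕ Fin n → σ) :
    (bm μU μV g n).φ (Sum.inr k) x = g (x k) := by
  cases k <;> rfl

lemma sv_inr (lam h1 h2 : ℝ) (k : Fin n ⊕ Fin n) :
    Mdl.rt (sv n lam 0 h1 h2) (Sum.inr k) = √(hv n h1 h2 k) := by
  cases k <;> rfl

lemma sv_inl (lam h1 h2 : ℝ) (k : Fin n × Fin n) :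
    Mdl.rt (sv n lam 0 h1 h2) (Sum.inl k) = 0 := by
  simp [Mdl.rt, sv]

lemma bm_L0 (lam h1 h2 : ℝ) (y : Ix n → ℝ) :
    (bm μU μV g n).L (Mdl.rt (sv n lam 0 h1 h2)) y
      = ∏ k, l1 (mus μU μV n k) g √(hv n h1 h2 k) (y (Sum.inr k)) := by
  classical
  unfold l1
  rw [Fintype.prod_sum, Mdl.L]
  refine Finset.sum_congr rfl fun x _ => ?_
  rw [Finset.prod_mul_distrib, ← Real.exp_sum, Mdl.ex, Mdl.en, Fintype.sum_sum_type]
  simp only [sv_inl, sv_inr, bm_phi]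
  congr 1
  · change (Measure.pi (mus μU μV n)).real {x} = _
    simp only [Measure.real, Measure.pi_singleton, ENNReal.toReal_prod]
  · congr 1
    simp

/-- scalar expected log -/
def Gk (h1 h2 : ℝ) (k : Fin n ⊕ Fin n) (a : σ) : ℝ :=
  ∫ z, Real.log (l1 (mus μU μV n k) g √(hv n h1 h2 k) (z + √(hv n h1 h2 k) * g a)) ∂stdG

lemma eval_integrable {ι : Type} [Fintype ι] (k : ι) (f : ℝ → ℝ) (hf : Integrable f stdG) :
    Integrable (fun y : ι → ℝ => f (y k)) (gM ι) := by
  have hp : MeasurePreserving (Function.eval k) (gM ι) stdG :=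
    measurePreserving_eval (fun _ : ι => stdG) k
  exact hp.integrable_comp_of_integrable hf

lemma Ph_init (hn : 0 < n) (lam h1 h2 : ℝ) :
    Ph μU μV g n lam 0 h1 h2 = ps μU g h1 + ps μV g h2 := by
  have hn' : (0 : ℝ) < n := by exact_mod_cast hn
  have key : (bm μU μV g n).Psi (sv n lam 0 h1 h2)
      = ∑ k, ps (mus μU μV n k) g (hv n h1 h2 k) := by
    rw [Mdl.Psi_eq]
    have e : ∀ x, ∫ z, Real.log ((bm μU μV g n).L (Mdl.rt (sv n lam 0 h1 h2))
        (z + fun k => Mdl.rt (sv n lam 0 h1 h2) k * (bm μU μV g n).φ k x)) ∂(gM (Ix n))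
        = ∑ k, Gk μU μV g n h1 h2 k (x k) := by
      intro x
      have e1 : ∀ z : Ix n → ℝ, Real.log ((bm μU μV g n).L (Mdl.rt (sv n lam 0 h1 h2))
        (z + fun k => Mdl.rt (sv n lam 0 h1 h2) k * (bm μU μV g n).φ k x))
        = ∑ k, Real.log (l1 (mus μU μV n k) g √(hv n h1 h2 k)
            (z (Sum.inr k) + √(hv n h1 h2 k) * g (x k))) := by
        intro z
        rw [bm_L0, Real.log_prod (fun k _ => (l1_pos _ _ _ _).ne')]
        simp only [Pi.add_apply, sv_inr, bm_phi]
      simp only [e1]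
      rw [integral_finsetSum]
      · refine Finset.sum_congr rfl fun k _ => ?_
        exact gM_int_eval (Sum.inr k) (fun z => Real.log (l1 (mus μU μV n k) g √(hv n h1 h2 k)
            (z + √(hv n h1 h2 k) * g (x k)))) (logl1_meas _ _ _ _)
      · intro k _
        exact eval_integrable (Sum.inr k) (fun z => Real.log (l1 (mus μU μV n k) g √(hv n h1 h2 k)
            (z + √(hv n h1 h2 k) * g (x k)))) (logl1_integrable _ _ _ _)
    simp only [e, Finset.mul_sum]
    rw [Finset.sum_comm]
    refine Finset.sum_congr rfl fun k _ => ?_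
    have h := int_eval (mus μU μV n) k (Gk μU μV g n h1 h2 k)
      (measurable_of_finite _).aestronglyMeasurable
    rw [integral_fintype Integrable.of_finite, integral_fintype Integrable.of_finite] at h
    simp only [smul_eq_mul] at h
    rw [ps_eq]
    exact h
  have a1 : ∑ i, ps (mus μU μV n (Sum.inl i)) g (hv n h1 h2 (Sum.inl i))
      = ∑ _i : Fin n, ps μU g h1 := rfl
  have a2 : ∑ i, ps (mus μU μV n (Sum.inr i)) g (hv n h1 h2 (Sum.inr i))
      = ∑ _i : Fin n, ps μV g h2 := rfl
  rw [Ph, key, Fintype.sum_sum_type, a1, a2]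
  simp only [Finset.sum_const, Finset.card_univ, Fintype.card_fin, nsmul_eq_mul]
  field_simp

lemma ad_inst (hn : 0 < n) {lam K : ℝ} (hl : 0 < lam) (hg : ∀ a, |g a| ≤ K) :
    AD lam (K ^ 2) (ps μU g) (ps μV g) (Ph μU μV g n lam) (qa μU μV g n lam)
      (qb μU μV g n lam) (qc μU μV g n lam) (db μU μV g n lam) where
  cΦ := Ph_cont μU μV g n lam
  ca := qa_cont μU μV g n lam
  cb := qb_cont μU μV g n lam
  cc := qc_cont μU μV g n lam
  cd := db_cont μU μV g n lam
  a0 := qa_nonneg μU μV g n lam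
  aK := qa_le μU μV g n hg lam
  b0 := qb_nonneg μU μV g n lam
  bK := qb_le μU μV g n hg lam
  c0 := qc_nonneg μU μV g n lam
  d0 := db_nonneg μU μV g n lam
  tan t x y t' x' y' ht hx hy ht' hx' hy' := Ph_tangent μU μV g n hn hl.le ht hx hy ht' hx' hy'
  dT t x y ht := Ph_dT μU μV g n hn hl ht x y
  d1 t x y hx := Ph_d1 μU μV g n hx lam t y
  d2 t x y hy := Ph_d2 μU μV g n hy lam t x
  db1 t x y hx := qb_d1 μU μV g n hx lam t y
  start0 x y _ _ := Ph_init μU μV g n hn lam x y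

theorem Ph_limit {lam K : ℝ} (hl : 0 < lam) (hK : 0 ≤ K) (hg : ∀ a, |g a| ≤ K) :
    Tendsto (fun n => Ph μU μV g n lam 1 0 0) atTop
      (𝓝 (sSup ((fun q : ℝ × ℝ => rsA lam (ps μU g) (ps μV g) q.1 q.2) ''
        GamA lam (ov μU g) (ov μV g)))) := by
  refine limit hl (sc_inst μU g hg) (sc_inst μV g hg) (fun n => Ph μU μV g n lam)
    (fun n => qa μU μV g n lam) (fun n => qb μU μV g n lam) (fun n => qc μU μV g n lam)
    (fun n => db μU μV g n lam) (fun n hn => ad_inst μU μV g n hn hl hg)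
    (fun n M => CE K lam M / √√(n:ℝ)) ?_ ?_
  · intro M _
    have : Tendsto (fun n : ℕ => √√(n:ℝ)) atTop atTop :=
      Real.tendsto_sqrt_atTop.comp (Real.tendsto_sqrt_atTop.comp tendsto_natCast_atTop_atTop)
    exact this.const_div_atTop _
  · intro n M t hn hM ht
    exact err_int μU μV g n hg hK hn hl.le ht.1 ht.2 hM.le

/-- embedding of the finite configuration space -/
def jm (x : Fin n ⊕ Fin n → σ) : (Fin n → ℝ) × (Fin n → ℝ) :=
  (fun i => fu g n i x, fun j => fv g n j x)

lemma jm_inj (hg : Function.Injective g) : Function.Injective (jm g n) := by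
  intro x y h
  rw [jm, jm, Prod.mk.injEq] at h
  ext k
  rcases k with k | k
  · exact hg (congrFun h.1 k)
  · exact hg (congrFun h.2 k)

lemma prior_eq (PU PV : Measure ℝ) [IsProbabilityMeasure PU] [IsProbabilityMeasure PV]
    (hU : PU = μU.map g) (hV : PV = μV.map g) :
    prior PU PV n = (Measure.pi (mus μU μV n)).map (jm g n) := by
  have hgm : Measurable g := measurable_of_finite g
  have iU : IsProbabilityMeasure (μU.map g) := by rw [← hU]; infer_instance
  have iV : IsProbabilityMeasure (μV.map g) := by rw [← hV]; infer_instance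
  have h1 : (Measure.pi fun _ : Fin n => PU)
      = (Measure.pi fun _ : Fin n => μU).map (fun x i => g (x i)) := by
    rw [Measure.pi_map_pi (f := fun _ => g) (fun i => hgm.aemeasurable), hU]
  have h2 : (Measure.pi fun _ : Fin n => PV)
      = (Measure.pi fun _ : Fin n => μV).map (fun x i => g (x i)) := by
    rw [Measure.pi_map_pi (f := fun _ => g) (fun i => hgm.aemeasurable), hV]
  have h3 := (measurePreserving_sumPiEquivProdPi (mus μU μV n)).map_eq
  have h4 : ((Measure.pi fun i => mus μU μV n (Sum.inl i)).prod
      (Measure.pi fun i => mus μU μV n (Sum.inr i)))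
      = (Measure.pi fun _ : Fin n => μU).prod (Measure.pi fun _ : Fin n => μV) := rfl
  rw [prior, h1, h2, Measure.map_prod_map _ _ (by fun_prop) (by fun_prop), ← h4, ← h3,
    Measure.map_map (by fun_prop) (MeasurableEquiv.measurable _)]
  rfl

/-- model without side channels -/
def m0 : Mdl (Fin n ⊕ Fin n → σ) (Fin n × Fin n) where
  w := (bm μU μV g n).w
  w0 := (bm μU μV g n).w0
  w1 := (bm μU μV g n).w1
  φ p x := fu g n p.1 x * fv g n p.2 x

lemma Ph_m0 (lam : ℝ) : Ph μU μV g n lam 1 0 0 = (m0 μU μV g n).Psi (fun _ => lam / n) / n := by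
  have e : bm μU μV g n = (m0 μU μV g n).ext (Sum.elim (fu g n) (fv g n)) := rfl
  have e2 : sv n lam 1 0 0 = Sum.elim (fun _ => lam / n) 0 := by
    ext k
    rcases k with k | k | k <;> simp [sv]
  rw [Ph, e, e2, Mdl.ext_Psi_zero]

/-- reference density -/
def cD (Y : Fin n → Fin n → ℝ) : ℝ :=
  ∏ i : Fin n, ∏ j : Fin n, Real.exp (-(Y i j) ^ 2 / 2) / √(2 * Real.pi)

lemma cD_pos (Y : Fin n → Fin n → ℝ) : 0 < cD n Y :=
  Finset.prod_pos fun i _ => Finset.prod_pos fun j _ => by positivity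

lemma condDens_eq (lam : ℝ) (x : Fin n ⊕ Fin n → σ) (Y : Fin n → Fin n → ℝ) :
    condDens lam n (jm g n x).1 (jm g n x).2 Y
      = cD n Y * (m0 μU μV g n).ex (fun _ => √(lam / n)) (fun p => Y p.1 p.2) x := by
  rw [condDens, cD, Mdl.ex, Mdl.en, Real.exp_sum, Fintype.prod_prod_type,
    ← Finset.prod_mul_distrib]
  refine Finset.prod_congr rfl fun i _ => ?_
  rw [← Finset.prod_mul_distrib]
  refine Finset.prod_congr rfl fun j _ => ?_
  rw [div_mul_eq_mul_div, ← Real.exp_add]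
  congr 2
  simp only [jm, m0]
  ring

end Bip
end MI


namespace MI
namespace Bip

lemma int_id_stdG : ∫ z, z ∂stdG = 0 := by
  rw [stdG]; exact integral_id_gaussianReal

lemma integrable_id_stdG : Integrable (fun z : ℝ => z) stdG :=
  memLp_id_stdG.integrable (by norm_num)

variable {σ : Type} [Fintype σ] [MeasurableSpace σ] [MeasurableSingletonClass σ]
  (μU μV : Measure σ) [IsProbabilityMeasure μU] [IsProbabilityMeasure μV] (g : σ → ℝ) (n : ℕ)

lemma int_en {X ι : Type} [Fintype X] [Fintype ι] (m : Mdl X ι) (r : ι → ℝ) (x : X) :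
    Integrable (fun z => m.en r (z + fun k => r k * m.φ k x) x) (gM ι) ∧
    ∫ z, m.en r (z + fun k => r k * m.φ k x) x ∂(gM ι) = ∑ k, (r k * m.φ k x) ^ 2 / 2 := by
  have e : ∀ z : ι → ℝ, m.en r (z + fun k => r k * m.φ k x) x
      = ∑ k, (r k * m.φ k x * z k + (r k * m.φ k x) ^ 2 / 2) := by
    intro z
    rw [Mdl.en]
    refine Finset.sum_congr rfl fun k _ => ?_
    rw [Pi.add_apply]; ring
  simp only [e]
  have hi : ∀ k, Integrable (fun z : ι → ℝ => r k * m.φ k x * z k) (gM ι) := fun k =>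
    (eval_integrable k (fun z => z) integrable_id_stdG).const_mul _
  have hi2 : ∀ k, Integrable (fun z : ι → ℝ => r k * m.φ k x * z k + (r k * m.φ k x) ^ 2 / 2)
    (gM ι) := fun k => (hi k).add (integrable_const _)
  refine ⟨integrable_finsetSum _ fun k _ => hi2 k, ?_⟩
  rw [integral_finsetSum _ fun k _ => hi2 k]
  refine Finset.sum_congr rfl fun k _ => ?_
  rw [integral_add (hi k) (integrable_const _), integral_const_mul,
    gM_int_eval k (fun z => z) measurable_id, int_id_stdG]
  simp

theorem mutInfo_eq (hg : Function.Injective g) (hn : 0 < n) {lam : ℝ} (hl : 0 < lam)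
    (PU PV : Measure ℝ) [IsProbabilityMeasure PU] [IsProbabilityMeasure PV]
    (hU : PU = μU.map g) (hV : PV = μV.map g) :
    (1 / (n : ℝ)) * mutInfo PU PV lam n
      = lam / 2 * ((∫ x, x ^ 2 ∂PU) * (∫ x, x ^ 2 ∂PV)) - Ph μU μV g n lam 1 0 0 := by
  have hn' : (0 : ℝ) < n := by exact_mod_cast hn
  set M := m0 μU μV g n with hM
  set r : Fin n × Fin n → ℝ := fun _ => √(lam / n) with hr
  have hrt : Mdl.rt (fun _ : Fin n × Fin n => lam / n) = r := rfl
  have hpr := prior_eq μU μV g n PU PV hU hV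
  have hj := jm_inj g n hg
  have hden : ∀ Y : Fin n → Fin n → ℝ, ∫ uv, condDens lam n uv.1 uv.2 Y ∂(prior PU PV n)
      = cD n Y * M.L r (fun p => Y p.1 p.2) := by
    intro Y
    rw [hpr, int_map _ _ hj]
    simp only [condDens_eq μU μV g n, Mdl.L, Finset.mul_sum]
    refine Finset.sum_congr rfl fun x _ => ?_
    change (Measure.pi (mus μU μV n)).real {x} * _
      = _ * ((Measure.pi (mus μU μV n)).real {x} * _)
    ring
  have hYm : ∀ x (z : Fin n → Fin n → ℝ), (fun p : Fin n × Fin n => Ymat lam n (jm g n x, z) p.1 p.2)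
      = (fun p => z p.1 p.2) + fun p => r p * M.φ p x := by
    intro x z
    ext p
    simp only [Ymat, jm, Pi.add_apply, hr, hM, m0]
    ring
  have h_integ : ∀ x (z : Fin n → Fin n → ℝ),
      Real.log (condDens lam n (jm g n x).1 (jm g n x).2 (Ymat lam n (jm g n x, z))
      / ∫ uv, condDens lam n uv.1 uv.2 (Ymat lam n (jm g n x, z)) ∂(prior PU PV n))
      = M.en r ((fun p => z p.1 p.2) + fun p => r p * M.φ p x) x
        - Real.log (M.L r ((fun p => z p.1 p.2) + fun p => r p * M.φ p x)) := by
    intro x z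
    rw [hden, condDens_eq μU μV g n, mul_div_mul_left _ _ (cD_pos n _).ne',
      Real.log_div (M.ex_pos _ _ _).ne' (M.L_pos _ _).ne', hYm, Mdl.ex, Real.log_exp]
  have hcont : ∀ x, Continuous fun z : Fin n → Fin n → ℝ =>
      M.en r ((fun p => z p.1 p.2) + fun p => r p * M.φ p x) x
        - Real.log (M.L r ((fun p => z p.1 p.2) + fun p => r p * M.φ p x)) := by
    intro x
    have h1 : Continuous fun z : Fin n → Fin n → ℝ =>
      ((fun p => z p.1 p.2) + fun p => r p * M.φ p x : Fin n × Fin n → ℝ) := by fun_prop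
    refine Continuous.sub ?_ ((M.nice_logL.cont r).comp h1)
    exact (M.en_cont x).comp (continuous_const.prodMk h1)
  have hIg : ∀ x, Integrable (fun y : Fin n × Fin n → ℝ => M.en r (y + fun p => r p * M.φ p x) x
        - Real.log (M.L r (y + fun p => r p * M.φ p x))) (gM (Fin n × Fin n)) ∧
      ∫ y, (M.en r (y + fun p => r p * M.φ p x) x
        - Real.log (M.L r (y + fun p => r p * M.φ p x))) ∂(gM (Fin n × Fin n))
      = ∑ k, (r k * M.φ k x) ^ 2 / 2
        - ∫ y, Real.log (M.L r (y + fun p => r p * M.φ p x)) ∂(gM (Fin n × Fin n)) := by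
    intro x
    have h1 := int_en M r x
    have h2 : Integrable (fun y : Fin n × Fin n → ℝ => Real.log (M.L r (y + fun p => r p * M.φ p x)))
      (gM (Fin n × Fin n)) :=
      ((M.nice_logL.eg r).shift _).integrable
        ((M.nice_logL.cont r).comp (continuous_id.add continuous_const)).measurable
    exact ⟨h1.1.sub h2, by rw [integral_sub h1.1 h2, h1.2]⟩
  have hIn : ∀ x, Integrable (fun z : Fin n → Fin n → ℝ =>
      M.en r ((fun p => z p.1 p.2) + fun p => r p * M.φ p x) x
        - Real.log (M.L r ((fun p => z p.1 p.2) + fun p => r p * M.φ p x))) (noiseM n) := by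
    intro x
    have hp : MeasurePreserving (MeasurableEquiv.curry (Fin n) (Fin n) ℝ).symm (noiseM n)
      (gM (Fin n × Fin n)) := ⟨MeasurableEquiv.measurable _, noise_uncurry n⟩
    exact hp.integrable_comp_of_integrable (hIg x).1
  haveI : IsProbabilityMeasure (noiseM n) := by unfold noiseM; unfold stdG; infer_instance
  have hmut : mutInfo PU PV lam n
      = ∑ x, M.w x * (∑ k, (r k * M.φ k x) ^ 2 / 2) - M.Psi (fun _ => lam / n) := by
    rw [mutInfo, sampleM]
    have e : (prior PU PV n).prod (noiseM n)
      = ((Measure.pi (mus μU μV n)).map (jm g n)).prod (noiseM n) := by rw [hpr]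
    rw [e, int_map_prod _ _ hj]
    · simp only [h_integ]
      rw [Mdl.Psi_eq, hrt, ← Finset.sum_sub_distrib]
      refine Finset.sum_congr rfl fun x _ => ?_
      rw [← mul_sub, int_noise, ← (hIg x).2]
      rfl
    · intro x
      simp only [h_integ]
      exact (hcont x).measurable
    · intro x
      simp only [h_integ]
      exact hIn x
  have hmom : ∀ p : Fin n × Fin n, ∑ x, M.w x * M.φ p x ^ 2
      = (∫ x, x ^ 2 ∂PU) * (∫ x, x ^ 2 ∂PV) := by
    intro p
    have h1 := int_map (Measure.pi (mus μU μV n)) (jm g n) hj (fun q => q.1 p.1 ^ 2 * q.2 p.2 ^ 2)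
    rw [← hpr, prior, integral_prod_mul (fun q : Fin n → ℝ => q p.1 ^ 2)
      (fun q : Fin n → ℝ => q p.2 ^ 2),
      int_eval (fun _ : Fin n => PU) p.1 (fun x => x ^ 2) (by fun_prop),
      int_eval (fun _ : Fin n => PV) p.2 (fun x => x ^ 2) (by fun_prop)] at h1
    rw [h1]
    refine Finset.sum_congr rfl fun x _ => ?_
    simp only [hM, m0, jm, mul_pow]
    rfl
  have hsum : ∑ x, M.w x * (∑ k, (r k * M.φ k x) ^ 2 / 2)
      = n * (lam / 2 * ((∫ x, x ^ 2 ∂PU) * (∫ x, x ^ 2 ∂PV))) := by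
    have e : ∀ x, M.w x * (∑ k, (r k * M.φ k x) ^ 2 / 2)
        = ∑ k, lam / n / 2 * (M.w x * M.φ k x ^ 2) := by
      intro x
      rw [Finset.mul_sum]
      refine Finset.sum_congr rfl fun k _ => ?_
      simp only [hr]
      rw [mul_pow, Real.sq_sqrt (by positivity)]
      ring
    simp only [e]
    rw [Finset.sum_comm]
    simp only [← Finset.mul_sum, hmom]
    simp only [Finset.sum_const, Finset.card_univ, Fintype.card_prod, Fintype.card_fin,
      nsmul_eq_mul, Nat.cast_mul]
    field_simp
  rw [hmut, hsum, Ph_m0, ← hM]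
  field_simp

end Bip

theorem final (K₀ : ℝ) (S : Finset ℝ) (hSK : ∀ x ∈ S, |x| ≤ K₀)
    (PU PV : Measure ℝ) [IsProbabilityMeasure PU] [IsProbabilityMeasure PV]
    (hUS : PU ((↑S : Set ℝ)ᶜ) = 0) (hVS : PV ((↑S : Set ℝ)ᶜ) = 0)
    (lam : ℝ) (hlam : 0 < lam) :
    Tendsto (fun n : ℕ => (1 / (n : ℝ)) * mutInfo PU PV lam n) atTop
      (𝓝 (lam / 2 * ((∫ x, x ^ 2 ∂PU) * (∫ x, x ^ 2 ∂PV))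
        - sSup ((fun q : ℝ × ℝ => rsF PU PV lam q.1 q.2) '' Gam PU PV lam))) := by
  have hSm : MeasurableSet (↑S : Set ℝ) := S.measurableSet
  have hemb : MeasurableEmbedding (Subtype.val : {x // x ∈ S} → ℝ) :=
    MeasurableEmbedding.subtype_coe hSm
  have hmap : ∀ (P : Measure ℝ), P ((↑S : Set ℝ)ᶜ) = 0 →
      P = (P.comap (Subtype.val : {x // x ∈ S} → ℝ)).map Subtype.val := by
    intro P hP
    rw [hemb.map_comap]
    have : Set.range (Subtype.val : {x // x ∈ S} → ℝ) = (↑S : Set ℝ) := by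
      ext x; simp
    rw [this, Measure.restrict_eq_self_of_ae_mem]
    exact hP
  have hprob : ∀ (P : Measure ℝ) [IsProbabilityMeasure P], P ((↑S : Set ℝ)ᶜ) = 0 →
      IsProbabilityMeasure (P.comap (Subtype.val : {x // x ∈ S} → ℝ)) := by
    intro P _ hP
    refine ⟨?_⟩
    have h := congrArg (fun m : Measure ℝ => m Set.univ) (hmap P hP)
    rw [measure_univ, Measure.map_apply hemb.measurable MeasurableSet.univ, Set.preimage_univ] at h
    exact h.symm
  set μU := PU.comap (Subtype.val : {x // x ∈ S} → ℝ) with hμU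
  set μV := PV.comap (Subtype.val : {x // x ∈ S} → ℝ) with hμV
  haveI : IsProbabilityMeasure μU := hprob PU hUS
  haveI : IsProbabilityMeasure μV := hprob PV hVS
  have hU : PU = μU.map Subtype.val := hmap PU hUS
  have hV : PV = μV.map Subtype.val := hmap PV hVS
  set g : {x // x ∈ S} → ℝ := Subtype.val with hgdef
  have hg : Function.Injective g := Subtype.val_injective
  have hgK : ∀ a, |g a| ≤ |K₀| := fun a => (hSK _ a.2).trans (le_abs_self _)
  have lim := Bip.Ph_limit μU μV g hlam (abs_nonneg K₀) hgK
  have hGam : Gam PU PV lam = GamA lam (ov μU g) (ov μV g) := by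
    ext q
    simp only [Gam, GamA, Set.mem_setOf_eq]
    refine and_congr_right fun h1 => and_congr_right fun h2 => ?_
    rw [Fov_eq μU g PU hg hU (mul_nonneg hlam.le h1), Fov_eq μV g PV hg hV (mul_nonneg hlam.le h2)]
  have himg : (fun q : ℝ × ℝ => rsF PU PV lam q.1 q.2) '' Gam PU PV lam
      = (fun q : ℝ × ℝ => rsA lam (ps μU g) (ps μV g) q.1 q.2) '' GamA lam (ov μU g) (ov μV g) := by
    rw [hGam]
    refine Set.image_congr fun q hq => ?_
    simp only [rsF, rsA]
    rw [psiF_eq μU g PU hg hU (mul_nonneg hlam.le hq.1),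
      psiF_eq μV g PV hg hV (mul_nonneg hlam.le hq.2.1)]
  rw [himg]
  refine (lim.const_sub _).congr' ?_
  filter_upwards [eventually_gt_atTop 0] with n hn
  exact (Bip.mutInfo_eq μU μV g n hg hn hlam PU PV hU hV).symm

end MI


/-- **Limit of the mutual information.** -/
theorem mutual_information_limit
    (K₀ : ℝ) (S : Finset ℝ) (hSK : ∀ x ∈ S, |x| ≤ K₀)
    (PU PV : Measure ℝ) [IsProbabilityMeasure PU] [IsProbabilityMeasure PV]
    (hUS : PU ((↑S : Set ℝ)ᶜ) = 0) (hVS : PV ((↑S : Set ℝ)ᶜ) = 0)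
    (hUvar : 0 < (∫ x, x ^ 2 ∂PU) - (∫ x, x ∂PU) ^ 2)
    (hVvar : 0 < (∫ x, x ^ 2 ∂PV) - (∫ x, x ∂PV) ^ 2)
    (lam : ℝ) (hlam : 0 < lam) :
    Tendsto (fun n : ℕ => (1 / (n : ℝ)) * mutInfo PU PV lam n) atTop
      (𝓝 (lam / 2 * ((∫ x, x ^ 2 ∂PU) * (∫ x, x ^ 2 ∂PV))
        - sSup ((fun q : ℝ × ℝ => rsF PU PV lam q.1 q.2) '' Gam PU PV lam))) := by
  exact MI.final K₀ S hSK PU PV hUS hVS lam hlam
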